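/- Let H be a complex Hilbert space and let A, B be C*-subalgebras of B(H) acting nondegenerately with d(A,B) < γ for some γ < 1/(2+6√2). Suppose A has no nonzero bounded trace. Then B has no nonzero bounded trace, and moreover d(Mₙ(A), Mₙ(B)) < 6γ for every n ∈ ℕ. -/

import Mathlib

open Filter Topology Metric ComplexOrder

variable {H : Type*} [NormedAddCommGroup H] [InnerProductSpace ℂ H] [CompleteSpace H]

/-- The Kadison–Kastler distance between two subsets of a C*-algebra: the Hausdorff
distance between their closed unit balls. -/
noncomputable def KKdist {E : Type*} [NormedAddCommGroup E] (S T : Set E) : ℝ :=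
  hausdorffDist (S ∩ closedBall 0 1) (T ∩ closedBall 0 1)

/-- A subalgebra of `B(H)` acts nondegenerately if the closed linear span of
`{a ξ : a ∈ A, ξ ∈ H}` is all of `H`. -/
def Nondegenerate (A : NonUnitalStarSubalgebra ℂ (H →L[ℂ] H)) : Prop :=
  Dense (↑(Submodule.span ℂ {v : H | ∃ a ∈ A, ∃ ξ : H, v = a ξ}) : Set H)

/-- The operator on the `n`-fold Hilbert space direct sum `Hⁿ` given by an `n × n`
matrix of operators on `H`. -/
noncomputable def matrixOp {n : ℕ} (a : Fin n → Fin n → (H →L[ℂ] H)) :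
    (PiLp 2 fun _ : Fin n => H) →L[ℂ] (PiLp 2 fun _ : Fin n => H) :=
  ((PiLp.continuousLinearEquiv 2 ℂ (fun _ : Fin n => H)).symm :
      (∀ _ : Fin n, H) →L[ℂ] PiLp 2 fun _ : Fin n => H).comp
    ((ContinuousLinearMap.pi fun i => ∑ j, (a i j).comp (ContinuousLinearMap.proj j)).comp
      ((PiLp.continuousLinearEquiv 2 ℂ (fun _ : Fin n => H) :
        (PiLp 2 fun _ : Fin n => H) →L[ℂ] ∀ _ : Fin n, H)))

/-- `Mₙ(A)`: the `n × n` matrices with entries in `A`, acting on `Hⁿ`. -/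
noncomputable def MatrixAmp (n : ℕ) (A : NonUnitalStarSubalgebra ℂ (H →L[ℂ] H)) :
    Set ((PiLp 2 fun _ : Fin n => H) →L[ℂ] (PiLp 2 fun _ : Fin n => H)) :=
  {T | ∃ a : Fin n → Fin n → (H →L[ℂ] H), (∀ i j, a i j ∈ A) ∧ T = matrixOp a}

/-- Christensen's property `D_k`: for every nondegenerate representation `π` of `A` on a
Hilbert space `K` and every `T ∈ B(K)`, the distance from `T` to the commutant `π(A)'`
is at most `k · sup{‖π(a) T − T π(a)‖ : a ∈ A, ‖a‖ ≤ 1}`. -/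
def PropertyDk (k : ℝ) (A : NonUnitalStarSubalgebra ℂ (H →L[ℂ] H)) : Prop :=
  ∀ (K : Type*) [NormedAddCommGroup K] [InnerProductSpace ℂ K] [CompleteSpace K]
    (π : A →⋆ₙₐ[ℂ] (K →L[ℂ] K)),
    Dense (↑(Submodule.span ℂ {v : K | ∃ (a : A) (ξ : K), v = π a ξ}) : Set K) →
    ∀ T : K →L[ℂ] K,
      infDist T {S : K →L[ℂ] K | ∀ a : A, π a * S = S * π a} ≤
        k * sSup {r : ℝ | ∃ a : A, ‖(a : H →L[ℂ] H)‖ ≤ 1 ∧ r = ‖π a * T - T * π a‖}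

/-- The commutant of a set of operators. -/
def commutantSet {E : Type*} [Mul E] (S : Set E) : Set E := {T | ∀ a ∈ S, a * T = T * a}

/-- Cuntz subequivalence `a ≾ b` relative to a subset `S` (a C*-subalgebra as a set):
there is a sequence `(vₙ)` in `S` with `‖vₙ b vₙ* − a‖ → 0`. -/
def CuntzBelowIn (S : Set (H →L[ℂ] H)) (a b : H →L[ℂ] H) : Prop :=
  ∃ v : ℕ → H →L[ℂ] H, (∀ n, v n ∈ S) ∧
    Tendsto (fun n => ‖v n * b * star (v n) - a‖) atTop (𝓝 0)

/-- `(a − ε)₊` via the continuous functional calculus. -/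
noncomputable def cutP (a : H →L[ℂ] H) (ε : ℝ) : H →L[ℂ] H :=
  cfc (fun t : ℝ => max (t - ε) 0) a

/-- Rapidly increasing sequence in the C*-subalgebra given by the set `S`. -/
def RapidlyIncreasingIn (S : Set (H →L[ℂ] H)) (a : ℕ → H →L[ℂ] H) : Prop :=
  ∀ n, ∃ ε > (0 : ℝ), CuntzBelowIn S (a n) (cutP (a (n + 1)) ε)

/-- Very rapidly increasing sequence in the C*-subalgebra given by the set `S`. -/
def VeryRapidlyIncreasingIn (S : Set (H →L[ℂ] H)) (a : ℕ → H →L[ℂ] H) : Prop :=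
  RapidlyIncreasingIn S a ∧
    ∀ ε > (0 : ℝ), ∀ n, ∃ m₀, ∀ m ≥ m₀,
      ∃ v ∈ S, ‖v‖ ≤ 1 ∧ ‖v * a m * star v * a n - a n‖ < ε

/-- A bounded trace on the C*-subalgebra `A`: a bounded (equivalently continuous) linear
functional `τ` with `τ(x*x) = τ(xx*) ≥ 0` for all `x`. -/
def IsBoundedTrace (A : NonUnitalStarSubalgebra ℂ (H →L[ℂ] H)) (τ : A → ℂ) : Prop :=
  (∀ x y : A, τ (x + y) = τ x + τ y) ∧ (∀ (c : ℂ) (x : A), τ (c • x) = c * τ x) ∧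
    (∀ x : A, τ (star x * x) = τ (x * star x)) ∧ (∀ x : A, 0 ≤ τ (star x * x)) ∧
    (∃ C : ℝ, ∀ x : A, ‖τ x‖ ≤ C * ‖(x : H →L[ℂ] H)‖)


set_option linter.unusedSectionVars false

section VN
variable {K : Type*} [NormedAddCommGroup K] [InnerProductSpace ℂ K] [CompleteSpace K]

local notation "⟪" x "," y "⟫" => inner ℂ x y

/-- `M` contains its bicommutant. -/
def IsVN (M : StarSubalgebra ℂ (K →L[ℂ] K)) : Prop :=
  ∀ x : K →L[ℂ] K, (∀ y : K →L[ℂ] K, (∀ m ∈ M, m * y = y * m) → y * x = x * y) → x ∈ M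

lemma mulA (x y : K →L[ℂ] K) (v : K) : (x * y) v = x (y v) := rfl

lemma inner_star_left (y : K →L[ℂ] K) (u v : K) : ⟪star y u, v⟫ = ⟪u, y v⟫ :=
  ContinuousLinearMap.adjoint_inner_left y v u

lemma inner_star_right (y : K →L[ℂ] K) (u v : K) : ⟪u, star y v⟫ = ⟪y u, v⟫ :=
  ContinuousLinearMap.adjoint_inner_right y u v

lemma norm_sq_star (y : K →L[ℂ] K) (u : K) : (‖y u‖ ^ 2 : ℝ) = (⟪(star y * y) u, u⟫).re := by
  rw [mulA, inner_star_left, ← inner_self_eq_norm_sq (𝕜 := ℂ)]; rfl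

lemma commutant_star {M : StarSubalgebra ℂ (K →L[ℂ] K)} {y : K →L[ℂ] K}
    (hy : ∀ m ∈ M, m * y = y * m) : ∀ m ∈ M, m * star y = star y * m := by
  intro m hm
  have := congrArg star (hy (star m) (star_mem hm))
  simpa using this.symm

lemma comm_starProjection (V : Submodule ℂ K) [V.HasOrthogonalProjection] (y : K →L[ℂ] K)
    (h1 : ∀ v ∈ V, y v ∈ V) (h2 : ∀ v ∈ V, star y v ∈ V) :
    y * V.starProjection = V.starProjection * y := by
  ext x
  simp only [mulA]
  refine (Submodule.eq_starProjection_of_mem_of_inner_eq_zero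
    (h1 _ (Submodule.starProjection_apply_mem V x)) ?_).symm
  intro w hw
  rw [← map_sub, ← inner_star_right]
  exact Submodule.starProjection_inner_eq_zero (K := V) x _ (h2 w hw)

/-- projection onto the closure of a subspace -/
noncomputable def cproj (V : Submodule ℂ K) : K →L[ℂ] K := V.topologicalClosure.starProjection

lemma cproj_star (V : Submodule ℂ K) : star (cproj V) = cproj V :=
  (isSelfAdjoint_starProjection V.topologicalClosure)

lemma cproj_mul_self (V : Submodule ℂ K) : cproj V * cproj V = cproj V :=
  Submodule.isIdempotentElem_starProjection (K := V.topologicalClosure)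

lemma cproj_apply_mem {V : Submodule ℂ K} {v : K} (hv : v ∈ V) : cproj V v = v :=
  Submodule.starProjection_eq_self_iff.2 (V.le_topologicalClosure hv)

lemma cproj_comm (V : Submodule ℂ K) (y : K →L[ℂ] K)
    (h1 : ∀ v ∈ V, y v ∈ V) (h2 : ∀ v ∈ V, star y v ∈ V) :
    y * cproj V = cproj V * y := by
  refine comm_starProjection _ y ?_ ?_
  · intro v hv
    exact map_mem_closure y.continuous hv h1
  · intro v hv
    exact map_mem_closure (star y).continuous hv h2

/-- two operators agreeing on `V` agree after multiplying by the projection -/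
lemma mul_cproj_ext {V : Submodule ℂ K} {x y : K →L[ℂ] K} (h : ∀ v ∈ V, x v = y v) :
    x * cproj V = y * cproj V := by
  ext w
  simp only [mulA]
  have hm : cproj V w ∈ closure (V : Set K) :=
    Submodule.starProjection_apply_mem V.topologicalClosure w
  exact closure_minimal (s := (V : Set K)) (t := {v | x v = y v}) h
    (isClosed_eq x.continuous y.continuous) hm

lemma cproj_mul_of_range {V : Submodule ℂ K} {x : K →L[ℂ] K} (h : ∀ v, x v ∈ V) :
    cproj V * x = x := by
  ext w; exact cproj_apply_mem (h w)

lemma cproj_apply_zero {V : Submodule ℂ K} {w : K} (h : ∀ v ∈ V, ⟪v, w⟫ = 0) : cproj V w = 0 := by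
  unfold cproj
  rw [Submodule.starProjection_apply_eq_zero_iff, Submodule.orthogonal_closure]
  exact fun v hv => h v hv

lemma cproj_norm_le (V : Submodule ℂ K) : ‖cproj V‖ ≤ 1 := Submodule.starProjection_norm_le _

lemma cproj_mem {M : StarSubalgebra ℂ (K →L[ℂ] K)} (hM : IsVN M) (V : Submodule ℂ K)
    (hV : ∀ y : K →L[ℂ] K, (∀ m ∈ M, m * y = y * m) → ∀ v ∈ V, y v ∈ V) : cproj V ∈ M :=
  hM _ fun y hy => cproj_comm V y (hV y hy) (hV _ (commutant_star hy))

/-- norm of partial isometry -/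
lemma pi_norm_le {u : K →L[ℂ] K} (h : u * star u * u = u) : ‖u‖ ≤ 1 := by
  have h1 : ‖star u * u‖ = ‖u‖ * ‖u‖ := CStarRing.norm_star_mul_self
  have h2 : ‖star u * u‖ * ‖star u * u‖ = ‖star u * u‖ := by
    rw [← CStarRing.norm_star_mul_self (x := star u * u)]
    congr 1
    simp only [star_mul, star_star, mul_assoc] at h ⊢
    rw [h]
  rcases (norm_nonneg u).eq_or_lt with h0 | h0
  · rw [← h0]; norm_num
  · rw [h1] at h2
    nlinarith [mul_pos h0 h0, mul_pos (mul_pos h0 h0) h0]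

section SS
variable {ι : Type*} (u : ι → K →L[ℂ] K)

lemma sum_pi (hu : ∀ i, u i * star (u i) * u i = u i)
    (h1 : ∀ i j, i ≠ j → star (u i) * u j = 0) (h2 : ∀ i j, i ≠ j → u i * star (u j) = 0)
    (s : Finset ι) : (∑ i ∈ s, u i) * star (∑ i ∈ s, u i) * (∑ i ∈ s, u i) = ∑ i ∈ s, u i := by
  classical
  rw [star_sum, Finset.sum_mul_sum, Finset.sum_mul]
  refine Finset.sum_congr rfl fun i hi => ?_
  rw [Finset.sum_eq_single i (fun j _ hj => h2 i j hj.symm) (fun h => absurd hi h),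
    Finset.mul_sum, Finset.sum_eq_single i (fun j _ hj => by rw [mul_assoc, h1 i j hj.symm, mul_zero])
      (fun h => absurd hi h), hu]

lemma ss_summable (hu : ∀ i, u i * star (u i) * u i = u i)
    (h1 : ∀ i j, i ≠ j → star (u i) * u j = 0) (h2 : ∀ i j, i ≠ j → u i * star (u j) = 0)
    (x : K) : Summable (fun i => u i x) := by
  classical
  have key : ∀ s : Finset ι, ‖∑ i ∈ s, u i x‖ ^ 2 = ∑ i ∈ s, ‖u i x‖ ^ 2 := by
    intro s
    have : ∑ i ∈ s, u i x = (∑ i ∈ s, u i) x := by simp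
    rw [this, norm_sq_star]
    have : star (∑ i ∈ s, u i) * (∑ i ∈ s, u i) = ∑ i ∈ s, star (u i) * u i := by
      rw [star_sum, Finset.sum_mul_sum]
      refine Finset.sum_congr rfl fun i hi => ?_
      rw [Finset.sum_eq_single i (fun j _ hj => h1 i j hj.symm) (fun h => absurd hi h)]
    rw [this]
    simp only [sum_apply, sum_inner, Complex.re_sum, ← norm_sq_star]
  have hs : Summable (fun i => ‖u i x‖ ^ 2) := by
    refine summable_of_sum_le (c := ‖x‖ ^ 2) (fun i => by positivity) fun s => ?_
    rw [← key]
    have : ∑ i ∈ s, u i x = (∑ i ∈ s, u i) x := by simp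
    rw [this]
    have := (∑ i ∈ s, u i).le_of_opNorm_le (pi_norm_le (sum_pi u hu h1 h2 s)) x
    rw [one_mul] at this
    gcongr
  rw [summable_iff_vanishing_norm] at hs ⊢
  intro ε hε
  obtain ⟨s, hs⟩ := hs (ε ^ 2) (by positivity)
  refine ⟨s, fun t ht => ?_⟩
  have := hs t ht
  rw [← key, Real.norm_of_nonneg (by positivity)] at this
  exact lt_of_pow_lt_pow_left₀ 2 hε.le this

lemma ss_aux (hu : ∀ i, u i * star (u i) * u i = u i)
    (h1 : ∀ i j, i ≠ j → star (u i) * u j = 0) (h2 : ∀ i j, i ≠ j → u i * star (u j) = 0) :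
    ∃ U : K →L[ℂ] K, ∀ x, HasSum (fun i => u i x) (U x) := by
  have hs := ss_summable u hu h1 h2
  refine ⟨LinearMap.mkContinuous
    { toFun := fun x => ∑' i, u i x
      map_add' := fun x y => by
        simp only [map_add]; exact (hs x).tsum_add (hs y)
      map_smul' := fun c x => by
        simp only [map_smul]; exact (hs x).tsum_const_smul c } 1 ?_, fun x => (hs x).hasSum⟩
  intro x
  refine le_of_tendsto (hs x).hasSum.norm (Eventually.of_forall fun s => ?_)
  have : ∑ i ∈ s, u i x = (∑ i ∈ s, u i) x := by simp
  rw [this]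
  exact (∑ i ∈ s, u i).le_of_opNorm_le (pi_norm_le (sum_pi u hu h1 h2 s)) x

/-- strong sums of orthogonal partial isometries -/
lemma strong_sum {M : StarSubalgebra ℂ (K →L[ℂ] K)} (hM : IsVN M) (huM : ∀ i, u i ∈ M)
    (hu : ∀ i, u i * star (u i) * u i = u i)
    (h1 : ∀ i j, i ≠ j → star (u i) * u j = 0) (h2 : ∀ i j, i ≠ j → u i * star (u j) = 0) :
    ∃ U ∈ M, (∀ x, HasSum (fun i => u i x) (U x)) ∧ (∀ x, HasSum (fun i => star (u i) x) (star U x)) ∧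
      (∀ i, star (u i) * U = star (u i) * u i) ∧ (∀ i, u i * star U = u i * star (u i)) ∧
      (∀ i, U * star (u i) = u i * star (u i)) ∧ (∀ i, star U * u i = star (u i) * u i) := by
  classical
  obtain ⟨U, hU⟩ := ss_aux u hu h1 h2
  have hu' : ∀ i, star (u i) * star (star (u i)) * star (u i) = star (u i) := fun i => by
    have := congrArg star (hu i)
    simpa [mul_assoc] using this
  obtain ⟨V, hV⟩ := ss_aux (fun i => star (u i)) hu' (fun i j h => by simpa using h2 i j h)
    (fun i j h => by simpa using h1 i j h)
  have hVU : star U = V := by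
    ext x
    refine ext_inner_right ℂ fun y => ?_
    rw [inner_star_left]
    have a := (hU y).mapL (innerSL ℂ x)
    have b : HasSum (fun i => ⟪star (u i) x, y⟫) ⟪V x, y⟫ := (hV x).map
        (AddMonoidHom.mk' (fun z : K => ⟪z, y⟫) (fun a b => inner_add_left a b y))
        (by show Continuous (fun z : K => ⟪z, y⟫); fun_prop)
    simp only [inner_star_left] at b
    exact a.unique b
  have e1 : ∀ i, star (u i) * U = star (u i) * u i := by
    intro i
    ext x
    have a := (hU x).mapL (star (u i))
    refine a.unique ?_
    rw [mulA]
    refine hasSum_single i (fun j hj => ?_)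
    rw [← mulA, h1 i j hj.symm]; rfl
  have e2 : ∀ i, u i * star U = u i * star (u i) := by
    intro i
    ext x
    have a := (hV x).mapL (u i)
    rw [hVU]
    refine a.unique ?_
    rw [mulA]
    refine hasSum_single i (fun j hj => ?_)
    rw [← mulA, h2 i j hj.symm]; rfl
  refine ⟨U, ?_, hU, hVU ▸ hV, e1, e2, ?_, ?_⟩
  · refine hM _ fun y hy => ?_
    ext x
    have a := (hU x).mapL y
    have b := hU (y x)
    refine a.unique ?_
    rw [mulA]
    convert b using 2 with i
    have := hy _ (huM i)
    rw [← mulA, ← this, mulA]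
  · intro i; have := congrArg star (e2 i); simpa using this
  · intro i; have := congrArg star (e1 i); simpa using this

lemma ss_mul_ext {U : K →L[ℂ] K} (hU : ∀ x, HasSum (fun i => u i x) (U x)) {X Y : K →L[ℂ] K}
    (h : ∀ i, u i * X = u i * Y) : U * X = U * Y := by
  ext x
  refine (hU (X x)).unique ?_
  have := hU (Y x)
  rw [mulA]
  convert this using 2 with i
  exact congrArg (fun z : K →L[ℂ] K => z x) (h i)

lemma ss_ext_mul {U : K →L[ℂ] K} (hU : ∀ x, HasSum (fun i => u i x) (U x)) {X Y : K →L[ℂ] K}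
    (h : ∀ i, X * u i = Y * u i) : X * U = Y * U := by
  ext x
  refine ((hU x).mapL X).unique ?_
  have := (hU x).mapL Y
  rw [mulA]
  convert this using 2 with i
  exact congrArg (fun z : K →L[ℂ] K => z x) (h i)

lemma ss_pi {U : K →L[ℂ] K} (hu : ∀ i, u i * star (u i) * u i = u i)
    (hU : ∀ x, HasSum (fun i => u i x) (U x))
    (e1 : ∀ i, star (u i) * U = star (u i) * u i) (e2 : ∀ i, u i * star U = u i * star (u i)) :
    U * star U * U = U := by
  rw [mul_assoc]
  conv_rhs => rw [← mul_one U]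
  refine ss_mul_ext u hU fun i => ?_
  rw [← mul_assoc, e2, mul_assoc, e1, ← mul_assoc, hu, mul_one]

lemma ss_norm {U : K →L[ℂ] K} (hU' : ∀ x, HasSum (fun i => star (u i) x) (star U x))
    (e1 : ∀ i, star (u i) * U = star (u i) * u i) (x : K) :
    HasSum (fun i => ‖u i x‖ ^ 2) (‖U x‖ ^ 2) := by
  have := hU' (U x)
  simp only [← mulA, e1] at this
  have b : HasSum (fun i => (⟪(star (u i) * u i) x, x⟫).re) (⟪(star U * U) x, x⟫).re := this.map
        (AddMonoidHom.mk' (fun z : K => (⟪z, x⟫).re) (fun a b => by rw [inner_add_left, Complex.add_re]))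
        (by show Continuous (fun z : K => (⟪z, x⟫).re); fun_prop)
  simpa only [← norm_sq_star] using b

end SS
end VN

set_option linter.unusedSectionVars false

section VN2
variable {K : Type*} [NormedAddCommGroup K] [InnerProductSpace ℂ K] [CompleteSpace K]

local notation "⟪" x "," y "⟫" => inner ℂ x y

lemma re_inner_mono {x y : K →L[ℂ] K} (h : x ≤ y) (ξ : K) : (⟪x ξ, ξ⟫).re ≤ (⟪y ξ, ξ⟫).re := by
  have := (ContinuousLinearMap.le_def x y).1 h
  have := this.re_inner_nonneg_left ξ
  simp only [sub_apply, inner_sub_left, map_sub] at this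
  simpa using this

lemma re_inner_smul (r : ℝ) (x : K →L[ℂ] K) (ξ : K) :
    (⟪(r • x) ξ, ξ⟫).re = r * (⟪x ξ, ξ⟫).re := by
  have : (r • x) ξ = (r : ℂ) • x ξ := by rw [Complex.coe_smul]; rfl
  rw [this, inner_smul_left]; simp

lemma cfc_mem_vn {M : StarSubalgebra ℂ (K →L[ℂ] K)} (hM : IsVN M) {h : K →L[ℂ] K} (hh : h ∈ M)
    (f : ℝ → ℝ) : cfc f h ∈ M := by
  by_cases hs : IsSelfAdjoint h
  swap
  · rw [cfc_apply_of_not_predicate h hs]; exact zero_mem M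
  refine hM _ fun y hy => ?_
  exact ((hs.commute_cfc (show Commute h y from hy h hh) f).symm).eq

lemma layer {M : StarSubalgebra ℂ (K →L[ℂ] K)} (hM : IsVN M) {y : K →L[ℂ] K} (hy : y ∈ M)
    {δ : ℝ} (hδ : 0 < δ) : ∃ (N : ℕ) (E u : ℕ → K →L[ℂ] K),
      (∀ k, u k ∈ M ∧ u k * star (u k) * u k = u k ∧ star (u k) * u k = E k ∧
        ∃ X Y, u k = y * X ∧ u k = Y * y) ∧
      star y * y ≤ δ • 1 + δ • ∑ k ∈ Finset.range N, E k ∧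
      δ • ∑ k ∈ Finset.range N, u k * star (u k) ≤ y * star y := by
  set h := star y * y with hh
  have hhM : h ∈ M := mul_mem (star_mem hy) hy
  have hs : IsSelfAdjoint h := IsSelfAdjoint.star_mul_self y
  have hpos : 0 ≤ h := star_mul_self_nonneg y
  have hspec : ∀ t ∈ spectrum ℝ h, 0 ≤ t := fun t ht => spectrum_nonneg_of_nonneg hpos ht
  -- functions
  let p : ℕ → ℝ → ℝ := fun k t => max (t - k * δ) 0
  have pc : ∀ k, Continuous (p k) := fun k => by fun_prop
  let g : ℝ → ℝ := fun t => 1 / √(max t δ)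
  have gpos : ∀ t, 0 < √(max t δ) := fun t => Real.sqrt_pos.2 (lt_max_of_lt_right hδ)
  have gc : Continuous g := by
    refine continuous_const.div (by fun_prop) fun t => (gpos t).ne'
  set G := cfc g h with hG
  have hGs : star G = G := (cfc_predicate g h : IsSelfAdjoint _)
  let P : ℕ → K →L[ℂ] K := fun k => cfc (p k) h
  have hPs : ∀ k, star (P k) = P k := fun k => (cfc_predicate (p k) h : IsSelfAdjoint _)
  have hid : cfc (fun t : ℝ => t) h = h := cfc_id' ℝ h
  let E : ℕ → K →L[ℂ] K := fun k => cproj (P (k + 1)).range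
  have hEs : ∀ k, star (E k) = E k := fun k => cproj_star _
  have hEE : ∀ k, E k * E k = E k := fun k => cproj_mul_self _
  have hEP : ∀ k, E k * P (k + 1) = P (k + 1) := fun k =>
    cproj_mul_of_range fun v => LinearMap.mem_range_self _ v
  have hPE : ∀ k, P (k + 1) * E k = P (k + 1) := fun k => by
    have := congrArg star (hEP k); simpa [hPs, hEs] using this
  have hEext : ∀ k (x z : K →L[ℂ] K), x * P (k + 1) = z * P (k + 1) → x * E k = z * E k := by
    intro k x z hxz
    refine mul_cproj_ext ?_
    rintro _ ⟨w, rfl⟩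
    exact congrArg (fun q : K →L[ℂ] K => q w) hxz
  have hEc : ∀ k (x : K →L[ℂ] K), x * P (k + 1) = P (k + 1) * x →
      star x * P (k + 1) = P (k + 1) * star x → x * E k = E k * x := by
    intro k x h1 h2
    refine cproj_comm _ x ?_ ?_
    · rintro _ ⟨w, rfl⟩
      exact ⟨x w, (congrArg (fun q : K →L[ℂ] K => q w) h1).symm⟩
    · rintro _ ⟨w, rfl⟩
      exact ⟨star x w, (congrArg (fun q : K →L[ℂ] K => q w) h2).symm⟩
  have hEM : ∀ k, E k ∈ M := fun k => hM _ fun x hx => by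
    have hPM : P (k + 1) ∈ M := cfc_mem_vn hM hhM _
    exact hEc k x (hx _ hPM).symm (commutant_star hx _ hPM).symm
  have hGM : G ∈ M := cfc_mem_vn hM hhM _
  have hGE : ∀ k, G * E k = E k * G := fun k => by
    have : G * P (k + 1) = P (k + 1) * G := (cfc_commute_cfc g (p (k + 1)) h).eq
    exact hEc k G this (by rw [hGs]; exact this)
  -- G h G P = P
  have hGh : G * h = h * G := by
    have := (cfc_commute_cfc g (fun t => t) h).eq
    rwa [hid] at this
  have hGhG : G * h * G = cfc (fun t => g t * t * g t) h := by
    rw [cfc_mul (fun t => g t * t) g h (by fun_prop) (by fun_prop),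
      cfc_mul g (fun t => t) h (by fun_prop) (by fun_prop), hid]
  have hgg : ∀ t, g t * g t = 1 / max t δ := fun t => by
    simp only [g]
    rw [div_mul_div_comm, Real.mul_self_sqrt (le_max_of_le_right hδ.le), one_mul]
  have hGP : ∀ k, G * h * G * P (k + 1) = 1 * P (k + 1) := by
    intro k
    rw [one_mul, hGhG]
    simp only [P]
    rw [← cfc_mul (fun t => g t * t * g t) (p (k + 1)) h (by fun_prop) (by fun_prop)]
    refine cfc_congr fun t ht => ?_
    simp only [p]
    by_cases hc : t - ((k + 1 : ℕ) : ℝ) * δ ≤ 0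
    · rw [max_eq_right hc, mul_zero]
    · push Not at hc
      have h1 : δ ≤ t := by
        push_cast at hc
        have : 0 ≤ (k : ℝ) * δ := by positivity
        nlinarith
      have : g t * t * g t = 1 := by
        rw [mul_right_comm, hgg, max_eq_left h1]
        field_simp [(hδ.trans_le h1).ne']
      rw [this, one_mul]
  have hGEE : ∀ k, G * h * G * E k = E k := fun k => by
    have := hEext k _ _ (hGP k); rwa [one_mul] at this
  have hGle : G * h * G ≤ 1 := by
    rw [hGhG]
    refine cfc_le_one _ h fun t ht => ?_
    rw [mul_right_comm, hgg, one_div_mul_eq_div]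
    refine (div_le_one (lt_max_of_lt_right hδ)).2 (le_max_left _ _)
  -- D_k
  let D : ℕ → K →L[ℂ] K := fun k => P k - P (k + 1)
  have hD : ∀ k, D k = cfc (fun t => p k t - p (k + 1) t) h := fun k => by
    simp only [D, P]; rw [cfc_sub (p k) (p (k + 1)) h]
  have hDnn : ∀ k, 0 ≤ D k := fun k => by
    rw [hD]
    refine cfc_nonneg fun t ht => ?_
    simp only [p]
    push_cast
    rw [sub_nonneg]
    refine max_le_max ?_ le_rfl
    nlinarith
  have hDle : ∀ k, D k ≤ δ • 1 := fun k => by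
    rw [hD, ← Algebra.algebraMap_eq_smul_one]
    refine cfc_le_algebraMap _ _ h fun t ht => ?_
    simp only [p]
    push_cast
    rw [sub_le_iff_le_add]
    refine max_le ?_ ?_
    · have := le_max_left (t - (k + 1) * δ) 0
      nlinarith
    · have := le_max_right (t - (k + 1) * δ) 0
      linarith
  have hDs : ∀ k, star (D k) = D k := fun k => (hDnn k).isSelfAdjoint
  have hEP2 : ∀ k, E k * P (k + 2) = P (k + 2) := by
    intro k
    have e2 : P (k + 2) = P (k + 1) * cfc (fun t => p (k + 2) t / max (p (k+1) t) δ) h := by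
      simp only [P]
      rw [← cfc_mul (p (k + 1)) _ h (by fun_prop) ?_]
      swap
      · refine ContinuousOn.div (by fun_prop) (by fun_prop) fun t _ => (lt_max_of_lt_right hδ).ne'
      refine cfc_congr fun t ht => ?_
      simp only [p]
      push_cast
      by_cases hc : t - (k + 2) * δ ≤ 0
      · rw [max_eq_right hc]; simp
      · push Not at hc
        have h1 : δ ≤ t - (k + 1) * δ := by linarith
        have h0 : 0 < t - (k + 1) * δ := hδ.trans_le h1
        rw [max_eq_left h0.le, max_eq_left h1, mul_div_cancel₀ _ h0.ne']
    rw [e2, ← mul_assoc, hEP]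
  have hED : ∀ k, E k * D (k + 1) = D (k + 1) := by
    intro k
    simp only [D]
    rw [mul_sub, hEP, hEP2]
  have hDE : ∀ k, D (k + 1) * E k = D (k + 1) := fun k => by
    have := congrArg star (hED k); simpa [hDs, hEs] using this
  have hDE' : ∀ k, D (k + 1) ≤ δ • E k := by
    intro k
    have := star_left_conjugate_le_conjugate (hDle (k + 1)) (E k)
    rw [hEs, hED, hDE, mul_smul_comm, mul_one, smul_mul_assoc, hEE] at this
    exact this
  have hDE2 : ∀ k, D k * E k = δ • E k := by
    intro k
    have : D k * P (k + 1) = (δ • (1 : K →L[ℂ] K)) * P (k + 1) := by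
      rw [hD, smul_mul_assoc, one_mul]
      simp only [P]
      rw [← cfc_mul _ (p (k + 1)) h (by fun_prop) (by fun_prop), ← cfc_smul δ (p (k + 1)) h]
      refine cfc_congr fun t ht => ?_
      simp only [p, smul_eq_mul]
      push_cast
      by_cases hc : t - (k + 1) * δ ≤ 0
      · rw [max_eq_right hc]; simp
      · push Not at hc
        rw [max_eq_left hc.le, max_eq_left (by linarith)]
        ring
    have := hEext k _ _ this
    rwa [smul_mul_assoc, one_mul] at this
  have hED2 : ∀ k, E k * D k = δ • E k := fun k => by
    have := congrArg star (hDE2 k); simpa [hDs, hEs] using this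
  have hEle : ∀ k, δ • E k ≤ D k := by
    intro k
    have := star_left_conjugate_nonneg (hDnn k) (1 - E k)
    rw [← sub_nonneg]
    convert this using 1
    rw [star_sub, star_one, hEs, sub_mul, one_mul, hED2, sub_mul, mul_sub, mul_sub, hDE2, mul_one,
      mul_one, smul_mul_assoc, hEE]
    abel
  obtain ⟨N, hN⟩ : ∃ N : ℕ, ‖h‖ ≤ N * δ := by
    obtain ⟨N, hN⟩ := exists_nat_ge (‖h‖ / δ)
    exact ⟨N, (div_le_iff₀ hδ).1 hN⟩
  have hPN : ∀ k, N ≤ k → P k = 0 := by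
    intro k hk
    have : P k = cfc (fun _ : ℝ => (0 : ℝ)) h := by
      refine cfc_congr fun t ht => ?_
      simp only [p]
      refine max_eq_right ?_
      have h4 := spectrum.norm_le_norm_mul_of_mem ht
      have h3 : ‖(1 : K →L[ℂ] K)‖ ≤ 1 := ContinuousLinearMap.norm_id_le
      have : ‖t‖ ≤ ‖h‖ := h4.trans (mul_le_of_le_one_right (norm_nonneg _) h3)
      rw [Real.norm_eq_abs] at this
      have h3 : (N : ℝ) * δ ≤ k * δ := by gcongr
      linarith [le_abs_self t]
    rw [this]; simp
  have hP0 : P 0 = h := by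
    conv_rhs => rw [← hid]
    refine cfc_congr fun t ht => ?_
    simp [p, hspec t ht]
  have hsum : ∀ n, ∑ k ∈ Finset.range n, D k = h - P n := fun n => by
    rw [Finset.sum_range_sub', hP0]
  have hsum' : ∑ k ∈ Finset.range N, D (k + 1) = h - D 0 := by
    have := hsum (N + 1)
    rw [Finset.sum_range_succ', hPN (N + 1) (by omega), sub_zero] at this
    rw [← this]; abel
  refine ⟨N, E, fun k => y * G * E k, fun k => ?_, ?_, ?_⟩
  · have e1 : star (y * G * E k) * (y * G * E k) = E k := by
      simp only [star_mul, hEs, hGs]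
      calc E k * (G * star y) * (y * G * E k) = E k * (G * h * G * E k) := by
            rw [hh]; simp only [mul_assoc]
        _ = E k := by rw [hGEE, hEE]
    refine ⟨mul_mem (mul_mem hy hGM) (hEM k), ?_, e1, G * E k, y * G * E k * G * G * star y, ?_, ?_⟩
    · rw [mul_assoc, e1, mul_assoc, hEE]
    · exact mul_assoc _ _ _
    · show y * G * E k = _
      calc y * G * E k = y * G * (E k * E k) := by rw [hEE]
        _ = y * G * (E k * (G * h * G * E k)) := by rw [hGEE]
        _ = y * G * (E k * (G * h * (E k * G))) := by rw [← hGE]; simp only [mul_assoc]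
        _ = y * G * (E k * G * h * E k * G) := by simp only [mul_assoc]
        _ = y * G * (G * E k * h * E k * G) := by rw [hGE]
        _ = _ := ?_
      have hhE : h * E k = E k * h := by
        have : h * P (k + 1) = P (k + 1) * h := by
          have := (cfc_commute_cfc (fun t => t) (p (k + 1)) h).eq
          rwa [hid] at this
        exact hEc k h this (by rw [hs.star_eq]; exact this)
      calc y * G * (G * E k * h * E k * G) = y * G * (G * (E k * (h * E k) * G)) := by
            simp only [mul_assoc]
        _ = y * G * (G * (E k * (h * G))) := by rw [hhE, ← mul_assoc (E k) (E k), hEE, mul_assoc (E k) h G]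
        _ = y * G * ((G * E k) * (G * h)) := by rw [hGh]; simp only [mul_assoc]
        _ = y * G * (E k * G * (G * h)) := by rw [hGE]
        _ = _ := by rw [hh]; simp only [mul_assoc]
  · have : h = D 0 + ∑ k ∈ Finset.range N, D (k + 1) := by rw [hsum']; abel
    rw [this, Finset.smul_sum]
    exact add_le_add (hDle 0) (Finset.sum_le_sum fun k _ => hDE' k)
  · have hle : δ • ∑ k ∈ Finset.range N, E k ≤ h := by
      rw [Finset.smul_sum]
      refine (Finset.sum_le_sum fun k _ => hEle k).trans ?_
      rw [hsum, hPN N le_rfl, sub_zero]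
    have h1 := star_right_conjugate_le_conjugate hle G
    rw [hGs] at h1
    have h2 := star_right_conjugate_le_conjugate (h1.trans hGle) y
    rw [mul_one] at h2
    refine le_trans (le_of_eq ?_) h2
    simp only [Finset.smul_sum, Finset.mul_sum, Finset.sum_mul]
    refine Finset.sum_congr rfl fun k _ => ?_
    simp only [star_mul, hEs, hGs, mul_smul_comm, smul_mul_assoc]
    congr 1
    calc y * G * E k * (E k * (G * star y)) = y * G * (E k * E k) * G * star y := by
          simp only [mul_assoc]
      _ = _ := by rw [hEE]; simp only [mul_assoc]

/-- a nonzero element yields a nonzero partial isometry -/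
lemma exists_pi {M : StarSubalgebra ℂ (K →L[ℂ] K)} (hM : IsVN M) {y : K →L[ℂ] K} (hy : y ∈ M)
    (h0 : y ≠ 0) : ∃ u ∈ M, u ≠ 0 ∧ u * star u * u = u ∧ (∃ X, u = y * X) ∧ ∃ Y, u = Y * y := by
  have hn : 0 < ‖star y * y‖ := by
    rw [CStarRing.norm_star_mul_self]; have := norm_pos_iff.2 h0; positivity
  obtain ⟨N, E, u, hu, h1, -⟩ := layer hM hy (δ := ‖star y * y‖ / 2) (by positivity)
  by_contra hcon
  push Not at hcon
  have hE : ∀ k, E k = 0 := by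
    intro k
    obtain ⟨a, b, c, X, Y, d, e⟩ := hu k
    by_cases hz : u k = 0
    · rw [← c, hz, mul_zero]
    · exact absurd e (hcon _ a hz b ⟨X, d⟩ Y)
  simp only [hE, Finset.sum_const_zero, smul_zero, add_zero] at h1
  have := CStarAlgebra.norm_le_norm_of_nonneg_of_le (star_mul_self_nonneg y) h1
  rw [norm_smul, Real.norm_of_nonneg (by positivity)] at this
  have h3 : ‖(1 : K →L[ℂ] K)‖ ≤ 1 := ContinuousLinearMap.norm_id_le
  nlinarith

lemma layer_ineq {M : StarSubalgebra ℂ (K →L[ℂ] K)} (hM : IsVN M) {y : K →L[ℂ] K} (hy : y ∈ M)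
    (ξ : K) (hu : ∀ u ∈ M, u * star u * u = u → (∃ X, u = y * X) → (∃ Y, u = Y * y) →
      ‖u ξ‖ ^ 2 ≤ 2 * ‖star u ξ‖ ^ 2) : ‖y ξ‖ ^ 2 ≤ 2 * ‖star y ξ‖ ^ 2 := by
  refine le_of_forall_pos_le_add fun ε hε => ?_
  set δ := ε / (‖ξ‖ ^ 2 + 1) with hδ'
  have hδ : 0 < δ := by positivity
  obtain ⟨N, E, u, h, h1, h2⟩ := layer hM hy hδ
  have h1 := re_inner_mono h1 ξ
  have h2 := re_inner_mono h2 ξ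
  rw [← norm_sq_star] at h1
  have e1 : (⟪(δ • (1 : K →L[ℂ] K) + δ • ∑ k ∈ Finset.range N, E k) ξ, ξ⟫).re =
      δ * ‖ξ‖ ^ 2 + δ * ∑ k ∈ Finset.range N, ‖u k ξ‖ ^ 2 := by
    rw [add_apply, inner_add_left, Complex.add_re, re_inner_smul, re_inner_smul]
    congr 2
    · rw [← inner_self_eq_norm_sq (𝕜 := ℂ)]; rfl
    · simp only [sum_apply, sum_inner, Complex.re_sum]
      refine Finset.sum_congr rfl fun k _ => ?_
      rw [norm_sq_star, (h k).2.2.1]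
  have e2 : (⟪(δ • ∑ k ∈ Finset.range N, u k * star (u k)) ξ, ξ⟫).re =
      δ * ∑ k ∈ Finset.range N, ‖star (u k) ξ‖ ^ 2 := by
    rw [re_inner_smul]
    simp only [sum_apply, sum_inner, Complex.re_sum]
    congr 1
    refine Finset.sum_congr rfl fun k _ => ?_
    rw [norm_sq_star, star_star]
  have e3 : (⟪(y * star y) ξ, ξ⟫).re = ‖star y ξ‖ ^ 2 := by rw [norm_sq_star, star_star]
  rw [e1] at h1
  rw [e2, e3] at h2
  have h3 : ∑ k ∈ Finset.range N, ‖u k ξ‖ ^ 2 ≤ ∑ k ∈ Finset.range N, 2 * ‖star (u k) ξ‖ ^ 2 := by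
    refine Finset.sum_le_sum fun k _ => ?_
    obtain ⟨a, b, c, X, Y, d, e⟩ := h k
    exact hu _ a b ⟨X, d⟩ ⟨Y, e⟩
  rw [← Finset.mul_sum] at h3
  have h4 : δ * ‖ξ‖ ^ 2 ≤ ε := by
    rw [hδ', div_mul_eq_mul_div, div_le_iff₀ (by positivity)]
    nlinarith
  have := mul_le_mul_of_nonneg_left h3 hδ.le
  linarith

end VN2

set_option linter.unusedSectionVars false

lemma zorn_pairwise {α : Type*} (g : α → Prop) (r : α → α → Prop) (J0 : Set α)
    (h0 : ∀ u ∈ J0, g u) (h1 : J0.Pairwise r) :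
    ∃ J, J0 ⊆ J ∧ (∀ u ∈ J, g u) ∧ J.Pairwise r ∧
      ∀ u, g u → (∀ v ∈ J, r u v ∧ r v u) → u ∈ J := by
  obtain ⟨J, hJ0, hJ⟩ := zorn_subset_nonempty {J : Set α | (∀ u ∈ J, g u) ∧ J.Pairwise r} (by
    intro c hc hch hne
    refine ⟨⋃₀ c, ⟨?_, ?_⟩, fun s hs => Set.subset_sUnion_of_mem hs⟩
    · rintro u ⟨s, hs, hu⟩
      exact (hc hs).1 u hu
    · exact (Set.pairwise_sUnion hch.directedOn).2 fun s hs => (hc hs).2) J0 ⟨h0, h1⟩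
  refine ⟨J, hJ0, hJ.prop.1, hJ.prop.2, fun u hu hr => ?_⟩
  have hin : insert u J ∈ {J : Set α | (∀ u ∈ J, g u) ∧ J.Pairwise r} := by
    refine ⟨?_, ?_⟩
    · rintro v (rfl | hv)
      · exact hu
      · exact hJ.prop.1 v hv
    · exact hJ.prop.2.insert fun v hv _ => hr v hv
  exact hJ.le_of_ge hin (Set.subset_insert u J) (Set.mem_insert u J)

section VN3
variable {K : Type*} [NormedAddCommGroup K] [InnerProductSpace ℂ K] [CompleteSpace K]

local notation "⟪" x "," y "⟫" => inner ℂ x y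

lemma pi_star {u : K →L[ℂ] K} (h : u * star u * u = u) : star u * u * star u = star u := by
  have := congrArg star h
  simpa [mul_assoc] using this

lemma eq_zero_of_mul_star {u : K →L[ℂ] K} (h : u * star u = 0) : u = 0 :=
  CStarRing.mul_star_self_eq_zero_iff u |>.1 h

lemma exhaust {M : StarSubalgebra ℂ (K →L[ℂ] K)} (hM : IsVN M) (e0 f0 : K →L[ℂ] K) (ξ : K) :
    ∃ U ∈ M, U * star U * U = U ∧ f0 * U = U ∧ U * e0 = U ∧ 2 * ‖star U ξ‖ ^ 2 ≤ ‖U ξ‖ ^ 2 ∧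
      ∀ u ∈ M, u * star u * u = u → f0 * u = u → u * e0 = u → u * star U = 0 → star u * U = 0 →
        2 * ‖star u ξ‖ ^ 2 ≤ ‖u ξ‖ ^ 2 → u = 0 := by
  obtain ⟨J, -, hg, hp, hmax⟩ := zorn_pairwise (fun u : K →L[ℂ] K => u ∈ M ∧ u * star u * u = u ∧
      f0 * u = u ∧ u * e0 = u ∧ 2 * ‖star u ξ‖ ^ 2 ≤ ‖u ξ‖ ^ 2)
    (fun u v => star u * v = 0 ∧ u * star v = 0) ∅ (by simp) (by simp)
  obtain ⟨U, hUM, hU, hU', e1, e2, e3, e4⟩ := strong_sum (fun i : J => (i : K →L[ℂ] K)) hM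
    (fun i => (hg i i.2).1) (fun i => (hg i i.2).2.1)
    (fun i j hij => (hp i.2 j.2 fun h => hij (Subtype.ext h)).1)
    (fun i j hij => (hp i.2 j.2 fun h => hij (Subtype.ext h)).2)
  refine ⟨U, hUM, ss_pi _ (fun i : J => (hg i i.2).2.1) hU e1 e2, ?_, ?_, ?_, ?_⟩
  · conv_rhs => rw [← one_mul U]
    exact ss_ext_mul _ hU fun i => by rw [(hg i i.2).2.2.1, one_mul]
  · conv_rhs => rw [← mul_one U]
    exact ss_mul_ext _ hU fun i => by rw [(hg i i.2).2.2.2.1, mul_one]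
  · have a := ss_norm _ hU' e1 ξ
    have b : HasSum (fun i : J => ‖star (i : K →L[ℂ] K) ξ‖ ^ 2) (‖star U ξ‖ ^ 2) := by
      refine ss_norm (fun i : J => star (i : K →L[ℂ] K)) ?_ ?_ ξ
      · simpa using hU
      · simpa using e2
    exact hasSum_le (fun i : J => (hg i i.2).2.2.2.2) (b.mul_left 2) a
  · intro u h1 h2 h3 h4 h5 h6 h7
    have key : u ∈ J := by
      refine hmax u ⟨h1, h2, h3, h4, h7⟩ fun v hv => ?_
      have hv2 := (hg v hv).2.1
      have a1 : u * star v = 0 := by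
        have := e4 ⟨v, hv⟩
        simp only at this
        rw [← pi_star hv2, ← this, mul_assoc, ← mul_assoc, h5, zero_mul]
      have a2 : star u * v = 0 := by
        have := e3 ⟨v, hv⟩
        simp only at this
        rw [← hv2, ← this, mul_assoc, ← mul_assoc, h6, zero_mul]
      refine ⟨⟨a2, a1⟩, ?_, ?_⟩
      · have := congrArg star a2; simpa using this
      · have := congrArg star a1; simpa using this
    have := e2 ⟨u, key⟩
    simp only [h5] at this
    exact eq_zero_of_mul_star this.symm

/-- comparison -/
lemma comparison {M : StarSubalgebra ℂ (K →L[ℂ] K)} (hM : IsVN M) {E g : K →L[ℂ] K}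
    (hE : E ∈ M) (hg : g ∈ M) (hEs : star E = E) (hEE : E * E = E) (hgs : star g = g)
    (hgg : g * g = g)
    (hno : ¬ ∃ v ∈ M, star v * v = g ∧ E * v = v) :
    ∃ z ∈ M, (∀ m ∈ M, z * m = m * z) ∧ z * z = z ∧ star z = z ∧ z * g ≠ 0 ∧
      ∃ w ∈ M, star w * w = z * E ∧ g * w = w := by
  obtain ⟨U, hUM, hUU, hgU, hUE, -, hmax⟩ := exhaust hM E g 0
  have hUg : star U * g = star U := by have := congrArg star hgU; simpa [hgs] using this
  have hEU : E * star U = star U := by have := congrArg star hUE; simpa [hEs] using this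
  set e' := E - star U * U with he'
  set g' := g - U * star U with hg'
  have hg0 : g' ≠ 0 := by
    intro h
    refine hno ⟨star U, star_mem hUM, ?_, hEU⟩
    rw [star_star]; exact (sub_eq_zero.1 h).symm
  have hg'M : g' ∈ M := sub_mem hg (mul_mem hUM (star_mem hUM))
  have he'M : e' ∈ M := sub_mem hE (mul_mem (star_mem hUM) hUM)
  have he's : star e' = e' := by simp [he', hEs]
  have hg's : star g' = g' := by simp [hg', hgs]
  have hgg' : g * g' = g' := by rw [hg', mul_sub, hgg, ← mul_assoc, hgU]
  have hee' : e' * E = e' := by rw [he', sub_mul, hEE, mul_assoc, hUE]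
  have heU : e' * star U = 0 := by rw [he', sub_mul, hEU, pi_star hUU, sub_self]
  have hgU' : g' * U = 0 := by rw [hg', sub_mul, hgU, hUU, sub_self]
  have hzero : ∀ m ∈ M, g' * m * e' = 0 := by
    intro m hm
    by_contra hne
    obtain ⟨u, huM, hu0, huu, ⟨X, hX⟩, ⟨Y, hY⟩⟩ :=
      exists_pi hM (mul_mem (mul_mem hg'M hm) he'M) hne
    refine hu0 (hmax u huM huu ?_ ?_ ?_ ?_ (by simp))
    · rw [hX]; simp only [← mul_assoc]; rw [hgg']
    · rw [hY]; simp only [mul_assoc]; rw [hee']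
    · rw [hY]; simp only [mul_assoc]; rw [heU]; simp
    · rw [hX]; simp only [star_mul, hg's, mul_assoc]; rw [hgU']; simp
  let V : Submodule ℂ K := Submodule.span ℂ {v | ∃ m ∈ M, ∃ k, v = m (g' k)}
  have hVM : ∀ m ∈ M, ∀ v ∈ V, m v ∈ V := by
    intro m hm v hv
    refine Submodule.span_induction (p := fun v _ => m v ∈ V) ?_ ?_ ?_ ?_ hv
    · rintro _ ⟨m', hm', k, rfl⟩
      exact Submodule.subset_span ⟨m * m', mul_mem hm hm', k, rfl⟩
    · simp
    · intro x y _ _ hx hy; rw [map_add]; exact add_mem hx hy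
    · intro c x _ hx; rw [map_smul]; exact V.smul_mem c hx
  have hVM' : ∀ y : K →L[ℂ] K, (∀ m ∈ M, m * y = y * m) → ∀ v ∈ V, y v ∈ V := by
    intro y hy v hv
    refine Submodule.span_induction (p := fun v _ => y v ∈ V) ?_ ?_ ?_ ?_ hv
    · rintro _ ⟨m', hm', k, rfl⟩
      refine Submodule.subset_span ⟨m', hm', y k, ?_⟩
      have := hy _ (mul_mem hm' hg'M)
      exact (congrArg (fun q : K →L[ℂ] K => q k) this).symm
    · simp
    · intro x y _ _ hx hy; rw [map_add]; exact add_mem hx hy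
    · intro c x _ hx; rw [map_smul]; exact V.smul_mem c hx
  have hzM : cproj V ∈ M := cproj_mem hM V hVM'
  have hzc : ∀ m ∈ M, cproj V * m = m * cproj V := fun m hm =>
    (cproj_comm V m (hVM m hm) (hVM _ (star_mem hm))).symm
  have hzg : cproj V * g' = g' := cproj_mul_of_range fun k =>
    Submodule.subset_span ⟨1, one_mem M, k, rfl⟩
  have hze : e' * cproj V = 0 := by
    have : e' * cproj V = 0 * cproj V := by
      refine mul_cproj_ext fun v hv => ?_
      refine Submodule.span_induction (p := fun v _ => e' v = (0 : K →L[ℂ] K) v) ?_ ?_ ?_ ?_ hv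
      · rintro _ ⟨m', hm', k, rfl⟩
        have := congrArg star (hzero _ (star_mem hm'))
        simp only [star_mul, star_star, he's, hg's, star_zero] at this
        exact congrArg (fun q : K →L[ℂ] K => q k) this
      · simp
      · intro x y _ _ hx hy; rw [map_add, hx, hy]; simp
      · intro c x _ hx; rw [map_smul, hx]; simp
    rw [this, zero_mul]
  refine ⟨cproj V, hzM, hzc, cproj_mul_self V, cproj_star V, ?_, U * cproj V, mul_mem hUM hzM, ?_, ?_⟩
  · intro h
    apply hg0
    rw [← hzg, ← hgg', ← mul_assoc, h, zero_mul]
  · have hUU' : star U * U = E - e' := by rw [he']; abel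
    rw [star_mul, cproj_star]
    calc cproj V * star U * (U * cproj V) = cproj V * (star U * U * cproj V) := by
          simp only [mul_assoc]
      _ = cproj V * (E * cproj V) := by rw [hUU', sub_mul, hze, sub_zero]
      _ = cproj V * E := by rw [← hzc E hE, ← mul_assoc, cproj_mul_self]
  · rw [← mul_assoc, hgU]

end VN3

set_option linter.unusedSectionVars false

lemma hasSum_opt {α : Type*} {ι : Type*} [NormedAddCommGroup α] {f : Option ι → α} {a : α}
    (h : HasSum (fun i => f (some i)) a) : HasSum f (f none + a) := by
  classical
  have h1 : HasSum (fun o : Option ι => if o = none then f none else 0) (f none) :=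
    hasSum_ite_eq none (f none)
  have h2 : HasSum (fun o : Option ι => if o = none then 0 else f o) a := by
    rw [← (Option.some_injective ι).hasSum_iff]
    · simpa [Function.comp_def] using h
    · intro x hx
      rcases x with _ | x
      · simp
      · exact absurd ⟨x, rfl⟩ hx
  convert h1.add h2 using 2 with o
  split_ifs with ho
  · simp [ho]
  · simp

section VN4
universe u
variable {K : Type u} [NormedAddCommGroup K] [InnerProductSpace ℂ K] [CompleteSpace K]

local notation "⟪" x "," y "⟫" => inner ℂ x y

/-- `n` isometries with orthogonal ranges and initial projection `z` -/
def HasPI (M : StarSubalgebra ℂ (K →L[ℂ] K)) (n : ℕ) (z : K →L[ℂ] K) : Prop :=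
  ∃ v : Fin n → K →L[ℂ] K, (∀ i, v i ∈ M) ∧ ∀ i j, star (v i) * v j = if i = j then z else 0

lemma mul_of_star_mul {v g : K →L[ℂ] K} (hgs : star g = g) (hgg : g * g = g)
    (h : star v * v = g) : v * g = v := by
  have : star (v * g - v) * (v * g - v) = 0 := by
    rw [star_sub, star_mul, hgs]
    calc (g * star v - star v) * (v * g - v)
        = g * (star v * v) * g - g * (star v * v) - (star v * v) * g + star v * v := by noncomm_ring
      _ = 0 := by rw [h, hgg, hgg]; abel
  exact sub_eq_zero.1 (CStarRing.star_mul_self_eq_zero_iff _ |>.1 this)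

lemma pi_generic {M : StarSubalgebra ℂ (K →L[ℂ] K)} (hM : IsVN M) {n : ℕ} {ι ι' : Type*}
    {g z : K →L[ℂ] K} (hgs : star g = g) (hgg : g * g = g) (d : ι → K →L[ℂ] K) (hd : ∀ o, d o ∈ M)
    (hdd : ∀ o o', o ≠ o' → d o * star (d o') = 0) (hdp : ∀ o, d o * star (d o) * d o = d o)
    (hgd : ∀ o, g * d o = d o)
    (hsum : ∀ x, HasSum (fun o => (star (d o) * d o) x) (z x))
    (v : ι' → K →L[ℂ] K) (hv : ∀ i, v i ∈ M) (hvg : ∀ i, star (v i) * v i = g)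
    (hvv : ∀ i j, i ≠ j → star (v i) * v j = 0) (κ : Fin n × ι ↪ ι') : HasPI M n z := by
  have hdg : ∀ o, star (d o) * g = star (d o) := fun o => by
    have := congrArg star (hgd o); simpa [hgs] using this
  have hin : ∀ a b o o', star (v (κ (a, o)) * d o) * (v (κ (b, o')) * d o') =
      star (d o) * (star (v (κ (a, o))) * v (κ (b, o'))) * d o' := by
    intro a b o o'; simp only [star_mul, mul_assoc]
  have h0 : ∀ a b o o', (a, o) ≠ (b, o') → star (v (κ (a, o)) * d o) * (v (κ (b, o')) * d o') = 0 := by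
    intro a b o o' h
    rw [hin, hvv _ _ (fun h' => h (κ.injective h'))]; simp
  have h1 : ∀ a o, star (v (κ (a, o)) * d o) * (v (κ (a, o)) * d o) = star (d o) * d o := by
    intro a o
    rw [hin, hvg, hdg]
  have key : ∀ a : Fin n, ∃ U ∈ M, (∀ x, HasSum (fun o => (v (κ (a, o)) * d o) x) (U x)) ∧
      (∀ x, HasSum (fun o => star (v (κ (a, o)) * d o) x) (star U x)) ∧
      (∀ o, star (v (κ (a, o)) * d o) * U = star (v (κ (a, o)) * d o) * (v (κ (a, o)) * d o)) := by
    intro a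
    have g1 : ∀ o, v (κ (a, o)) * d o * star (v (κ (a, o)) * d o) * (v (κ (a, o)) * d o) =
        v (κ (a, o)) * d o := by
      intro o
      rw [mul_assoc, h1, mul_assoc, ← mul_assoc (d o), hdp]
    obtain ⟨U, hU, a1, a2, a3, -⟩ := strong_sum (fun o => v (κ (a, o)) * d o) hM
      (fun o => mul_mem (hv _) (hd _)) g1
      (fun o o' h => h0 a a o o' (fun h' => h (Prod.mk.inj h').2))
      (fun o o' h => by rw [star_mul, mul_assoc, ← mul_assoc (d o), hdd _ _ h]; simp)
    exact ⟨U, hU, a1, a2, a3⟩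
  choose U hUM hU hU' hU'' using key
  refine ⟨U, hUM, fun a b => ?_⟩
  split_ifs with hab
  · subst hab
    ext x
    have e := hU' a (U a x)
    simp only [← mulA, hU'', h1] at e
    exact e.unique (hsum x)
  · rw [← zero_mul (U b)]
    refine ss_ext_mul _ (hU b) fun o => ?_
    have : star (v (κ (b, o)) * d o) * U a = 0 := by
      rw [← zero_mul (U a)]
      have := ss_ext_mul _ (hU a) (X := star (v (κ (b, o)) * d o)) (Y := 0) fun o' => by
        rw [h0 _ _ _ _ (fun h' => hab (Prod.mk.inj h').1.symm), zero_mul]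
      exact this
    have := congrArg star this
    simpa using this

lemma exists_emb (J : Type u) [Infinite J] (n : ℕ) : Nonempty (Fin n × Option J ↪ J) := by
  rw [← Cardinal.lift_mk_le']
  simp only [Cardinal.mk_prod, Cardinal.lift_id, Cardinal.mk_option, Cardinal.mk_fin,
    Cardinal.lift_natCast, Cardinal.mk_add_one_eq]
  refine (Cardinal.mul_le_max _ _).trans ?_
  simp [Cardinal.aleph0_le_mk, (Cardinal.natCast_lt_aleph0 (n := n)).le.trans (Cardinal.aleph0_le_mk J)]

end VN4

set_option linter.unusedSectionVars false
set_option linter.unusedVariables false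

section VN5
universe u
variable {K : Type u} [NormedAddCommGroup K] [InnerProductSpace ℂ K] [CompleteSpace K]

local notation "⟪" x "," y "⟫" => inner ℂ x y

/-- from a projection with either infinitely many copies or a near-trace to a properly infinite
central piece -/
lemma pi_step_core {M : StarSubalgebra ℂ (K →L[ℂ] K)} (hM : IsVN M) {e : K →L[ℂ] K}
    (heM : e ∈ M) (hec : ∀ m ∈ M, e * m = m * e)
    (hT0 : ∀ (ι : Type u) [Fintype ι] (ζ η : ι → K) (C : ℝ),
      (∀ x ∈ M, ∑ i, ‖x (ζ i)‖ ^ 2 ≤ C * ∑ i, ‖star x (η i)‖ ^ 2) → ∀ i, e (ζ i) = 0) (n : ℕ)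
    {s g : K →L[ℂ] K} {ξ : K} (hfaith : ∀ a ∈ M, a ξ = 0 → a * s = 0)
    (hgM : g ∈ M) (hgs : star g = g) (hgg : g * g = g) (hg0 : g ≠ 0) (hgsx : g * s = g)
    (heg : e * g = g) (J0 : Set (K →L[ℂ] K)) (hJ0 : ∀ v ∈ J0, v ∈ M ∧ star v * v = g)
    (hJ0p : J0.Pairwise fun v v' => star v * v' = 0)
    (halt : J0.Infinite ∨ ∃ u0 : K →L[ℂ] K, ∀ x ∈ M, g * x = x → x * g = x →
      ‖x ξ‖ ^ 2 ≤ 2 * ‖star x (star u0 ξ)‖ ^ 2) :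
    ∃ z ∈ M, (∀ m ∈ M, z * m = m * z) ∧ z * z = z ∧ star z = z ∧ z * g ≠ 0 ∧ HasPI M n z := by
  classical
  obtain ⟨J, hJJ, hJ, hJp, hmax⟩ := zorn_pairwise (fun v : K →L[ℂ] K => v ∈ M ∧ star v * v = g)
    (fun v v' => star v * v' = 0) J0 hJ0 hJ0p
  have hvg : ∀ v ∈ J, v * g = v := fun v hv => mul_of_star_mul hgs hgg (hJ v hv).2
  have hvv : ∀ v ∈ J, v * star v * v = v := fun v hv => by rw [mul_assoc, (hJ v hv).2, hvg v hv]
  have horth : ∀ i j : J, i ≠ j → star (i : K →L[ℂ] K) * j = 0 := fun i j hij =>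
    hJp i.2 j.2 fun h => hij (Subtype.ext h)
  have horth2 : ∀ i j : J, i ≠ j →
      (i : K →L[ℂ] K) * star (i : K →L[ℂ] K) * (j * star (j : K →L[ℂ] K)) = 0 := by
    intro i j hij
    rw [mul_assoc, ← mul_assoc (star (i : K →L[ℂ] K)), horth i j hij]; simp
  have hpp : ∀ i : J, (i : K →L[ℂ] K) * star (i : K →L[ℂ] K) * (i * star (i : K →L[ℂ] K)) =
      i * star (i : K →L[ℂ] K) := by
    intro i
    rw [← mul_assoc, hvv i i.2]
  obtain ⟨R, hRM, hR, hR', r1, r2, r3, r4⟩ := strong_sum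
    (fun i : J => (i : K →L[ℂ] K) * star (i : K →L[ℂ] K)) hM
    (fun i => mul_mem (hJ i i.2).1 (star_mem (hJ i i.2).1))
    (fun i => by simp only [star_mul, star_star]; rw [hpp, hpp])
    (fun i j hij => by simp only [star_mul, star_star]; exact horth2 i j hij)
    (fun i j hij => by simp only [star_mul, star_star]; exact horth2 i j hij)
  have hRs : star R = R := by
    ext x
    have := hR' x
    simp only [star_mul, star_star] at this
    exact this.unique (hR x)
  have hRv : ∀ v ∈ J, R * v = v := by
    intro v hv
    have h := r3 ⟨v, hv⟩
    simp only [star_mul, star_star] at h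
    have hp := hpp ⟨v, hv⟩
    simp only at hp
    rw [hp] at h
    calc R * v = R * (v * star v * v) := by rw [hvv v hv]
      _ = R * (v * star v) * v := by simp only [mul_assoc]
      _ = v := by rw [h, hvv v hv]
  have hvR : ∀ v ∈ J, star v * R = star v := fun v hv => by
    have := congrArg star (hRv v hv); simpa [hRs] using this
  have hRR : R * R = R := by
    conv_rhs => rw [← one_mul R]
    refine ss_ext_mul _ hR fun i => ?_
    rw [← mul_assoc, hRv i i.2, one_mul]
  have hno : ¬ ∃ v ∈ M, star v * v = g ∧ (1 - R) * v = v := by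
    rintro ⟨v, hvM, h1, h2⟩
    have hRv0 : R * v = 0 := by
      rw [sub_mul, one_mul] at h2; simpa using h2
    have h3 : ∀ w ∈ J, star w * v = 0 := fun w hw => by
      rw [← hvR w hw, mul_assoc, hRv0, mul_zero]
    have : v ∈ J := hmax v ⟨hvM, h1⟩ fun w hw => ⟨by
      have := congrArg star (h3 w hw); simpa using this, h3 w hw⟩
    rw [hRv v this] at hRv0
    apply hg0
    rw [← h1, hRv0]; simp
  obtain ⟨z, hzM, hzc, hzz, hzs, hzg, w, hwM, hww, hgw⟩ := comparison hM (sub_mem (one_mem M) hRM) hgM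
    (by simp [hRs]) (by rw [mul_sub, sub_mul, sub_mul, hRR]; simp) hgs hgg hno
  refine ⟨z, hzM, hzc, hzz, hzs, hzg, ?_⟩
  -- the elements d
  let d : Option J → K →L[ℂ] K := fun o => match o with
    | none => w
    | some j => star (j : K →L[ℂ] K) * z
  have hzE : star (z * (1 - R)) = z * (1 - R) := by
    rw [star_mul, hzs, star_sub, star_one, hRs, hzc _ (sub_mem (one_mem M) hRM)]
  have hzE2 : (z * (1 - R)) * (z * (1 - R)) = z * (1 - R) := by
    calc (z * (1 - R)) * (z * (1 - R)) = z * ((1 - R) * z) * (1 - R) := by simp only [mul_assoc]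
      _ = (z * z) * ((1 - R) * (1 - R)) := by
        rw [← hzc _ (sub_mem (one_mem M) hRM)]; simp only [mul_assoc]
      _ = _ := by rw [hzz]; congr 1; rw [mul_sub, sub_mul, sub_mul, hRR]; simp
  have hwE : w * (z * (1 - R)) = w := mul_of_star_mul hzE hzE2 hww
  have hwv : ∀ v ∈ J, w * v = 0 := by
    intro v hv
    rw [← hwE, mul_assoc, mul_assoc, sub_mul, hRv v hv]; simp
  have hwz : w * z = w := by
    conv_lhs => rw [← hwE]
    conv_rhs => rw [← hwE]
    rw [mul_assoc, mul_assoc z, ← hzc _ (sub_mem (one_mem M) hRM), ← mul_assoc z, hzz]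
  have hdM : ∀ o, d o ∈ M := by
    rintro (_ | j)
    · exact hwM
    · exact mul_mem (star_mem (hJ j j.2).1) hzM
  have hdz : ∀ o, d o * z = d o := by
    rintro (_ | j)
    · exact hwz
    · simp only [d]; rw [mul_assoc, hzz]
  have hgd : ∀ o, g * d o = d o := by
    rintro (_ | j)
    · exact hgw
    · simp only [d]
      have := congrArg star (hvg j j.2)
      rw [star_mul, hgs] at this
      rw [← mul_assoc, this]
  have hdd : ∀ o o', o ≠ o' → d o * star (d o') = 0 := by
    have hx : ∀ j : J, w * star (star (j : K →L[ℂ] K) * z) = 0 := fun j => by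
      rw [star_mul, star_star, hzs, ← mul_assoc, hwz, hwv j j.2]
    rintro (_ | j) (_ | j') h
    · exact absurd rfl h
    · exact hx j'
    · have := congrArg star (hx j); simpa [d] using this
    · simp only [d]
      rw [star_mul, star_star, hzs, mul_assoc, ← mul_assoc z, hzz, hzc _ (hJ j' j'.2).1,
        ← mul_assoc, horth j j' (fun h' => h (by rw [h']))]
      simp
  have hdp : ∀ o, d o * star (d o) * d o = d o := by
    rintro (_ | j)
    · simp only [d]; rw [mul_assoc, hww, hwE]
    · simp only [d]
      have h1 := pi_star (hvv j j.2)
      have h2 := hzc _ (hJ j j.2).1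
      calc star (j : K →L[ℂ] K) * z * star (star (j : K →L[ℂ] K) * z) * (star (j : K →L[ℂ] K) * z)
          = star (j : K →L[ℂ] K) * (z * z * j) * star (j : K →L[ℂ] K) * z := by
            rw [star_mul, star_star, hzs]; simp only [mul_assoc]
        _ = (star (j : K →L[ℂ] K) * j) * (z * star (j : K →L[ℂ] K)) * z := by
            rw [hzz, h2]; simp only [mul_assoc]
        _ = (star (j : K →L[ℂ] K) * j * star (j : K →L[ℂ] K)) * (z * z) := by
            rw [hzc _ (star_mem (hJ j j.2).1)]; simp only [mul_assoc]
        _ = _ := by rw [h1, hzz]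
  have hdsum : ∀ x, HasSum (fun o => (star (d o) * d o) x) (z x) := by
    intro x
    have h1 : HasSum (fun j : J => (star (d (some j)) * d (some j)) x) ((z * R) x) := by
      have := (hR x).mapL z
      rw [mulA]
      convert this using 2 with j
      simp only [d]
      rw [← mulA]
      congr 1
      rw [star_mul, star_star, hzs]
      calc z * (j : K →L[ℂ] K) * (star (j : K →L[ℂ] K) * z)
          = z * j * (star (j : K →L[ℂ] K) * z) := rfl
        _ = (z * z) * (j * star (j : K →L[ℂ] K)) := by
          rw [← hzc _ (star_mem (hJ j j.2).1), mul_assoc, ← mul_assoc (j : K →L[ℂ] K),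
            ← hzc _ (hJ j j.2).1]; simp only [mul_assoc]
        _ = _ := by rw [hzz]
    have := hasSum_opt (f := fun o => (star (d o) * d o) x) h1
    convert this using 1
    simp only [d]
    rw [hww, ← add_apply, ← mul_add]; simp
  by_cases hfin : J.Finite
  swap
  · have : Infinite J := Set.infinite_coe_iff.2 hfin
    obtain ⟨κ⟩ := exists_emb J n
    exact pi_generic hM hgs hgg d hdM hdd hdp hgd hdsum (fun j : J => (j : K →L[ℂ] K))
      (fun j => (hJ j j.2).1) (fun j => (hJ j j.2).2) horth κ
  · exfalso
    rcases halt with hinf | ⟨u0, hu0⟩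
    · exact hinf (hfin.subset hJJ)
    have : Fintype J := hfin.fintype
    have hnorm : ∀ k : K, ∑ o, ‖d o k‖ ^ 2 = ‖z k‖ ^ 2 := by
      intro k
      have h1 : ∑ o, (star (d o) * d o) k = z k := (hasSum_fintype _).unique (hdsum k)
      rw [norm_sq_star z k, hzs, hzz, ← h1]
      simp only [sum_inner, Complex.re_sum, ← norm_sq_star]
    have hzds : ∀ o, z * star (d o) = star (d o) := fun o => by
      have := congrArg star (hdz o); simpa [hzs] using this
    have hnorm2 : ∀ x ∈ M, ∀ o (k : K), ∑ o', ‖d o' (x (star (d o) k))‖ ^ 2 =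
        ‖x (star (d o) k)‖ ^ 2 := by
      intro x hx o k
      rw [hnorm, ← hzds o, mulA, ← mulA x z, ← hzc x hx, ← mulA, ← mulA, ← mulA]
      simp only [← mul_assoc, hzz]
    have := hT0 (Option J) (fun o => star (d o) ξ) (fun o => star (d o) (star u0 ξ)) 2 ?_
    · -- conclusion
      have hne : ∃ v, v ∈ J := by
        by_contra hcon
        push Not at hcon
        exact hcon g (hmax g ⟨hgM, by rw [hgs, hgg]⟩ fun v hv => absurd hv (hcon v))
      obtain ⟨v, hv⟩ := hne
      have h1 := this (some ⟨v, hv⟩)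
      simp only [d] at h1
      rw [star_mul, star_star, hzs, ← mulA] at h1
      have h2 : (z * g) ξ = 0 := by
        have h3 : (star v : K →L[ℂ] K) ((e * (z * v)) ξ) = 0 := by rw [h1, map_zero]
        rw [← mulA] at h3
        have : star v * (e * (z * v)) = z * g := by
          rw [hzc v (hJ v hv).1, ← mul_assoc e, hec v (hJ v hv).1, ← mul_assoc, ← mul_assoc,
            (hJ v hv).2, ← hec g hgM, heg, ← hzc g hgM]
        rwa [this] at h3
      apply hzg
      have := hfaith _ (mul_mem hzM hgM) h2
      rwa [mul_assoc, hgsx] at this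
    · intro x hx
      calc ∑ o, ‖x (star (d o) ξ)‖ ^ 2 = ∑ o, ∑ o', ‖d o' (x (star (d o) ξ))‖ ^ 2 := by
            refine Finset.sum_congr rfl fun o _ => (hnorm2 x hx o ξ).symm
        _ ≤ ∑ o, ∑ o', 2 * ‖d o (star x (star (d o') (star u0 ξ)))‖ ^ 2 := by
            refine Finset.sum_le_sum fun o _ => Finset.sum_le_sum fun o' _ => ?_
            have := hu0 (d o' * x * star (d o)) (mul_mem (mul_mem (hdM _) hx) (star_mem (hdM _)))
              (by rw [← mul_assoc, ← mul_assoc, hgd]) (by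
                have := congrArg star (hgd o)
                rw [star_mul, hgs] at this
                rw [mul_assoc, this])
            simpa only [star_mul, star_star, mulA] using this
        _ = 2 * ∑ o', ∑ o, ‖d o (star x (star (d o') (star u0 ξ)))‖ ^ 2 := by
            rw [Finset.sum_comm]; simp only [Finset.mul_sum]
        _ = _ := by
            congr 1
            refine Finset.sum_congr rfl fun o _ => hnorm2 _ (star_mem hx) o _

end VN5

set_option linter.unusedSectionVars false

section VN6
universe u
variable {K : Type u} [NormedAddCommGroup K] [InnerProductSpace ℂ K] [CompleteSpace K]

local notation "⟪" x "," y "⟫" => inner ℂ x y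

lemma pi_step {M : StarSubalgebra ℂ (K →L[ℂ] K)} (hM : IsVN M) {e : K →L[ℂ] K}
    (heM : e ∈ M) (hec : ∀ m ∈ M, e * m = m * e)
    (hT0 : ∀ (ι : Type u) [Fintype ι] (ζ η : ι → K) (C : ℝ),
      (∀ x ∈ M, ∑ i, ‖x (ζ i)‖ ^ 2 ≤ C * ∑ i, ‖star x (η i)‖ ^ 2) → ∀ i, e (ζ i) = 0) (n : ℕ)
    {y : K →L[ℂ] K} (hyM : y ∈ M) (hyy : y * y = y) (hey : e * y = y) (hy0 : y ≠ 0) :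
    ∃ z ∈ M, (∀ m ∈ M, z * m = m * z) ∧ z * z = z ∧ star z = z ∧ z * y ≠ 0 ∧ HasPI M n z := by
  obtain ⟨ξ0, hξ0⟩ : ∃ ξ0, y ξ0 ≠ 0 := by
    by_contra hcon
    push Not at hcon
    exact hy0 (ContinuousLinearMap.ext hcon)
  set ξ := y ξ0 with hξ
  have hyξ : y ξ = ξ := by rw [hξ, ← mulA, hyy]
  let V : Submodule ℂ K :=
    { carrier := {v | ∃ x : K →L[ℂ] K, (∀ m ∈ M, m * x = x * m) ∧ v = x ξ}
      add_mem' := by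
        rintro _ _ ⟨x, hx, rfl⟩ ⟨x', hx', rfl⟩
        exact ⟨x + x', fun m hm => by rw [mul_add, add_mul, hx m hm, hx' m hm], rfl⟩
      zero_mem' := ⟨0, by simp, rfl⟩
      smul_mem' := by
        rintro c _ ⟨x, hx, rfl⟩
        exact ⟨c • x, fun m hm => by rw [mul_smul_comm, smul_mul_assoc, hx m hm], rfl⟩ }
  set s := cproj V with hs
  have hss : star s = s := cproj_star V
  have hs2 : s * s = s := cproj_mul_self V
  have hsM : s ∈ M := by
    refine cproj_mem hM V fun y hy v hv => ?_
    obtain ⟨x, hx, rfl⟩ := hv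
    exact ⟨y * x, fun m hm => by rw [← mul_assoc, hy m hm, mul_assoc, hx m hm, mul_assoc], rfl⟩
  have hsξ : s ξ = ξ := cproj_apply_mem ⟨1, by simp, rfl⟩
  have hfaith : ∀ a ∈ M, a ξ = 0 → a * s = 0 := by
    intro a ha h
    have : a * s = 0 * s := by
      refine mul_cproj_ext ?_
      rintro _ ⟨x, hx, rfl⟩
      rw [← mulA, hx a ha, mulA, h]; simp
    rw [this, zero_mul]
  have hys : y * s = s := by
    have : (y - 1) * s = 0 := hfaith _ (sub_mem hyM (one_mem M)) (by simp [hyξ])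
    rw [sub_mul, one_mul, sub_eq_zero] at this
    exact this
  have hes : e * s = s := by rw [← hys, ← mul_assoc, hey]
  obtain ⟨U, hUM, hUU, hsU, hUs, hU2, hUmax⟩ := exhaust hM s s ξ
  have hUs' : s * star U = star U := by have := congrArg star hUs; simpa [hss] using this
  have hsU' : star U * s = star U := by have := congrArg star hsU; simpa [hss] using this
  suffices hmain : ∃ g ∈ M, star g = g ∧ g * g = g ∧ g ≠ 0 ∧ g * s = g ∧
      ∃ J0 : Set (K →L[ℂ] K), (∀ v ∈ J0, v ∈ M ∧ star v * v = g) ∧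
        (J0.Pairwise fun v v' => star v * v' = 0) ∧
        (J0.Infinite ∨ ∃ u0 : K →L[ℂ] K, ∀ x ∈ M, g * x = x → x * g = x →
          ‖x ξ‖ ^ 2 ≤ 2 * ‖star x (star u0 ξ)‖ ^ 2) by
    obtain ⟨g, hgM, hgs, hgg, hg0, hgsx, J0, hJ0, hJ0p, halt⟩ := hmain
    have hsg : s * g = g := by have := congrArg star hgsx; simpa [hss, hgs] using this
    obtain ⟨z, h1, h2, h3, h4, h5, h6⟩ := pi_step_core hM heM hec hT0 n hfaith hgM hgs hgg hg0 hgsx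
      (by rw [← hsg, ← mul_assoc, hes]) J0 hJ0 hJ0p halt
    refine ⟨z, h1, h2, h3, h4, fun h => h5 ?_, h6⟩
    rw [← hsg, ← hys, mul_assoc, ← mul_assoc z, h, zero_mul]
  by_cases hca : ∃ y' ∈ M, y' ≠ 0 ∧ s * y' = y' ∧ y' * s = y' ∧ y' * star U = 0 ∧ star y' * U = 0
  · obtain ⟨y', hy'M, hy'0, a1, a2, a3, a4⟩ := hca
    obtain ⟨u, huM, hu0, huu, ⟨X, hX⟩, ⟨Y, hY⟩⟩ := exists_pi hM hy'M hy'0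
    have b1 : s * u = u := by rw [hX, ← mul_assoc, a1]
    have b2 : u * s = u := by rw [hY, mul_assoc, a2]
    have b3 : u * star U = 0 := by rw [hY, mul_assoc, a3, mul_zero]
    have b4 : star u * U = 0 := by rw [hX, star_mul, mul_assoc, a4, mul_zero]
    refine ⟨star u * u, mul_mem (star_mem huM) huM, by simp, ?_, ?_, by rw [mul_assoc, b2], ∅,
      by simp, by simp, Or.inr ⟨u, ?_⟩⟩
    · rw [← mul_assoc, pi_star huu]
    · intro h; exact hu0 (CStarRing.star_mul_self_eq_zero_iff _ |>.1 h)
    · intro x hx h1 h2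
      have key := layer_ineq hM (mul_mem huM hx) ξ ?_
      · have e1 : ‖(u * x) ξ‖ ^ 2 = ‖x ξ‖ ^ 2 := by
          rw [norm_sq_star, norm_sq_star, star_mul, mul_assoc, ← mul_assoc (star u), h1]
        rw [e1, star_mul, mulA] at key
        exact key
      · rintro w hw hww ⟨X', hX'⟩ ⟨Y', hY'⟩
        by_contra hcon
        push Not at hcon
        have : w = 0 := by
          refine hUmax w hw hww ?_ ?_ ?_ ?_ hcon.le
          · rw [hX', ← mul_assoc, ← mul_assoc, b1]
          · rw [hY', ← h2]; simp only [mul_assoc]; rw [b2]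
          · rw [hY', ← h2]; simp only [mul_assoc]; rw [b3]; simp
          · rw [hX']; simp only [star_mul, mul_assoc]; rw [b4]; simp
        rw [this] at hcon
        simp at hcon
  · set f1 := s - U * star U with hf1
    set e1 := s - star U * U with he1
    have hf1s : star f1 = f1 := by simp [hf1, hss]
    have he1s : star e1 = e1 := by simp [he1, hss]
    have hf1U : f1 * U = 0 := by rw [hf1, sub_mul, hsU, hUU, sub_self]
    have hUf1 : star U * f1 = 0 := by rw [hf1, mul_sub, hsU', ← mul_assoc, pi_star hUU, sub_self]
    have he1U : e1 * star U = 0 := by rw [he1, sub_mul, hUs', pi_star hUU, sub_self]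
    have hf1M : f1 ∈ M := sub_mem hsM (mul_mem hUM (star_mem hUM))
    have he1M : e1 ∈ M := sub_mem hsM (mul_mem (star_mem hUM) hUM)
    have hsf1 : s * f1 = f1 := by rw [hf1, mul_sub, hs2, ← mul_assoc, hsU]
    have hf1s' : f1 * s = f1 := by rw [hf1, sub_mul, hs2, mul_assoc, hsU']
    have he1s' : e1 * s = e1 := by rw [he1, sub_mul, hs2, mul_assoc, hUs]
    have hf1f1 : f1 * f1 = f1 := by
      conv_lhs => rw [hf1, sub_mul, mul_assoc, ← hf1, hUf1, mul_zero, sub_zero, hsf1]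
    have hzero : ∀ m ∈ M, e1 * m * f1 = 0 := by
      intro m hm
      have : f1 * star m * e1 = 0 := by
        by_contra hne
        refine hca ⟨f1 * star m * e1, mul_mem (mul_mem hf1M (star_mem hm)) he1M, hne, ?_, ?_, ?_, ?_⟩
        · rw [← mul_assoc, ← mul_assoc, hsf1]
        · rw [mul_assoc, he1s']
        · rw [mul_assoc, he1U, mul_zero]
        · simp only [star_mul, hf1s, mul_assoc]; rw [hf1U]; simp
      have := congrArg star this
      simpa [hf1s, he1s, mul_assoc] using this
    have hf10 : f1 ≠ 0 := by
      intro h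
      have hUUs : U * star U = s := (sub_eq_zero.1 h).symm
      have h1 : ‖star U ξ‖ ^ 2 = ‖ξ‖ ^ 2 := by
        rw [norm_sq_star, star_star, hUUs, hsξ, ← inner_self_eq_norm_sq (𝕜 := ℂ)]; rfl
      have h2 : ‖U ξ‖ ^ 2 ≤ ‖ξ‖ ^ 2 := by
        have := U.le_of_opNorm_le (pi_norm_le hUU) ξ
        rw [one_mul] at this
        gcongr
      have h3 : 0 < ‖ξ‖ := norm_pos_iff.2 hξ0
      rw [h1] at hU2
      nlinarith [pow_pos h3 2]
    let v : ℕ → K →L[ℂ] K := fun k => U ^ k * f1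
    have hvs : ∀ k, v (k + 1) = U * v k := fun k => by simp only [v]; rw [pow_succ', mul_assoc]
    have hv0 : v 0 = f1 := by simp [v]
    have hsv : ∀ k, s * v k = v k := by
      intro k
      cases k with
      | zero => rw [hv0, hsf1]
      | succ k => rw [hvs, ← mul_assoc, hsU]
    have hUUv : ∀ k, star U * U * v k = v k := by
      intro k
      have h1 : e1 * v k = 0 := by
        have := hzero (U ^ k) (pow_mem hUM k)
        rwa [mul_assoc] at this
      rw [he1, sub_mul, hsv, sub_eq_zero] at h1
      exact h1.symm
    have hpeel : ∀ j k, star (v (j + 1)) * v (k + 1) = star (v j) * v k := by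
      intro j k
      rw [hvs, hvs, star_mul, mul_assoc, ← mul_assoc (star U), hUUv]
    have hdiag : ∀ k, star (v k) * v k = f1 := by
      intro k
      induction k with
      | zero => rw [hv0, hf1s, hf1f1]
      | succ k ih => rw [hpeel, ih]
    have hoff : ∀ j k, star (v j) * v (j + k + 1) = 0 := by
      intro j k
      induction j with
      | zero => rw [hv0, hf1s, hvs, ← mul_assoc, hf1U, zero_mul]
      | succ j ih => rw [show j + 1 + k + 1 = (j + k + 1) + 1 by ring, hpeel, ih]
    have hoff' : ∀ j k, j ≠ k → star (v j) * v k = 0 := by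
      intro j k h
      rcases lt_or_gt_of_ne h with h | h
      · obtain ⟨i, rfl⟩ := Nat.exists_eq_add_of_lt h
        exact hoff j i
      · obtain ⟨i, rfl⟩ := Nat.exists_eq_add_of_lt h
        have := congrArg star (hoff k i); simpa using this
    have hinj : Function.Injective v := by
      intro j k h
      by_contra hne
      have := hoff' j k hne
      rw [← h, hdiag] at this
      exact hf10 this
    refine ⟨f1, hf1M, hf1s, hf1f1, hf10, hf1s', Set.range v, ?_, ?_,
      Or.inl (Set.infinite_range_of_injective hinj)⟩
    · rintro _ ⟨k, rfl⟩
      exact ⟨mul_mem (pow_mem hUM k) hf1M, hdiag k⟩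
    · rintro _ ⟨j, rfl⟩ _ ⟨k, rfl⟩ h
      exact hoff' j k fun h' => h (by rw [h'])

theorem pi_thm {M : StarSubalgebra ℂ (K →L[ℂ] K)} (hM : IsVN M) {e : K →L[ℂ] K}
    (heM : e ∈ M) (hec : ∀ m ∈ M, e * m = m * e) (hee : e * e = e) (hes : star e = e)
    (hT0 : ∀ (ι : Type u) [Fintype ι] (ζ η : ι → K) (C : ℝ),
      (∀ x ∈ M, ∑ i, ‖x (ζ i)‖ ^ 2 ≤ C * ∑ i, ‖star x (η i)‖ ^ 2) → ∀ i, e (ζ i) = 0) (n : ℕ) :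
    HasPI M n e := by
  obtain ⟨J, -, hJ, hJp, hmax⟩ := zorn_pairwise (fun z : K →L[ℂ] K => z ∈ M ∧
    (∀ m ∈ M, z * m = m * z) ∧ z * z = z ∧ star z = z ∧ e * z = z ∧ HasPI M n z)
    (fun z z' => z * z' = 0) ∅ (by simp) (by simp)
  have hJM := fun z : J => (hJ z z.2).1
  have hJc := fun z : J => (hJ z z.2).2.1
  have hJi := fun z : J => (hJ z z.2).2.2.1
  have hJs := fun z : J => (hJ z z.2).2.2.2.1
  have hJe := fun z : J => (hJ z z.2).2.2.2.2.1
  have hJpi := fun z : J => (hJ z z.2).2.2.2.2.2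
  have hJo : ∀ i j : J, i ≠ j → (i : K →L[ℂ] K) * j = 0 := fun i j hij =>
    hJp i.2 j.2 fun h => hij (Subtype.ext h)
  choose v hvM hv using hJpi
  obtain ⟨Z, hZM, hZ, hZ', z1, z2, z3, z4⟩ := strong_sum (fun i : J => (i : K →L[ℂ] K)) hM hJM
    (fun i => by rw [hJs, hJi, hJi]) (fun i j h => by rw [hJs, hJo i j h])
    (fun i j h => by rw [hJs, hJo i j h])
  have hZs : star Z = Z := by
    ext x
    have := hZ' x
    simp only [hJs] at this
    exact this.unique (hZ x)
  have hZz : ∀ z : J, Z * z = z := fun z => by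
    have := z3 z
    simp only [hJs, hJi] at this
    exact this
  have hZZ : Z * Z = Z := by
    conv_rhs => rw [← one_mul Z]
    exact ss_ext_mul _ hZ fun i => by rw [hZz, one_mul]
  have heZ : e * Z = Z := by
    conv_rhs => rw [← one_mul Z]
    exact ss_ext_mul _ hZ fun i => by rw [hJe, one_mul]
  have hZc : ∀ m ∈ M, Z * m = m * Z := by
    intro m hm
    ext x
    have a := (hZ x).mapL m
    have b := hZ (m x)
    refine b.unique ?_
    rw [mulA]
    convert a using 2 with i
    rw [← mulA, hJc i m hm, mulA]
  have hvz : ∀ (z : J) i, v z i * z = v z i := fun z i =>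
    mul_of_star_mul (hJs z) (hJi z) (by rw [hv]; simp)
  have hPIZ : HasPI M n Z := by
    have h1 : ∀ (z z' : J) i j, z ≠ z' → star (v z i) * v z' j = 0 := by
      intro z z' i j h
      rw [← hvz z i, ← hvz z' j, ← hJc z' _ (hvM z' j), star_mul, hJs,
        hJc z _ (star_mem (hvM z i)), mul_assoc, ← mul_assoc (z : K →L[ℂ] K), hJo z z' h]
      simp
    have h2 : ∀ (z z' : J) i j, z ≠ z' → v z i * star (v z' j) = 0 := by
      intro z z' i j h
      rw [← hvz z i, ← hvz z' j, star_mul, hJs, mul_assoc, ← mul_assoc (z : K →L[ℂ] K), hJo z z' h]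
      simp
    have key : ∀ i : Fin n, ∃ V ∈ M, (∀ x, HasSum (fun z : J => v z i x) (V x)) := by
      intro i
      obtain ⟨V, hV, a1, -⟩ := strong_sum (fun z : J => v z i) hM (fun z => hvM z i)
        (fun z => by rw [mul_assoc, hv]; simp [hvz]) (fun z z' h => h1 z z' i i h)
        (fun z z' h => h2 z z' i i h)
      exact ⟨V, hV, a1⟩
    choose V hVM hV using key
    have h3 : ∀ (z : J) i j, star (v z j) * V i = star (v z j) * v z i := by
      intro z i j
      ext x
      refine ((hV i x).mapL (star (v z j))).unique ?_
      rw [mulA]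
      refine hasSum_single z fun z' hz' => ?_
      rw [← mulA, h1 z z' j i hz'.symm]; rfl
    have h4 : ∀ (z : J) i j, star (V i) * v z j = star (v z i) * v z j := by
      intro z i j
      have := congrArg star (h3 z i j); simpa using this
    refine ⟨V, hVM, fun i j => ?_⟩
    ext x
    have a := (hV j x).mapL (star (V i))
    simp only [← mulA, h4, hv] at a
    refine a.unique ?_
    split_ifs with hij
    · exact hZ x
    · exact hasSum_zero
  by_cases hy : e - Z = 0
  · rw [sub_eq_zero.1 hy]; exact hPIZ
  exfalso
  have hZe : Z * e = Z := by rw [hZc e heM, heZ]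
  set y := e - Z with hydef
  have hyM : y ∈ M := sub_mem heM hZM
  have hyc : ∀ m ∈ M, y * m = m * y := fun m hm => by
    rw [hydef, sub_mul, mul_sub, hec m hm, hZc m hm]
  have hyy : y * y = y := by rw [hydef, sub_mul, mul_sub, mul_sub, hee, heZ, hZe, hZZ]; abel
  have hey : e * y = y := by rw [hydef, mul_sub, hee, heZ]
  have hys : star y = y := by rw [hydef, star_sub, hes, hZs]
  obtain ⟨z, hzM, hzc, hzz, hzs, hzy, w, hwM, hw⟩ := pi_step hM heM hec hT0 n hyM hyy hey hy
  have hyz : ∀ z' ∈ J, y * z' = 0 := fun z' hz' => by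
    rw [hydef, sub_mul, hZz ⟨z', hz'⟩, hJe ⟨z', hz'⟩, sub_self]
  have hin : z * y ∈ J := by
    refine hmax _ ⟨mul_mem hzM hyM, fun m hm => ?_, ?_, ?_, ?_, fun i => w i * y, fun i =>
      mul_mem (hwM i) hyM, fun i j => ?_⟩ fun z' hz' => ⟨?_, ?_⟩
    · rw [mul_assoc, hyc m hm, ← mul_assoc, hzc m hm, mul_assoc]
    · rw [mul_assoc, ← mul_assoc y, hyc z hzM, mul_assoc z y y, hyy, ← mul_assoc, hzz]
    · rw [star_mul, hzs, hys, hyc z hzM]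
    · rw [← mul_assoc, hec z hzM, mul_assoc, hey]
    · rw [star_mul, hys, mul_assoc, ← mul_assoc (star (w i)), hw]
      split_ifs
      · rw [hzc y hyM, ← mul_assoc, hyy]
      · simp
    · rw [mul_assoc, hyz z' hz', mul_zero]
    · rw [hzc y hyM, ← mul_assoc, ← hyc z' (hJ z' hz').1, hyz z' hz', zero_mul]
  have := hyz _ hin
  rw [hzc y hyM, ← mul_assoc, hyy, ← hzc y hyM] at this
  exact hzy this

end VN6

set_option linter.unusedSectionVars false

section VN7
universe u
variable {K : Type u} [NormedAddCommGroup K] [InnerProductSpace ℂ K] [CompleteSpace K]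

local notation "⟪" x "," y "⟫" => inner ℂ x y

/-- approximate Cuntz–Pedersen subequivalence -/
def SubEq (M : StarSubalgebra ℂ (K →L[ℂ] K)) (s t : K →L[ℂ] K) : Prop :=
  ∀ δ : ℝ, 0 < δ → ∃ (ι : Type) (_ : Fintype ι) (z : ι → K →L[ℂ] K), (∀ i, z i ∈ M) ∧
    s ≤ ∑ i, star (z i) * z i + δ • (1 : K →L[ℂ] K) ∧ ∑ i, z i * star (z i) ≤ t

lemma exists_inv_sqrt {M : StarSubalgebra ℂ (K →L[ℂ] K)} (hM : IsVN M) {c : K →L[ℂ] K}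
    (hc : c ∈ M) {δ : ℝ} (hδ : 0 < δ) (h : δ • (1 : K →L[ℂ] K) ≤ c) :
    ∃ r ∈ M, star r = r ∧ r * c * r = 1 := by
  have hc0 : IsSelfAdjoint c := by
    have h0 : (0 : K →L[ℂ] K) ≤ c := le_trans (smul_nonneg hδ.le zero_le_one) h
    exact IsSelfAdjoint.of_nonneg h0
  have hsp : ∀ x ∈ spectrum ℝ c, δ ≤ x := by
    refine (algebraMap_le_iff_le_spectrum (a := c) (r := δ)).1 ?_
    rwa [Algebra.algebraMap_eq_smul_one]
  have hcont : ContinuousOn (fun x : ℝ => (√x)⁻¹) (spectrum ℝ c) := by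
    refine ContinuousOn.inv₀ (by fun_prop) ?_
    intro x hx
    have := hsp x hx
    exact (Real.sqrt_pos.2 (by linarith)).ne'
  refine ⟨cfc (fun x : ℝ => (√x)⁻¹) c, cfc_mem_vn hM hc _, ?_, ?_⟩
  · exact cfc_predicate (R := ℝ) _ c
  · conv_lhs => enter [1, 2]; rw [← cfc_id ℝ c]
    rw [← cfc_mul _ _ c hcont (by fun_prop), ← cfc_mul (fun x : ℝ => (√x)⁻¹ * id x) _ c (hcont.mul (by fun_prop)) hcont,
      ← cfc_one ℝ c]
    refine cfc_congr fun x hx => ?_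
    have h1 := hsp x hx
    have h2 : 0 < √x := Real.sqrt_pos.2 (by linarith)
    have h3 : √x * √x = x := Real.mul_self_sqrt (by linarith)
    simp only [id, Pi.one_apply]
    field_simp
    nlinarith

lemma SubEq.trans {M : StarSubalgebra ℂ (K →L[ℂ] K)} (hM : IsVN M) {s t u : K →L[ℂ] K}
    (h1 : SubEq M s t) (h2 : SubEq M t u) : SubEq M s u := by
  intro δ hδ
  obtain ⟨J, _, z, hzM, hz1, hz2⟩ := h1 (δ / 2) (by linarith)
  set N : ℝ := (Fintype.card J : ℝ) with hN
  have hN0 : 0 ≤ N := by positivity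
  set d := δ / (2 * (N + 1)) with hd
  have hd0 : 0 < d := by positivity
  obtain ⟨I, _, x, hxM, hx1, hx2⟩ := h2 d hd0
  set c := ∑ i, star (x i) * x i + d • (1 : K →L[ℂ] K) with hc
  have hcM : c ∈ M := add_mem (sum_mem fun i _ => mul_mem (star_mem (hxM i)) (hxM i)) (by
    have : d • (1 : K →L[ℂ] K) = (d : ℂ) • (1 : K →L[ℂ] K) := by simp
    rw [this]; exact M.smul_mem (one_mem M) _)
  have hdc : d • (1 : K →L[ℂ] K) ≤ c := by
    rw [hc]
    exact le_add_of_nonneg_left (Finset.sum_nonneg fun i _ => star_mul_self_nonneg (x i))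
  obtain ⟨r, hrM, hrs, hr1⟩ := exists_inv_sqrt hM hcM hd0 hdc
  have hrr : star (r * c * r) = r * c * r := by rw [hr1, star_one]
  have hzle : ∀ j, z j * star (z j) ≤ c := fun j =>
    (Finset.single_le_sum (f := fun j => z j * star (z j))
      (fun i _ => mul_star_self_nonneg (z i)) (Finset.mem_univ j)).trans (hz2.trans hx1)
  have hzr : ∀ j, star (z j) * (r * r) * z j ≤ 1 := by
    intro j
    have a1 : (r * z j) * star (r * z j) ≤ 1 := by
      have := star_right_conjugate_le_conjugate (hzle j) r
      rw [hrs, hr1] at this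
      calc _ = r * (z j * star (z j)) * r := by rw [star_mul, hrs]; simp only [mul_assoc]
        _ ≤ 1 := this
    have a2 : ‖r * z j‖ ≤ 1 := by
      have b1 : ‖(r * z j) * star (r * z j)‖ ≤ 1 :=
        (CStarAlgebra.norm_le_one_iff_of_nonneg _ (mul_star_self_nonneg _)).2 a1
      rw [CStarRing.norm_self_mul_star] at b1
      nlinarith [norm_nonneg (r * z j)]
    have a3 : star (r * z j) * (r * z j) ≤ 1 := by
      rw [← CStarAlgebra.norm_le_one_iff_of_nonneg _ (star_mul_self_nonneg _),
        CStarRing.norm_star_mul_self]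
      nlinarith [norm_nonneg (r * z j)]
    calc _ = star (r * z j) * (r * z j) := by rw [star_mul, hrs]; simp only [mul_assoc]
      _ ≤ 1 := a3
  refine ⟨I × J, inferInstance, fun p => x p.1 * r * z p.2,
    fun p => mul_mem (mul_mem (hxM _) hrM) (hzM _), ?_, ?_⟩
  · have e1 : ∑ p : I × J, star (x p.1 * r * z p.2) * (x p.1 * r * z p.2) =
        ∑ j, star (z j) * z j - d • ∑ j, star (z j) * (r * r) * z j := by
      rw [Fintype.sum_prod_type_right, Finset.smul_sum, ← Finset.sum_sub_distrib]
      refine Finset.sum_congr rfl fun j _ => ?_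
      have : ∑ i, star (x i * r * z j) * (x i * r * z j) =
          star (z j) * (r * (∑ i, star (x i) * x i) * r) * z j := by
        simp only [Finset.mul_sum, Finset.sum_mul, star_mul, hrs, mul_assoc]
      rw [this]
      have h3 : ∑ i, star (x i) * x i = c - d • (1 : K →L[ℂ] K) := by rw [hc]; simp
      rw [h3, mul_sub, sub_mul, hr1, mul_sub, sub_mul]
      simp
    have e2 : ∑ j, star (z j) * (r * r) * z j ≤ N • (1 : K →L[ℂ] K) := by
      calc _ ≤ ∑ j : J, (1 : K →L[ℂ] K) := Finset.sum_le_sum fun j _ => hzr j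
        _ = _ := by simp [hN, Nat.cast_smul_eq_nsmul]
    rw [e1]
    have e3 : d • ∑ j, star (z j) * (r * r) * z j ≤ (δ / 2) • (1 : K →L[ℂ] K) := by
      calc _ ≤ d • (N • (1 : K →L[ℂ] K)) := smul_le_smul_of_nonneg_left e2 hd0.le
        _ = (d * N) • (1 : K →L[ℂ] K) := smul_smul _ _ _
        _ ≤ _ := by
          refine smul_le_smul_of_nonneg_right ?_ zero_le_one
          rw [hd]
          rw [div_mul_eq_mul_div, div_le_div_iff₀ (by positivity) (by norm_num)]
          nlinarith
    have e4 : δ • (1 : K →L[ℂ] K) = (δ / 2) • (1 : K →L[ℂ] K) + (δ / 2) • (1 : K →L[ℂ] K) := by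
      rw [← add_smul]; norm_num
    calc s ≤ _ := hz1
      _ = (∑ j, star (z j) * z j - (δ / 2) • (1 : K →L[ℂ] K)) + δ • (1 : K →L[ℂ] K) := by
        rw [e4]; abel
      _ ≤ _ := by gcongr
  · have e1 : ∑ p : I × J, (x p.1 * r * z p.2) * star (x p.1 * r * z p.2) =
        ∑ i, x i * (r * (∑ j, z j * star (z j)) * r) * star (x i) := by
      rw [Fintype.sum_prod_type]
      refine Finset.sum_congr rfl fun i _ => ?_
      simp only [Finset.mul_sum, Finset.sum_mul, star_mul, hrs, mul_assoc]
    rw [e1]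
    refine le_trans (Finset.sum_le_sum fun i _ => ?_) hx2
    have a1 := star_right_conjugate_le_conjugate (hz2.trans hx1) r
    rw [hrs, hr1] at a1
    have a2 := star_right_conjugate_le_conjugate a1 (x i)
    simpa using a2

lemma SubEq.add {M : StarSubalgebra ℂ (K →L[ℂ] K)} {s t q : K →L[ℂ] K}
    (h : SubEq M s t) (hq : q ∈ M) (hqs : star q = q) : SubEq M (s + q * q) (t + q * q) := by
  intro δ hδ
  obtain ⟨J, _, z, hzM, hz1, hz2⟩ := h δ hδ
  refine ⟨Option J, inferInstance, fun o => o.elim q z, ?_, ?_, ?_⟩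
  · rintro (_ | i)
    · exact hq
    · exact hzM i
  · rw [Fintype.sum_option]
    simp only [Option.elim, hqs]
    calc s + q * q ≤ (∑ i, star (z i) * z i + δ • (1 : K →L[ℂ] K)) + q * q := by gcongr
      _ = _ := by abel
  · rw [Fintype.sum_option]
    simp only [Option.elim, hqs]
    rw [add_comm]
    gcongr

lemma real_smul_mem (M : StarSubalgebra ℂ (K →L[ℂ] K)) {x : K →L[ℂ] K} (hx : x ∈ M) (r : ℝ) :
    r • x ∈ M := by
  have : r • x = (r : ℂ) • x := by simp
  rw [this]; exact M.smul_mem hx _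

lemma SubEq.iter {M : StarSubalgebra ℂ (K →L[ℂ] K)} (hM : IsVN M) {c : K →L[ℂ] K} (hc : c ∈ M)
    (hcs : star c = c) {ι : Type} [Fintype ι] {x : ι → K →L[ℂ] K} (hx : ∀ i, x i ∈ M)
    {ε : ℝ} (hε : 0 < ε)
    (h : c * c ≤ ∑ i, (star (x i) * x i - x i * star (x i)) + ε • (1 : K →L[ℂ] K)) (k : ℕ) :
    SubEq M (((k + 1 : ℕ) : ℝ) • (c * c) + ∑ i, x i * star (x i))
      (∑ i, x i * star (x i) + ((k + 1 : ℕ) * ε) • (1 : K →L[ℂ] K)) := by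
  have hsq : ∀ r : ℝ, 0 ≤ r → ∀ y : K →L[ℂ] K, (√r • y) * (√r • y) = r • (y * y) := by
    intro r hr y
    rw [smul_mul_smul_comm, Real.mul_self_sqrt hr]
  have base : SubEq M (c * c + ∑ i, x i * star (x i))
      (∑ i, x i * star (x i) + ε • (1 : K →L[ℂ] K)) := by
    intro δ hδ
    have hstar : star (√ε • (1 : K →L[ℂ] K)) = √ε • (1 : K →L[ℂ] K) := by
      rw [star_smul]; simp
    refine ⟨Option ι, inferInstance, fun o => o.elim (√ε • (1 : K →L[ℂ] K)) x, ?_, ?_, ?_⟩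
    · rintro (_ | i)
      · exact real_smul_mem M (one_mem M) _
      · exact hx i
    · rw [Fintype.sum_option]
      simp only [Option.elim, hstar]
      rw [hsq _ hε.le, one_mul]
      have : ∑ i, (star (x i) * x i - x i * star (x i)) =
        ∑ i, star (x i) * x i - ∑ i, x i * star (x i) := Finset.sum_sub_distrib _ _
      rw [this] at h
      calc c * c + ∑ i, x i * star (x i) ≤ (∑ i, star (x i) * x i - ∑ i, x i * star (x i) +
            ε • (1 : K →L[ℂ] K)) + ∑ i, x i * star (x i) := by gcongr
        _ = (ε • (1 : K →L[ℂ] K) + ∑ i, star (x i) * x i) := by abel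
        _ ≤ _ := le_add_of_nonneg_right (smul_nonneg hδ.le zero_le_one)
    · rw [Fintype.sum_option]
      simp only [Option.elim, hstar]
      rw [hsq _ hε.le, one_mul, add_comm]
  induction k with
  | zero => simpa using base
  | succ k ih =>
    have h1 := base.add (q := √((k + 1 : ℕ) : ℝ) • c) (real_smul_mem M hc _) (by rw [star_smul, hcs]; simp)
    have h2 := ih.add (q := √ε • 1) (real_smul_mem M (one_mem M) _) (by rw [star_smul]; simp)
    rw [hsq _ (by positivity)] at h1 h2
    have h3 : SubEq M (((k + 1 : ℕ) : ℝ) • (c * c) + ∑ i, x i * star (x i) + ε • (1 : K →L[ℂ] K) )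
      (∑ i, x i * star (x i) + ((k + 1 : ℕ) * ε) • (1 : K →L[ℂ] K) + ε • (1 : K →L[ℂ] K)) := by
      simpa using h2
    have h4 := SubEq.trans hM h1 (by convert h3 using 1; abel)
    have e1 : (((k + 1 + 1 : ℕ)) : ℝ) = ((k + 1 : ℕ) : ℝ) + 1 := by push_cast; ring
    rw [e1]
    convert h4 using 1
    · rw [add_smul, one_smul]; abel
    · rw [add_mul, one_mul, add_smul]; abel

lemma t0_lemma {M : StarSubalgebra ℂ (K →L[ℂ] K)} (hM : IsVN M) {c : K →L[ℂ] K} (hc : c ∈ M)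
    (hcs : star c = c)
    (hcp : ∀ ε : ℝ, 0 < ε → ∃ (ι : Type) (_ : Fintype ι) (x : ι → K →L[ℂ] K), (∀ i, x i ∈ M) ∧
      c * c ≤ ∑ i, (star (x i) * x i - x i * star (x i)) + ε • (1 : K →L[ℂ] K))
    {ι : Type*} [Fintype ι] (ζ η : ι → K) (C : ℝ)
    (h : ∀ x ∈ M, ∑ i, ‖x (ζ i)‖ ^ 2 ≤ C * ∑ i, ‖star x (η i)‖ ^ 2) (i : ι) : c (ζ i) = 0 := by
  have hf1 : ∀ (x : K →L[ℂ] K) (ξ : ι → K),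
      ∑ i, ‖x (ξ i)‖ ^ 2 = ∑ i, (⟪(star x * x) (ξ i), ξ i⟫).re := fun x ξ =>
    Finset.sum_congr rfl fun i _ => norm_sq_star _ _
  set F : (ι → K) → (K →L[ℂ] K) → ℝ := fun ξ y => ∑ i, (⟪y (ξ i), ξ i⟫).re with hF
  have Fadd : ∀ ξ x y, F ξ (x + y) = F ξ x + F ξ y := by
    intro ξ x y
    simp only [hF, add_apply, inner_add_left, Complex.add_re, Finset.sum_add_distrib]
  have Fsmul : ∀ ξ (r : ℝ) x, F ξ (r • x) = r * F ξ x := by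
    intro ξ r x
    simp only [hF, re_inner_smul, Finset.mul_sum]
  have Fmono : ∀ ξ x y, x ≤ y → F ξ x ≤ F ξ y := fun ξ x y h =>
    Finset.sum_le_sum fun i _ => re_inner_mono h _
  have F0 : ∀ ξ, F ξ 0 = 0 := by intro ξ; simp [hF]
  have Fnn : ∀ ξ x, 0 ≤ x → 0 ≤ F ξ x := fun ξ x hx => by rw [← F0 ξ]; exact Fmono _ _ _ hx
  have Fsum : ∀ ξ (J : Type) [Fintype J] (z : J → K →L[ℂ] K), F ξ (∑ j, z j) = ∑ j, F ξ (z j) := by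
    intro ξ J _ z
    simp only [hF, sum_apply, sum_inner, Complex.re_sum]
    exact Finset.sum_comm
  have h' : ∀ x ∈ M, F ζ (star x * x) ≤ |C| * F η (x * star x) := by
    intro x hx
    have a := h x hx
    rw [hf1, hf1, star_star] at a
    refine a.trans ?_
    exact mul_le_mul_of_nonneg_right (le_abs_self C) (Fnn η _ (mul_star_self_nonneg x))
  have hcc : 0 ≤ c * c := by
    have := star_mul_self_nonneg c
    rwa [hcs] at this
  have hkey : ∀ ε : ℝ, 0 < ε → F ζ (c * c) ≤ ε * (|C| * F η 1) := by
    intro ε hε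
    obtain ⟨J, _, x, hxM, hx⟩ := hcp ε hε
    set b := ∑ i, x i * star (x i) with hb
    have hb0 : 0 ≤ b := Finset.sum_nonneg fun i _ => mul_star_self_nonneg _
    have hk : ∀ k : ℕ, ((k + 1 : ℕ) : ℝ) * (F ζ (c * c) - ε * (|C| * F η 1)) ≤
        |C| * F η b + F ζ 1 := by
      intro k
      obtain ⟨J', _, z, hzM, hz1, hz2⟩ := SubEq.iter hM hc hcs hxM hε hx k 1 one_pos
      rw [← hb] at hz1 hz2
      have a1 := Fmono ζ _ _ hz1
      have a2 := Fmono η _ _ hz2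
      rw [Fadd, Fsmul, Fadd, Fsmul, Fsum ζ J' (fun j => star (z j) * z j)] at a1
      rw [Fadd, Fsmul, Fsum] at a2
      have a3 : ∑ j, F ζ (star (z j) * z j) ≤ |C| * ∑ j, F η (z j * star (z j)) := by
        rw [Finset.mul_sum]
        exact Finset.sum_le_sum fun j _ => h' _ (hzM j)
      have a4 := Fnn ζ _ hb0
      have a5 := mul_le_mul_of_nonneg_left a2 (abs_nonneg C)
      linarith
    by_contra hcon
    push Not at hcon
    obtain ⟨k, hk'⟩ := exists_nat_gt ((|C| * F η b + F ζ 1) / (F ζ (c * c) - ε * (|C| * F η 1)))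
    have hp : 0 < F ζ (c * c) - ε * (|C| * F η 1) := by linarith
    rw [div_lt_iff₀ hp] at hk'
    have := hk k
    push_cast at this
    nlinarith
  have hz : F ζ (c * c) ≤ 0 := by
    have h1 : 0 ≤ |C| * F η 1 := mul_nonneg (abs_nonneg C) (Fnn η _ zero_le_one)
    refine le_of_forall_pos_le_add fun ε hε => ?_
    have := hkey (ε / (|C| * F η 1 + 1)) (by positivity)
    refine this.trans ?_
    rw [zero_add, div_mul_eq_mul_div, div_le_iff₀ (by positivity)]
    nlinarith
  have h2 := hf1 c ζ
  rw [hcs] at h2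
  have h3 : ∑ i, ‖c (ζ i)‖ ^ 2 ≤ 0 := h2.le.trans hz
  have h4 : ‖c (ζ i)‖ ^ 2 ≤ 0 := le_trans
    (Finset.single_le_sum (f := fun i => ‖c (ζ i)‖ ^ 2) (fun i _ => by positivity)
      (Finset.mem_univ i)) h3
  have : ‖c (ζ i)‖ = 0 := by nlinarith [norm_nonneg (c (ζ i))]
  simpa using this
end VN7

set_option linter.unusedSectionVars false

section VN8
variable {K : Type*} [NormedAddCommGroup K] [InnerProductSpace ℂ K] [CompleteSpace K]

/-- auxiliary cone -/
def cpCone (A : NonUnitalStarSubalgebra ℂ (K →L[ℂ] K)) : Set (K →L[ℂ] K) :=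
  {h | h ∈ A ∧ ∃ (ι : Type) (_ : Fintype ι) (x : ι → K →L[ℂ] K), (∀ i, x i ∈ A) ∧
    h + star h ≤ (2 : ℝ) • ∑ i, (star (x i) * x i - x i * star (x i))}

lemma real_smul_memA (A : NonUnitalStarSubalgebra ℂ (K →L[ℂ] K)) {x : K →L[ℂ] K} (hx : x ∈ A)
    (r : ℝ) : r • x ∈ A := by
  have : r • x = (r : ℂ) • x := by simp
  rw [this]; exact SMulMemClass.smul_mem _ hx

lemma cpCone_comb (A : NonUnitalStarSubalgebra ℂ (K →L[ℂ] K)) {h k : K →L[ℂ] K}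
    (hh : h ∈ cpCone A) (hk : k ∈ cpCone A) {a b : ℝ} (ha : 0 ≤ a) (hb : 0 ≤ b) :
    a • h + b • k ∈ cpCone A := by
  obtain ⟨hA, I, _, x, hxA, hx⟩ := hh
  obtain ⟨kA, J, _, y, hyA, hy⟩ := hk
  refine ⟨add_mem (real_smul_memA A hA a) (real_smul_memA A kA b), I ⊕ J, inferInstance,
    Sum.elim (fun i => √a • x i) (fun j => √b • y j), ?_, ?_⟩
  · rintro (i | j)
    · exact real_smul_memA A (hxA i) _
    · exact real_smul_memA A (hyA j) _
  · have e : ∀ (r : ℝ), 0 ≤ r → ∀ z : K →L[ℂ] K, star (√r • z) * (√r • z) - (√r • z) * star (√r • z)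
        = r • (star z * z - z * star z) := by
      intro r hr z
      rw [star_smul, smul_mul_smul_comm, smul_mul_smul_comm, smul_sub]
      simp [Real.mul_self_sqrt hr]
    rw [Fintype.sum_sum_type]
    simp only [Sum.elim_inl, Sum.elim_inr, e a ha, e b hb, ← Finset.smul_sum]
    calc _ = a • (h + star h) + b • (k + star k) := by
            simp only [star_add, star_smul, smul_add, star_trivial]; abel
      _ ≤ a • ((2 : ℝ) • ∑ i, (star (x i) * x i - x i * star (x i))) +
          b • ((2 : ℝ) • ∑ i, (star (y i) * y i - y i * star (y i))) :=
        add_le_add (smul_le_smul_of_nonneg_left hx ha) (smul_le_smul_of_nonneg_left hy hb)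
      _ = _ := by
        rw [smul_add, smul_comm a, smul_comm b]

lemma cpCone_of_neg (A : NonUnitalStarSubalgebra ℂ (K →L[ℂ] K)) {h : K →L[ℂ] K} (hA : h ∈ A)
    (hh : h + star h ≤ 0) : h ∈ cpCone A :=
  ⟨hA, Fin 0, inferInstance, fun _ => 0, fun _ => zero_mem A, by simpa using hh⟩

lemma cpCone_of_comm (A : NonUnitalStarSubalgebra ℂ (K →L[ℂ] K)) {x : K →L[ℂ] K} (hA : x ∈ A) :
    star x * x - x * star x ∈ cpCone A := by
  refine ⟨sub_mem (mul_mem (star_mem hA) hA) (mul_mem hA (star_mem hA)), Fin 1, inferInstance,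
    fun _ => x, fun _ => hA, ?_⟩
  simp [two_smul]

lemma hb_cp (A : NonUnitalStarSubalgebra ℂ (K →L[ℂ] K))
    (hA : ∀ τ : A → ℂ, IsBoundedTrace A τ → τ = 0) {c : K →L[ℂ] K} (hcA : c ∈ A)
    (hcs : star c = c) {ε : ℝ} (hε : 0 < ε) :
    ∃ (ι : Type) (_ : Fintype ι) (x : ι → K →L[ℂ] K), (∀ i, x i ∈ A) ∧
      c * c ≤ ∑ i, (star (x i) * x i - x i * star (x i)) + ε • (1 : K →L[ℂ] K) := by
  have hconv : Convex ℝ (cpCone A) := by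
    intro x hx y hy a b ha hb _
    exact cpCone_comb A hx hy ha hb
  have hccA : c * c ∈ A := mul_mem hcA hcA
  have hcl : c * c ∈ closure (cpCone A) := by
    by_contra hcon
    obtain ⟨f, u, hf1, hf2⟩ := geometric_hahn_banach_closed_point hconv.closure isClosed_closure hcon
    have h0 : (0 : K →L[ℂ] K) ∈ cpCone A := cpCone_of_neg A (zero_mem A) (by simp)
    have hu : 0 < u := by simpa using hf1 0 (subset_closure h0)
    have hneg : ∀ h ∈ cpCone A, f h ≤ 0 := by
      intro h hh
      by_contra hp
      push Not at hp
      have h1 : (u / f h) • h + (0 : ℝ) • (0 : K →L[ℂ] K) ∈ cpCone A :=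
        cpCone_comb A hh h0 (by positivity) le_rfl
      have h2 := hf1 _ (subset_closure h1)
      rw [smul_zero, add_zero, map_smul, smul_eq_mul, div_mul_cancel₀ _ hp.ne'] at h2
      exact lt_irrefl _ h2
    have hskew : ∀ h ∈ A, star h = -h → f h = 0 := by
      intro h hh hs
      have h1 := hneg h (cpCone_of_neg A hh (by rw [hs]; simp))
      have h2 := hneg (-h) (cpCone_of_neg A (neg_mem hh) (by rw [star_neg, hs]; simp))
      rw [map_neg] at h2
      linarith
    have htr : ∀ x ∈ A, f (star x * x) = f (x * star x) := by
      intro x hx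
      have h1 := hneg _ (cpCone_of_comm A hx)
      have h2 := hneg _ (cpCone_of_comm A (star_mem hx))
      rw [star_star, map_sub] at h2
      rw [map_sub] at h1
      linarith
    have hpos : ∀ x ∈ A, 0 ≤ f (star x * x) := by
      intro x hx
      have h1 := hneg (-(star x * x)) (cpCone_of_neg A (neg_mem (mul_mem (star_mem hx) hx)) (by
        have := star_mul_self_nonneg x
        rw [star_neg, star_mul, star_star, ← neg_add, neg_nonpos]
        exact add_nonneg this this))
      rw [map_neg] at h1
      linarith
    have him : ∀ x ∈ A, f (Complex.I • (star x * x)) = 0 := by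
      intro x hx
      refine hskew _ (SMulMemClass.smul_mem _ (mul_mem (star_mem hx) hx)) ?_
      rw [star_smul]; simp
    set τ : A → ℂ := fun x => (f x : ℂ) - Complex.I * (f (Complex.I • (x : K →L[ℂ] K)) : ℂ) with hτ
    have hval : ∀ x : A, τ (star x * x) = (f (star (x : K →L[ℂ] K) * x) : ℂ) := by
      intro x
      simp only [hτ, NonUnitalStarSubalgebra.coe_mul, StarMemClass.coe_star]
      rw [him _ x.2]; simp
    have ht : IsBoundedTrace A τ := by
      refine ⟨?_, ?_, ?_, ?_, ?_⟩
      · intro x y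
        simp only [hτ, NonUnitalStarSubalgebra.coe_add, smul_add, map_add]
        push_cast; ring
      · intro z x
        have key : ∀ (w : ℂ) (y : K →L[ℂ] K), f (w • y) = w.re * f y + w.im * f (Complex.I • y) := by
          intro w y
          have : w • y = w.re • y + w.im • (Complex.I • y) := by
            conv_lhs => rw [← Complex.re_add_im w]
            rw [add_smul, mul_smul]
            simp
          rw [this, map_add, map_smul, map_smul]; rfl
        simp only [hτ, NonUnitalStarSubalgebra.coe_smul]
        rw [key z, smul_smul, key (Complex.I * z)]
        apply Complex.ext <;> simp <;> ring
      · intro x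
        have := hval (star x)
        rw [star_star] at this
        rw [hval, this]
        simp only [StarMemClass.coe_star, star_star]
        rw [htr _ x.2]
      · intro x
        rw [hval]
        exact_mod_cast hpos _ x.2
      · refine ⟨2 * ‖f‖, fun x => ?_⟩
        simp only [hτ]
        refine (norm_sub_le _ _).trans ?_
        rw [norm_mul, Complex.norm_I, one_mul, Complex.norm_real, Complex.norm_real]
        have h1 := f.le_opNorm (x : K →L[ℂ] K)
        have h2 := f.le_opNorm (Complex.I • (x : K →L[ℂ] K))
        rw [norm_smul, Complex.norm_I, one_mul] at h2
        linarith
    have hz := congrFun (hA τ ht) (star ⟨c, hcA⟩ * ⟨c, hcA⟩)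
    rw [hval] at hz
    simp only [hcs, Pi.zero_apply, Complex.ofReal_eq_zero] at hz
    linarith
  obtain ⟨h, ⟨hhA, I, _, x, hxA, hx⟩, hd⟩ := Metric.mem_closure_iff.1 hcl ε hε
  refine ⟨I, inferInstance, x, hxA, ?_⟩
  set d := c * c - h with hd'
  have hdn : ‖d + star d‖ ≤ 2 * ε := by
    rw [dist_eq_norm] at hd
    calc _ ≤ ‖d‖ + ‖star d‖ := norm_add_le _ _
      _ = 2 * ‖d‖ := by rw [norm_star]; ring
      _ ≤ _ := by linarith
  have hle : d + star d ≤ (2 * ε) • (1 : K →L[ℂ] K) := by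
    have h1 : IsSelfAdjoint (d + star d) := IsSelfAdjoint.add_star_self d
    have h2 := h1.le_algebraMap_norm_self
    rw [Algebra.algebraMap_eq_smul_one] at h2
    exact h2.trans (smul_le_smul_of_nonneg_right hdn zero_le_one)
  have hsum : (2 : ℝ) • (c * c) = (h + star h) + (d + star d) := by
    rw [hd', star_sub, star_mul, hcs, two_smul]; abel
  have h5 : (2 : ℝ) • (c * c) ≤ (2 : ℝ) • (∑ i, (star (x i) * x i - x i * star (x i)) +
      ε • (1 : K →L[ℂ] K)) := by
    rw [hsum, smul_add, smul_smul]
    exact add_le_add hx hle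
  have h6 := smul_le_smul_of_nonneg_left h5 (by norm_num : (0 : ℝ) ≤ 1 / 2)
  rw [smul_smul, smul_smul] at h6
  norm_num at h6
  rwa [Finset.sum_sub_distrib]
end VN8

set_option linter.unusedSectionVars false

section VN9
variable {X : Type*} [NormedAddCommGroup X] [InnerProductSpace ℂ X] [CompleteSpace X]
variable {K : Type*} [NormedAddCommGroup K] [InnerProductSpace ℂ K] [CompleteSpace K]

local notation "⟪" x "," y "⟫" => inner ℂ x y

/-- support projection of a represented algebra -/
noncomputable def suppP (D : NonUnitalStarSubalgebra ℂ (X →L[ℂ] X))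
    (ρ : (X →L[ℂ] X) →⋆ₐ[ℂ] (K →L[ℂ] K)) : K →L[ℂ] K :=
  cproj (Submodule.span ℂ {v : K | ∃ a ∈ D, ∃ u : K, v = ρ a u})

/-- the bicommutant of a represented algebra -/
noncomputable def bic (D : NonUnitalStarSubalgebra ℂ (X →L[ℂ] X))
    (ρ : (X →L[ℂ] X) →⋆ₐ[ℂ] (K →L[ℂ] K)) : StarSubalgebra ℂ (K →L[ℂ] K) :=
  StarSubalgebra.centralizer ℂ (StarSubalgebra.centralizer ℂ (Set.image ρ (D : Set (X →L[ℂ] X))) :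
    Set (K →L[ℂ] K))

variable (D : NonUnitalStarSubalgebra ℂ (X →L[ℂ] X)) (ρ : (X →L[ℂ] X) →⋆ₐ[ℂ] (K →L[ℂ] K))

lemma bic_comm {y m : K →L[ℂ] K} (hy : y ∈ bic D ρ) (hm : ∀ a ∈ D, ρ a * m = m * ρ a) :
    m * y = y * m := by
  have := (StarSubalgebra.mem_centralizer_iff ℂ).1 hy m ?_
  · exact this.1
  · rw [SetLike.mem_coe, StarSubalgebra.mem_centralizer_iff]
    rintro _ ⟨a, ha, rfl⟩
    refine ⟨hm a ha, ?_⟩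
    rw [← map_star]
    exact hm _ (star_mem ha)

lemma mem_bic {y : K →L[ℂ] K}
    (h : ∀ m : K →L[ℂ] K, (∀ a ∈ D, ρ a * m = m * ρ a) → m * y = y * m) : y ∈ bic D ρ := by
  rw [bic, StarSubalgebra.mem_centralizer_iff]
  intro g hg
  have hgs := star_mem (S := StarSubalgebra ℂ (K →L[ℂ] K)) hg
  rw [SetLike.mem_coe, StarSubalgebra.mem_centralizer_iff] at hg
  rw [StarSubalgebra.mem_centralizer_iff] at hgs
  exact ⟨h _ fun a ha => (hg _ ⟨a, ha, rfl⟩).1, h _ fun a ha => (hgs _ ⟨a, ha, rfl⟩).1⟩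

lemma bic_of_mem {a : X →L[ℂ] X} (ha : a ∈ D) : ρ a ∈ bic D ρ :=
  mem_bic D ρ fun _ hm => (hm a ha).symm

lemma bic_isVN : IsVN (bic D ρ) := by
  intro x hx
  refine mem_bic D ρ fun m hm => hx m fun y hy => (bic_comm D ρ hy hm).symm

lemma supp_comm {a : X →L[ℂ] X} (ha : a ∈ D) : ρ a * suppP D ρ = suppP D ρ * ρ a := by
  have key : ∀ b ∈ D, ∀ v ∈ Submodule.span ℂ {v : K | ∃ a ∈ D, ∃ u : K, v = ρ a u},
      ρ b v ∈ Submodule.span ℂ {v : K | ∃ a ∈ D, ∃ u : K, v = ρ a u} := by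
    intro b hb v _
    exact Submodule.subset_span ⟨b, hb, v, rfl⟩
  refine cproj_comm _ _ (key a ha) ?_
  rw [← map_star]
  exact key _ (star_mem ha)

lemma supp_mul {a : X →L[ℂ] X} (ha : a ∈ D) : suppP D ρ * ρ a = ρ a :=
  cproj_mul_of_range fun v => Submodule.subset_span ⟨a, ha, v, rfl⟩

lemma mul_supp {a : X →L[ℂ] X} (ha : a ∈ D) : ρ a * suppP D ρ = ρ a := by
  rw [supp_comm D ρ ha, supp_mul D ρ ha]

lemma supp_apply_zero {w : K} (hw : ∀ a ∈ D, ρ a w = 0) : suppP D ρ w = 0 := by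
  refine cproj_apply_zero fun v hv => ?_
  induction hv using Submodule.span_induction with
  | mem x h =>
    obtain ⟨a, ha, u, rfl⟩ := h
    rw [← inner_star_right, ← map_star, hw _ (star_mem ha), inner_zero_right]
  | zero => simp
  | add x y _ _ h1 h2 => rw [inner_add_left, h1, h2, add_zero]
  | smul c x _ h1 => rw [inner_smul_left, h1, mul_zero]

lemma supp_bic_comm {y : K →L[ℂ] K} (hy : y ∈ bic D ρ) : suppP D ρ * y = y * suppP D ρ :=
  bic_comm D ρ hy fun _ ha => supp_comm D ρ ha

lemma supp_mem : suppP D ρ ∈ bic D ρ := by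
  refine mem_bic D ρ fun m hm => ?_
  have key : ∀ m : K →L[ℂ] K, (∀ a ∈ D, ρ a * m = m * ρ a) →
      ∀ v ∈ Submodule.span ℂ {v : K | ∃ a ∈ D, ∃ u : K, v = ρ a u},
      m v ∈ Submodule.span ℂ {v : K | ∃ a ∈ D, ∃ u : K, v = ρ a u} := by
    intro m hm v hv
    induction hv using Submodule.span_induction with
    | mem x h =>
      obtain ⟨a, ha, u, rfl⟩ := h
      rw [← mulA, ← hm a ha]
      exact Submodule.subset_span ⟨a, ha, m u, rfl⟩
    | zero => simp
    | add x y _ _ h1 h2 => rw [map_add]; exact add_mem h1 h2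
    | smul c x _ h1 => rw [map_smul]; exact Submodule.smul_mem _ _ h1
  refine cproj_comm _ _ (key m hm) (key _ ?_)
  intro a ha
  have := congrArg star (hm _ (star_mem ha))
  rw [star_mul, star_mul, ← map_star, star_star] at this
  exact this.symm

lemma supp_star : star (suppP D ρ) = suppP D ρ := cproj_star _
lemma supp_idem : suppP D ρ * suppP D ρ = suppP D ρ := cproj_mul_self _

section amp
variable {ι : Type*} [Fintype ι] [DecidableEq ι]

/-- coordinate inclusion -/
noncomputable def sg (i : ι) : K →L[ℂ] PiLp 2 (fun _ : ι => K) :=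
  ((PiLp.continuousLinearEquiv 2 ℂ (fun _ : ι => K)).symm :
    (∀ _ : ι, K) →L[ℂ] PiLp 2 fun _ : ι => K).comp (ContinuousLinearMap.single ℂ (fun _ : ι => K) i)

lemma sg_apply (i j : ι) (u : K) : sg i u j = if j = i then u else 0 := by
  by_cases h : j = i
  · subst h; simp [sg]
  · simp [sg, h]

lemma sum_sg (v : PiLp 2 (fun _ : ι => K)) : ∑ i, sg i (v i) = v := by
  ext j
  simp [sg_apply]

/-- diagonal amplification -/
noncomputable def dgo (a : K →L[ℂ] K) : PiLp 2 (fun _ : ι => K) →L[ℂ] PiLp 2 (fun _ : ι => K) :=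
  ∑ i, (sg i).comp (a.comp (PiLp.proj 2 (fun _ : ι => K) i))

lemma dgo_apply (a : K →L[ℂ] K) (v : PiLp 2 (fun _ : ι => K)) (i : ι) : dgo a v i = a (v i) := by
  simp [dgo, sum_apply, sg_apply]

lemma dgo_star (a : K →L[ℂ] K) : star (dgo (ι := ι) a) = dgo (star a) := by
  refine ContinuousLinearMap.ext fun v => ?_
  refine ext_inner_left ℂ fun w => ?_
  rw [inner_star_right, PiLp.inner_apply, PiLp.inner_apply]
  refine Finset.sum_congr rfl fun i _ => ?_
  rw [dgo_apply, dgo_apply, inner_star_right]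

lemma dgo_comm {y : K →L[ℂ] K} {p : PiLp 2 (fun _ : ι => K) →L[ℂ] PiLp 2 (fun _ : ι => K)}
    (hy : y ∈ bic D ρ) (hp : ∀ a ∈ D, dgo (ρ a) * p = p * dgo (ρ a)) : dgo y * p = p * dgo y := by
  have hsg : ∀ (a : K →L[ℂ] K) (i : ι) u, dgo a (sg i u) = sg i (a u) := by
    intro a i u
    ext j
    rw [dgo_apply, sg_apply, sg_apply]
    split_ifs <;> simp
  set q : ι → ι → K →L[ℂ] K := fun i j => (PiLp.proj 2 (fun _ : ι => K) i).comp (p.comp (sg j))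
    with hq
  have hqa : ∀ i j u, q i j u = p (sg j u) i := fun i j u => rfl
  have h1 : ∀ i j, q i j * y = y * q i j := by
    intro i j
    refine bic_comm D ρ hy fun a ha => ?_
    ext u
    rw [mulA, mulA, hqa, hqa, ← hsg, ← mulA p, ← hp a ha, mulA, dgo_apply]
  ext v
  conv_lhs => rw [← sum_sg v]
  conv_rhs => rw [← sum_sg v]
  rw [map_sum, map_sum]
  rename_i i
  simp only [WithLp.ofLp_sum, Finset.sum_apply]
  refine Finset.sum_congr rfl fun j _ => ?_
  rw [mulA, mulA, dgo_apply, ← hqa, hsg, ← hqa, ← mulA, ← mulA, h1]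
end amp

lemma weak_dense {x : K →L[ℂ] K} (hx : x ∈ bic D ρ) (hxe : x * suppP D ρ = x)
    {ι : Type*} [Fintype ι] (ζ η : ι → K) (h : ∀ a ∈ D, ∑ i, ⟪η i, ρ a (ζ i)⟫ = 0) :
    ∑ i, ⟪η i, x (ζ i)⟫ = 0 := by
  classical
  set Z : PiLp 2 (fun _ : ι => K) := WithLp.toLp 2 ζ with hZ
  set Y : PiLp 2 (fun _ : ι => K) := WithLp.toLp 2 η with hY
  let T : D →ₗ[ℂ] PiLp 2 (fun _ : ι => K) :=
    { toFun := fun a => dgo (ρ a) Z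
      map_add' := fun a b => by ext i; simp [dgo_apply]
      map_smul' := fun c a => by ext i; simp [dgo_apply] }
  set W := LinearMap.range T with hW
  have hinv : ∀ a ∈ D, ∀ v ∈ W, dgo (ρ a) v ∈ W := by
    rintro a ha _ ⟨b, rfl⟩
    refine ⟨⟨a, ha⟩ * b, ?_⟩
    ext i
    simp [T, dgo_apply]
  have hcomm : ∀ a ∈ D, dgo (ρ a) * cproj W = cproj W * dgo (ρ a) := by
    intro a ha
    refine cproj_comm W _ (hinv a ha) ?_
    rw [dgo_star, ← map_star]
    exact hinv _ (star_mem ha)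
  have hcx := dgo_comm D ρ hx hcomm
  have hw : ∀ i, x ((Z - cproj W Z) i) = 0 := by
    intro i
    rw [← hxe, mulA, supp_apply_zero, map_zero]
    intro a ha
    rw [← dgo_apply, map_sub, ← mulA, hcomm a ha, mulA, cproj_apply_mem (V := W) (v := dgo (ρ a) Z) ⟨⟨a, ha⟩, rfl⟩]
    simp
  have h2 : dgo x Z = cproj W (dgo x Z) := by
    rw [← mulA, ← hcx, mulA]
    ext i
    have := hw i
    rw [dgo_apply, dgo_apply]
    simp only [PiLp.sub_apply, map_sub] at this
    exact sub_eq_zero.1 this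
  have h3 : cproj W Y = 0 := by
    refine cproj_apply_zero ?_
    rintro _ ⟨a, rfl⟩
    have := h a a.2
    rw [← inner_conj_symm, PiLp.inner_apply]
    simp only [T, LinearMap.coe_mk, AddHom.coe_mk, dgo_apply]
    rw [this, map_zero]
  have h4 : ⟪Y, dgo x Z⟫ = 0 := by
    rw [h2]
    have := inner_star_left (cproj W) Y (dgo x Z)
    rw [← this, cproj_star, h3, inner_zero_left]
  rw [PiLp.inner_apply] at h4
  simpa [dgo_apply] using h4
end VN9

set_option linter.unusedSectionVars false

section VN10
variable {X : Type*} [NormedAddCommGroup X] [InnerProductSpace ℂ X] [CompleteSpace X]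
variable {K : Type*} [NormedAddCommGroup K] [InnerProductSpace ℂ K] [CompleteSpace K]

local notation "⟪" x "," y "⟫" => inner ℂ x y

lemma real_dual_rep (f : StrongDual ℝ K) : ∃ p : K, ∀ u, f u = (⟪p, u⟫).re := by
  refine ⟨(InnerProductSpace.toDual ℂ K).symm (StrongDual.extendRCLike (𝕜 := ℂ) f), fun u => ?_⟩
  rw [InnerProductSpace.toDual_symm_apply]
  exact (StrongDual.re_extendRCLike_apply (𝕜 := ℂ) f u).symm

lemma real_dual_rep_pi {ι : Type*} [Fintype ι] (f : StrongDual ℝ ((ι → K) × (ι → K))) :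
    ∃ p q : ι → K, ∀ u v, f (u, v) = ∑ i, ((⟪p i, u i⟫).re + (⟪q i, v i⟫).re) := by
  classical
  have h1 : ∀ i, ∃ p : K, ∀ u, f (Pi.single i u, 0) = (⟪p, u⟫).re := fun i => by
    obtain ⟨p, hp⟩ := real_dual_rep (f.comp ((ContinuousLinearMap.inl ℝ (ι → K) (ι → K)).comp
      (ContinuousLinearMap.single ℝ (fun _ : ι => K) i)))
    exact ⟨p, fun u => by rw [← hp]; simp⟩
  have h2 : ∀ i, ∃ p : K, ∀ u, f (0, Pi.single i u) = (⟪p, u⟫).re := fun i => by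
    obtain ⟨p, hp⟩ := real_dual_rep (f.comp ((ContinuousLinearMap.inr ℝ (ι → K) (ι → K)).comp
      (ContinuousLinearMap.single ℝ (fun _ : ι => K) i)))
    exact ⟨p, fun u => by rw [← hp]; simp⟩
  choose p hp using h1
  choose q hq using h2
  refine ⟨p, q, fun u v => ?_⟩
  have : (u, v) = ∑ i, ((Pi.single i (u i), 0) + (0, Pi.single i (v i)) : (ι → K) × (ι → K)) := by
    rw [Finset.sum_add_distrib]
    refine Prod.ext ?_ ?_
    · simp [Prod.fst_sum, Finset.univ_sum_single]
    · simp [Prod.snd_sum, Finset.univ_sum_single]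
  rw [this, map_sum]
  refine Finset.sum_congr rfl fun i _ => ?_
  rw [map_add, hp, hq]

variable (D : NonUnitalStarSubalgebra ℂ (X →L[ℂ] X)) (ρ : (X →L[ℂ] X) →⋆ₐ[ℂ] (K →L[ℂ] K))

lemma strong_star_dense {x : K →L[ℂ] K} (hx : x ∈ bic D ρ) (hxe : x * suppP D ρ = x)
    {ι : Type*} [Fintype ι] (ζ η : ι → K) {ε : ℝ} (hε : 0 < ε) :
    ∃ a ∈ D, (∀ i, ‖ρ a (ζ i) - x (ζ i)‖ < ε) ∧ ∀ i, ‖star (ρ a) (η i) - star x (η i)‖ < ε := by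
  set S : Set ((ι → K) × (ι → K)) := {w | ∃ a ∈ D, w = (fun i => ρ a (ζ i), fun i => star (ρ a) (η i))}
    with hS
  have hconv : Convex ℝ S := by
    rintro _ ⟨a, ha, rfl⟩ _ ⟨b, hb, rfl⟩ s t _ _ _
    refine ⟨s • a + t • b, add_mem (real_smul_memA D ha s) (real_smul_memA D hb t), ?_⟩
    have e : ∀ (r : ℝ) (y : X →L[ℂ] X), ρ (r • y) = r • ρ y := by
      intro r y
      have : r • y = (r : ℂ) • y := by simp
      rw [this, map_smul]; simp
    rw [map_add, e, e]
    refine Prod.ext ?_ ?_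
    · ext i; simp
    · ext i; simp
  have hmem : ((fun i => x (ζ i), fun i => star x (η i)) : (ι → K) × (ι → K)) ∈ closure S := by
    by_contra hcon
    obtain ⟨f, u, hf1, hf2⟩ := geometric_hahn_banach_closed_point hconv.closure isClosed_closure hcon
    obtain ⟨p, q, hpq⟩ := real_dual_rep_pi f
    have hval : ∀ y : K →L[ℂ] K, f (fun i => y (ζ i), fun i => star y (η i)) =
        (∑ j : ι ⊕ ι, ⟪Sum.elim p η j, y (Sum.elim ζ q j)⟫).re := by
      intro y
      rw [hpq, Fintype.sum_sum_type, Complex.add_re, Complex.re_sum, Complex.re_sum,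
        ← Finset.sum_add_distrib]
      refine Finset.sum_congr rfl fun i _ => ?_
      simp only [Sum.elim_inl, Sum.elim_inr]
      rw [inner_star_right, ← inner_conj_symm (η i), Complex.conj_re]
    have hu : 0 < u := by
      have := hf1 0 (subset_closure ⟨0, zero_mem D, by simp; rfl⟩)
      simpa using this
    have hre : ∀ a ∈ D, (∑ j : ι ⊕ ι, ⟪Sum.elim p η j, ρ a (Sum.elim ζ q j)⟫).re ≤ 0 := by
      intro a ha
      by_contra hp
      push Not at hp
      set R := (∑ j : ι ⊕ ι, ⟪Sum.elim p η j, ρ a (Sum.elim ζ q j)⟫).re with hR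
      have h1 := hf1 _ (subset_closure ⟨((u / R : ℝ) : ℂ) • a, SMulMemClass.smul_mem _ ha, rfl⟩)
      rw [hval, map_smul] at h1
      simp only [smul_apply, inner_smul_right, ← Finset.mul_sum,
        Complex.re_ofReal_mul] at h1
      rw [← hR, div_mul_cancel₀ _ hp.ne'] at h1
      exact lt_irrefl _ h1
    have hz : ∀ a ∈ D, ∑ j : ι ⊕ ι, ⟪Sum.elim p η j, ρ a (Sum.elim ζ q j)⟫ = 0 := by
      intro a ha
      have k : ∀ c : ℂ, (c * ∑ j : ι ⊕ ι, ⟪Sum.elim p η j, ρ a (Sum.elim ζ q j)⟫).re ≤ 0 := by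
        intro c
        have := hre (c • a) (SMulMemClass.smul_mem _ ha)
        rw [map_smul] at this
        simpa only [smul_apply, inner_smul_right, ← Finset.mul_sum] using this
      set T := ∑ j : ι ⊕ ι, ⟪Sum.elim p η j, ρ a (Sum.elim ζ q j)⟫ with hT
      have k1 := k 1
      have k2 := k (-1)
      have k3 := k Complex.I
      have k4 := k (-Complex.I)
      simp at k1 k2 k3 k4
      exact Complex.ext (le_antisymm k1 k2) (le_antisymm k4 k3)
    have h3 := weak_dense D ρ hx hxe _ _ hz
    rw [hval, h3] at hf2
    simp at hf2
    linarith
  obtain ⟨_, ⟨a, ha, rfl⟩, hd⟩ := Metric.mem_closure_iff.1 hmem ε hε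
  rw [Prod.dist_eq, max_lt_iff, dist_pi_lt_iff hε, dist_pi_lt_iff hε] at hd
  refine ⟨a, ha, fun i => ?_, fun i => ?_⟩
  · have := hd.1 i
    rwa [dist_comm, dist_eq_norm] at this
  · have := hd.2 i
    rwa [dist_comm, dist_eq_norm] at this

/-- `(1 + a* a)⁻¹` -/
noncomputable def resv (a : K →L[ℂ] K) : K →L[ℂ] K := cfc (fun t : ℝ => (1 + t)⁻¹) (star a * a)

lemma resv_props (a : K →L[ℂ] K) : resv a * (1 + star a * a) = 1 ∧ (1 + star a * a) * resv a = 1 ∧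
    ‖resv a‖ ≤ 1 ∧ ‖(2 : ℂ) • (a * resv a)‖ ≤ 1 := by
  set t := star a * a with ht
  have ht0 : 0 ≤ t := star_mul_self_nonneg a
  have hsa : IsSelfAdjoint t := .of_nonneg ht0
  have hsp : ∀ x ∈ spectrum ℝ t, 0 ≤ x := fun x hx => spectrum_nonneg_of_nonneg ht0 hx
  have hcont : ContinuousOn (fun x : ℝ => (1 + x)⁻¹) (spectrum ℝ t) := by
    refine ContinuousOn.inv₀ (by fun_prop) ?_
    intro x hx
    have := hsp x hx
    positivity
  have e1 : 1 + t = cfc (fun x : ℝ => 1 + x) t := by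
    rw [cfc_add (R := ℝ) (a := t) (fun _ => (1 : ℝ)) (fun x => x) (by fun_prop) (by fun_prop),
      cfc_const_one ℝ t, cfc_id' ℝ t]
  have h1 : resv a * (1 + t) = 1 := by
    rw [e1, resv, ← ht, ← cfc_mul _ _ t hcont (by fun_prop), ← cfc_one ℝ t]
    refine cfc_congr fun x hx => ?_
    have := hsp x hx
    simp only [Pi.one_apply]
    exact inv_mul_cancel₀ (by positivity)
  have h2 : (1 + t) * resv a = 1 := by
    rw [e1, resv, ← ht, ← cfc_mul _ _ t (by fun_prop) hcont, ← cfc_one ℝ t]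
    refine cfc_congr fun x hx => ?_
    have := hsp x hx
    simp only [Pi.one_apply]
    exact mul_inv_cancel₀ (by positivity)
  have h3 : ‖resv a‖ ≤ 1 := by
    refine norm_cfc_le zero_le_one fun x hx => ?_
    have := hsp x hx
    rw [Real.norm_of_nonneg (by positivity)]
    exact inv_le_one_of_one_le₀ (by linarith)
  refine ⟨h1, h2, h3, ?_⟩
  have hrs : star (resv a) = resv a := cfc_predicate (R := ℝ) _ t
  have h4 : ‖star (a * resv a) * (a * resv a)‖ ≤ 1 / 4 := by
    have : star (a * resv a) * (a * resv a) = cfc (fun x : ℝ => (1 + x)⁻¹ * x * (1 + x)⁻¹) t := by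
      rw [cfc_mul (fun x : ℝ => (1 + x)⁻¹ * x) _ t (hcont.mul (by fun_prop)) hcont,
        cfc_mul _ (fun x => x) t hcont (by fun_prop), cfc_id' ℝ t, star_mul, hrs, resv, ← ht, ht]
      simp only [mul_assoc]
    rw [this]
    refine norm_cfc_le (by norm_num) fun x hx => ?_
    have := hsp x hx
    rw [Real.norm_of_nonneg (by positivity)]
    have h5 : 0 < 1 + x := by linarith
    have h6 : (1 + x)⁻¹ * x * (1 + x)⁻¹ = x / (1 + x) ^ 2 := by field_simp
    rw [h6, div_le_div_iff₀ (by positivity) (by norm_num)]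
    nlinarith [sq_nonneg (x - 1)]
  rw [CStarRing.norm_star_mul_self] at h4
  rw [norm_smul]
  norm_num
  nlinarith [norm_nonneg (a * resv a)]
end VN10

set_option linter.unusedSectionVars false

section VN11
variable {X : Type*} [NormedAddCommGroup X] [InnerProductSpace ℂ X] [CompleteSpace X]
variable {K : Type*} [NormedAddCommGroup K] [InnerProductSpace ℂ K] [CompleteSpace K]

local notation "⟪" x "," y "⟫" => inner ℂ x y

lemma mul_resv_mem {D : NonUnitalStarSubalgebra ℂ (K →L[ℂ] K)} (hD : IsClosed (D : Set (K →L[ℂ] K)))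
    {a : K →L[ℂ] K} (ha : a ∈ D) : (2 : ℂ) • (a * resv a) ∈ D := by
  refine SMulMemClass.smul_mem _ ?_
  have htD : star a * a ∈ D := mul_mem (star_mem ha) ha
  set t := star a * a with ht
  have ht0 : 0 ≤ t := star_mul_self_nonneg a
  have hsa : IsSelfAdjoint t := .of_nonneg ht0
  have hsp : ∀ x ∈ spectrum ℝ t, 0 ≤ x := fun x hx => spectrum_nonneg_of_nonneg ht0 hx
  have hcont : ContinuousOn (fun x : ℝ => (1 + x)⁻¹) (spectrum ℝ t) := by
    refine ContinuousOn.inv₀ (by fun_prop) ?_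
    intro x hx
    have := hsp x hx
    positivity
  have hc : cfcₙ (fun x : ℝ => x * (1 + x)⁻¹) t ∈ D :=
    cfcₙ_mem (𝕜' := ℂ) (hs := hD) _ htD
  have hcont2 : ContinuousOn (fun x : ℝ => x * (1 + x)⁻¹) (quasispectrum ℝ t) := by
    have hq : ∀ x ∈ quasispectrum ℝ t, 0 ≤ x := fun x hx => quasispectrum_nonneg_of_nonneg t ht0 x hx
    refine ContinuousOn.mul (by fun_prop) (ContinuousOn.inv₀ (by fun_prop) ?_)
    intro x hx
    have := hq x hx
    positivity
  rw [cfcₙ_eq_cfc hcont2 (by simp)] at hc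
  have he : cfc (fun x : ℝ => x * (1 + x)⁻¹) t = 1 - resv a := by
    rw [cfc_mul (fun x : ℝ => x) _ t (by fun_prop) hcont, cfc_id' ℝ t]
    have := (resv_props a).2.1
    rw [add_mul, one_mul] at this
    rw [← this, add_sub_cancel_left]; rfl
  have : a * resv a = a - a * cfc (fun x : ℝ => x * (1 + x)⁻¹) t := by
    rw [he, mul_sub, mul_one, sub_sub_cancel]
  rw [this]
  exact sub_mem ha (mul_mem ha hc)

lemma map_resv (ρ : (X →L[ℂ] X) →⋆ₐ[ℂ] (K →L[ℂ] K)) (a : X →L[ℂ] X) : ρ (resv a) = resv (ρ a) := by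
  have h1 := congrArg ρ (resv_props a).1
  have h2 := (resv_props (ρ a)).2.1
  rw [map_mul, map_add, map_mul, map_star, map_one] at h1
  exact left_inv_eq_right_inv h1 h2

lemma mul_resv_sub (a b : K →L[ℂ] K) : a * resv a - b * resv b =
    resv (star a) * ((a - b) + a * (star b - star a) * b) * resv b := by
  have ha := (resv_props a)
  have hb := (resv_props b)
  have hs := (resv_props (star a))
  rw [star_star] at hs
  have h1 : resv (star a) * a = a * resv a := by
    have : (1 + a * star a) * (a * resv a) = a := by
      calc _ = a * ((1 + star a * a) * resv a) := by noncomm_ring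
        _ = a := by rw [ha.2.1, mul_one]
    calc _ = resv (star a) * ((1 + a * star a) * (a * resv a)) := by rw [this]
      _ = (resv (star a) * (1 + a * star a)) * (a * resv a) := by rw [mul_assoc]
      _ = _ := by rw [hs.1, one_mul]
  have h2 : (a - b) + a * (star b - star a) * b = a * (1 + star b * b) - (1 + a * star a) * b := by
    noncomm_ring
  rw [h2, mul_sub, sub_mul, ← mul_assoc, ← mul_assoc, hs.1, one_mul, mul_assoc _ _ (resv b), hb.2.1,
    mul_one, h1]

variable (D : NonUnitalStarSubalgebra ℂ (X →L[ℂ] X)) (ρ : (X →L[ℂ] X) →⋆ₐ[ℂ] (K →L[ℂ] K))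

lemma exists_preim {y : K →L[ℂ] K} (hy : y ∈ bic D ρ) (hye : y * suppP D ρ = y) (hy1 : ‖y‖ ≤ 1) :
    ∃ x ∈ bic D ρ, x * suppP D ρ = x ∧ y = (2 : ℂ) • (x * resv x) := by
  have hM := bic_isVN D ρ
  set t := star y * y with ht
  have htM : t ∈ bic D ρ := mul_mem (star_mem hy) hy
  have ht0 : 0 ≤ t := star_mul_self_nonneg y
  have hsa : IsSelfAdjoint t := .of_nonneg ht0
  have ht1 : t ≤ 1 := by
    rw [← CStarAlgebra.norm_le_one_iff_of_nonneg _ ht0, ht, CStarRing.norm_star_mul_self]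
    nlinarith [norm_nonneg y]
  have hsp : ∀ x ∈ spectrum ℝ t, x ≤ 1 := by
    refine (le_algebraMap_iff_spectrum_le (a := t) (r := (1 : ℝ))).1 ?_
    simpa using ht1
  set q := cfc (fun x : ℝ => √(1 - x)) t with hq
  set s := cfc (fun x : ℝ => (1 + √(1 - x))⁻¹) t with hs
  have hcs : ContinuousOn (fun x : ℝ => (1 + √(1 - x))⁻¹) (spectrum ℝ t) := by
    refine ContinuousOn.inv₀ (by fun_prop) ?_
    intro x hx
    positivity
  have hsM : s ∈ bic D ρ := cfc_mem_vn hM htM _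
  have hss : star s = s := cfc_predicate (R := ℝ) _ t
  have h1 : star (y * s) * (y * s) + 1 = (2 : ℝ) • s := by
    have e1 : star (y * s) * (y * s) = cfc (fun x : ℝ => (1 + √(1 - x))⁻¹ * x * (1 + √(1 - x))⁻¹) t := by
      rw [cfc_mul (fun x : ℝ => (1 + √(1 - x))⁻¹ * x) _ t (hcs.mul (by fun_prop)) hcs,
        cfc_mul _ (fun x => x) t hcs (by fun_prop), cfc_id' ℝ t, star_mul, hss, ← hs, ht]
      simp only [mul_assoc]
    rw [e1, hs, ← cfc_smul (2 : ℝ) _ t hcs, ← cfc_const_one ℝ t,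
      ← cfc_add (a := t) (fun x : ℝ => (1 + √(1 - x))⁻¹ * x * (1 + √(1 - x))⁻¹) (fun _ => (1 : ℝ)) ((hcs.mul (by fun_prop)).mul hcs) (by fun_prop)]
    refine cfc_congr fun x hx => ?_
    have h2 := hsp x hx
    have h3 : √(1 - x) * √(1 - x) = 1 - x := Real.mul_self_sqrt (by linarith)
    have h4 : 0 ≤ √(1 - x) := Real.sqrt_nonneg _
    simp only [smul_eq_mul]
    field_simp
    nlinarith
  refine ⟨y * s, mul_mem hy hsM, ?_, ?_⟩
  · rw [mul_assoc, ← supp_bic_comm D ρ hsM, ← mul_assoc, hye]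
  · have h2 := (resv_props (y * s)).2.1
    rw [add_comm, h1] at h2
    rw [mul_assoc, ← mul_smul_comm]
    have : (2 : ℂ) • (s * resv (y * s)) = 1 := by
      rw [← h2, smul_mul_assoc]
      have : (2 : ℂ) = ((2 : ℝ) : ℂ) := by norm_num
      rw [this, Complex.coe_smul]
    rw [this, mul_one]

/-- Kaplansky density -/
theorem kaplansky (hD : IsClosed (D : Set (X →L[ℂ] X))) {y : K →L[ℂ] K} (hy : y ∈ bic D ρ)
    (hye : y * suppP D ρ = y) (hy1 : ‖y‖ ≤ 1) {ι : Type*} [Fintype ι] (ζ : ι → K) {ε : ℝ}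
    (hε : 0 < ε) : ∃ a ∈ D, ‖a‖ ≤ 1 ∧ ∀ i, ‖ρ a (ζ i) - y (ζ i)‖ < ε := by
  obtain ⟨x, hx, hxe, hyx⟩ := exists_preim D ρ hy hye hy1
  obtain ⟨a, ha, h1, h2⟩ := strong_star_dense D ρ hx hxe (fun i => resv x (ζ i))
    (fun i => x (resv x (ζ i))) (ε := ε / 3) (by linarith)
  refine ⟨(2 : ℂ) • (a * resv a), mul_resv_mem hD ha, (resv_props a).2.2.2, fun i => ?_⟩
  set b := ρ a with hb
  have e1 : ρ ((2 : ℂ) • (a * resv a)) - y = (2 : ℂ) • (b * resv b - x * resv x) := by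
    rw [map_smul, map_mul, map_resv, hyx, smul_sub]
  rw [← sub_apply, e1, mul_resv_sub]
  set R := resv (star b) with hR
  have hRn : ‖R‖ ≤ 1 := (resv_props (star b)).2.2.1
  have hRb : ‖R * b‖ ≤ 1 / 2 := by
    have h3 := (resv_props b).2.2.2
    have h4 : R * b = b * resv b := by
      have := mul_resv_sub b 0
      simp at this
      have h0 : resv (0 : K →L[ℂ] K) = 1 := by
        have := (resv_props (0 : K →L[ℂ] K)).1
        simpa using this
      rw [h0, mul_one] at this
      exact this.symm
    rw [h4]
    rw [norm_smul] at h3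
    norm_num at h3
    linarith
  have e2 : ((2 : ℂ) • (R * ((b - x) + b * (star x - star b) * x) * resv x)) (ζ i) =
      (2 : ℂ) • (R (b (resv x (ζ i)) - x (resv x (ζ i))) +
        (R * b) (star x (x (resv x (ζ i))) - star b (x (resv x (ζ i))))) := by
    simp [mulA]
  rw [e2, norm_smul]
  have n1 : ‖R (b (resv x (ζ i)) - x (resv x (ζ i)))‖ ≤ ‖b (resv x (ζ i)) - x (resv x (ζ i))‖ :=
    (R.le_opNorm _).trans (by nlinarith [norm_nonneg (b (resv x (ζ i)) - x (resv x (ζ i)))])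
  have n2 : ‖(R * b) (star x (x (resv x (ζ i))) - star b (x (resv x (ζ i))))‖ ≤
      1 / 2 * ‖star b (x (resv x (ζ i))) - star x (x (resv x (ζ i)))‖ := by
    rw [norm_sub_rev (star b _)]
    exact ((R * b).le_opNorm _).trans (mul_le_mul_of_nonneg_right hRb (norm_nonneg _))
  have n3 := h1 i
  have n4 := h2 i
  have n5 := norm_add_le (R (b (resv x (ζ i)) - x (resv x (ζ i))))
    ((R * b) (star x (x (resv x (ζ i))) - star b (x (resv x (ζ i)))))
  have : ‖(2 : ℂ)‖ = 2 := by norm_num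
  rw [this]
  linarith

/-- extension of commutation estimates -/
theorem kap_ineq (hD : IsClosed (D : Set (X →L[ℂ] X))) {R S : K →L[ℂ] K} {c : ℝ}
    (h : ∀ a ∈ D, ‖a‖ ≤ 1 → ‖ρ a * R - S * ρ a‖ ≤ c)
    {y : K →L[ℂ] K} (hy : y ∈ bic D ρ)
    (hye : y * suppP D ρ = y) (hy1 : ‖y‖ ≤ 1) : ‖y * R - S * y‖ ≤ c := by
  have hc : 0 ≤ c := (norm_nonneg _).trans (h 0 (zero_mem D) (by simp))
  refine ContinuousLinearMap.opNorm_le_bound _ hc fun u => ?_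
  refine le_of_forall_pos_le_add fun ε hε => ?_
  have hε' : 0 < ε / (1 + ‖S‖) := by positivity
  obtain ⟨a, ha, ha1, hap⟩ := kaplansky D ρ hD hy hye hy1 ![R u, u] hε'
  have h0 := hap 0
  have h1 := hap 1
  simp only [Matrix.cons_val_zero, Matrix.cons_val_one] at h0 h1
  have e : (y * R - S * y) u = (ρ a * R - S * ρ a) u - (ρ a (R u) - y (R u)) +
      S (ρ a u - y u) := by
    simp only [sub_apply, mulA, map_sub]; abel
  rw [e]
  have n1 := ContinuousLinearMap.le_opNorm (ρ a * R - S * ρ a) u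
  have n2 := S.le_opNorm (ρ a u - y u)
  have n3 := mul_le_mul_of_nonneg_right (h a ha ha1) (norm_nonneg u)
  have n4 : ‖S‖ * ‖ρ a u - y u‖ ≤ ‖S‖ * (ε / (1 + ‖S‖)) :=
    mul_le_mul_of_nonneg_left h1.le (norm_nonneg S)
  have n5 : ε / (1 + ‖S‖) + ‖S‖ * (ε / (1 + ‖S‖)) = ε := by field_simp
  have n6 := norm_add_le ((ρ a * R - S * ρ a) u - (ρ a (R u) - y (R u))) (S (ρ a u - y u))
  have n7 := norm_sub_le ((ρ a * R - S * ρ a) u) (ρ a (R u) - y (R u))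
  linarith
end VN11

set_option linter.unusedSectionVars false

section VN12
universe u v
variable {X : Type v} [NormedAddCommGroup X] [InnerProductSpace ℂ X] [CompleteSpace X]
variable {K : Type u} [NormedAddCommGroup K] [InnerProductSpace ℂ K] [CompleteSpace K]

local notation "⟪" x "," y "⟫" => inner ℂ x y

theorem exists_pi_family (A : NonUnitalStarSubalgebra ℂ (X →L[ℂ] X))
    (hA : ∀ τ : A → ℂ, IsBoundedTrace A τ → τ = 0) (ρ : (X →L[ℂ] X) →⋆ₐ[ℂ] (K →L[ℂ] K)) (n : ℕ) :
    HasPI (bic A ρ) n (suppP A ρ) := by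
  refine pi_thm (bic_isVN A ρ) (supp_mem A ρ) (fun m hm => supp_bic_comm A ρ hm) (supp_idem A ρ)
    (supp_star A ρ) ?_ n
  intro ι _ ζ η C h i
  refine supp_apply_zero A ρ fun a ha => ?_
  have hc : ρ (star a * a) (ζ i) = 0 := by
    refine t0_lemma (bic_isVN A ρ) (bic_of_mem A ρ (mul_mem (star_mem ha) ha)) ?_ ?_ ζ η C h i
    · rw [← map_star, star_mul, star_star]
    · intro ε hε
      obtain ⟨J, _, x, hxA, hx⟩ := hb_cp A hA (mul_mem (star_mem ha) ha)
        (by rw [star_mul, star_star]) hε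
      refine ⟨J, inferInstance, fun j => ρ (x j), fun j => bic_of_mem A ρ (hxA j), ?_⟩
      have := OrderHomClass.mono ρ hx
      have e : ρ (ε • (1 : X →L[ℂ] X)) = ε • (1 : K →L[ℂ] K) := by
        have : ε • (1 : X →L[ℂ] X) = (ε : ℂ) • 1 := by simp
        rw [this, map_smul, map_one]; simp
      simpa [map_sum, e, map_star] using this
  have h2 := norm_sq_star (ρ a) (ζ i)
  rw [← map_star, ← map_mul, hc, inner_zero_left] at h2
  simpa using h2

lemma gns_real (f : (X →L[ℂ] X) →ₗ[ℝ] ℝ) (hpos : ∀ x, 0 ≤ f (star x * x))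
    (hskew : ∀ h, star h = -h → f h = 0) :
    ∃ (L : Type v) (_ : NormedAddCommGroup L) (_ : InnerProductSpace ℂ L) (_ : CompleteSpace L)
      (π : (X →L[ℂ] X) →⋆ₐ[ℂ] (L →L[ℂ] L)) (ξ : L),
      (∀ x, ‖π x ξ‖ ^ 2 = f (star x * x)) := by
  have him : ∀ h, star h = h → f (Complex.I • h) = 0 := by
    intro h hh
    refine hskew _ ?_
    rw [star_smul, hh]; simp
  have hsm : ∀ (w : ℂ) (y : X →L[ℂ] X), f (w • y) = w.re * f y + w.im * f (Complex.I • y) := by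
    intro w y
    have : w • y = w.re • y + w.im • (Complex.I • y) := by
      conv_lhs => rw [← Complex.re_add_im w]
      rw [add_smul, mul_smul]
      simp
    rw [this, map_add, map_smul, map_smul]; rfl
  let g : (X →L[ℂ] X) →ₗ[ℂ] ℂ :=
    { toFun := fun x => (f x : ℂ) - Complex.I * (f (Complex.I • x) : ℂ)
      map_add' := fun x y => by
        simp only [smul_add, map_add]
        push_cast; ring
      map_smul' := fun z x => by
        rw [hsm z, smul_smul, hsm (Complex.I * z)]
        apply Complex.ext <;> simp }
  have hg : ∀ h, star h = h → g h = (f h : ℂ) := by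
    intro h hh
    change (f h : ℂ) - Complex.I * (f (Complex.I • h) : ℂ) = _
    rw [him h hh]; simp
  let ψ : (X →L[ℂ] X) →ₚ[ℂ] ℂ := PositiveLinearMap.mk₀ g (by
    intro x hx
    obtain ⟨y, rfl⟩ := CStarAlgebra.nonneg_iff_eq_star_mul_self.1 hx
    rw [hg _ (by rw [star_mul, star_star])]
    exact_mod_cast hpos y)
  refine ⟨ψ.GNS, inferInstance, inferInstance, inferInstance, ψ.gnsStarAlgHom,
    ((ψ.toPreGNS 1 : ψ.PreGNS) : ψ.GNS), fun x => ?_⟩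
  have e : ψ.gnsStarAlgHom x ((ψ.toPreGNS 1 : ψ.PreGNS) : ψ.GNS) = ((ψ.toPreGNS x : ψ.PreGNS) : ψ.GNS) := by
    have := ψ.gnsNonUnitalStarAlgHom_apply_coe (a := x) (b := ψ.toPreGNS 1)
    refine Eq.trans this ?_
    rw [PositiveLinearMap.leftMulMapPreGNS_apply]
    simp
  rw [e, UniformSpace.Completion.norm_coe]
  have h1 := ψ.preGNS_norm_sq (ψ.toPreGNS x)
  have h2 : ψ (star x * x) = (f (star x * x) : ℂ) := hg _ (by rw [star_mul, star_star])
  simp only [PositiveLinearMap.ofPreGNS_toPreGNS] at h1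
  rw [h2] at h1
  exact_mod_cast h1
end VN12

set_option linter.unusedSectionVars false

section VN13
universe v
variable {X : Type v} [NormedAddCommGroup X] [InnerProductSpace ℂ X] [CompleteSpace X]

local notation "⟪" x "," y "⟫" => inner ℂ x y

lemma norm_sq_le_of_le [Nontrivial X] (x : X →L[ℂ] X) (r : ℝ)
    (h : star x * x ≤ r • (1 : X →L[ℂ] X)) : ‖x‖ ^ 2 ≤ r := by
  have key : ∀ v : X, ‖x v‖ ^ 2 ≤ r * ‖v‖ ^ 2 := by
    intro v
    have h1 := re_inner_mono h v
    rw [re_inner_smul, ← norm_sq_star] at h1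
    have : (⟪(1 : X →L[ℂ] X) v, v⟫).re = ‖v‖ ^ 2 := by
      have := inner_self_eq_norm_sq (𝕜 := ℂ) v
      simpa using this
    rwa [this] at h1
  obtain ⟨v, hv⟩ := exists_ne (0 : X)
  have hv' : 0 < ‖v‖ ^ 2 := by positivity
  have hr : 0 ≤ r := by
    by_contra hneg
    push Not at hneg
    nlinarith [key v, sq_nonneg ‖x v‖]
  have : ‖x‖ ≤ √r := by
    refine ContinuousLinearMap.opNorm_le_bound _ (Real.sqrt_nonneg _) fun w => ?_
    refine abs_le_of_sq_le_sq' ?_ (by positivity) |>.2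
    rw [mul_pow, Real.sq_sqrt hr]
    exact key w
  calc ‖x‖ ^ 2 ≤ √r ^ 2 := by gcongr
    _ = r := Real.sq_sqrt hr

set_option maxHeartbeats 2000000 in
lemma exists_dominating [Nontrivial X] (φ : (X →L[ℂ] X) →ₗ[ℂ] ℂ) (hφ : ∀ x, ‖φ x‖ ≤ ‖x‖) :
    ∃ f : (X →L[ℂ] X) →ₗ[ℝ] ℝ, (∀ x, 0 ≤ f (star x * x)) ∧ (∀ h, star h = -h → f h = 0) ∧
      f 1 = 1 ∧ ∀ x, ‖φ x‖ ^ 2 ≤ f (star x * x) := by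
  set N : Set (X →L[ℂ] X) := {h | ∃ ε > (0 : ℝ), h + star h ≤ -(ε • 1)} with hN
  set D : Set (X →L[ℂ] X) := {h | ∃ x, star x * x + (1 - 2 * (φ x).re) • 1 ≤ h} with hD
  have smono : ∀ {r s : ℝ}, r ≤ s → r • (1 : X →L[ℂ] X) ≤ s • 1 := by
    intro r s hrs
    exact smul_le_smul_of_nonneg_right hrs zero_le_one
  have hNc : Convex ℝ N := by
    rintro h ⟨ε, hε, h1⟩ k ⟨δ, hδ, h2⟩ a b ha hb hab
    refine ⟨a * ε + b * δ, ?_, ?_⟩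
    · rcases eq_or_lt_of_le ha with h0 | h0
      · have : b = 1 := by linarith
        subst this; rw [← h0]; simpa using hδ
      · have : 0 < a * ε := by positivity
        have : 0 ≤ b * δ := by positivity
        linarith
    · have e : a • h + b • k + star (a • h + b • k) = a • (h + star h) + b • (k + star k) := by
        simp only [star_add, star_smul, star_trivial, smul_add]; abel
      have e2 : -((a * ε + b * δ) • (1 : X →L[ℂ] X)) = a • (-(ε • 1)) + b • (-(δ • 1)) := by
        simp only [smul_neg, smul_smul, add_smul]; abel
      rw [e, e2]
      exact add_le_add (smul_le_smul_of_nonneg_left h1 ha) (smul_le_smul_of_nonneg_left h2 hb)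
  have hNo : IsOpen N := by
    rw [Metric.isOpen_iff]
    rintro h ⟨ε, hε, h1⟩
    refine ⟨ε / 4, by positivity, fun k hk => ⟨ε / 2, by positivity, ?_⟩⟩
    have hsa : IsSelfAdjoint ((k - h) + star (k - h)) := IsSelfAdjoint.add_star_self _
    have hn : ‖(k - h) + star (k - h)‖ ≤ ε / 2 := by
      have hk' : ‖k - h‖ < ε / 4 := by simpa [dist_eq_norm] using hk
      calc _ ≤ ‖k - h‖ + ‖star (k - h)‖ := norm_add_le _ _
        _ ≤ ε / 2 := by rw [norm_star]; linarith
    have h3 : (k - h) + star (k - h) ≤ (ε / 2) • (1 : X →L[ℂ] X) := by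
      have := hsa.le_algebraMap_norm_self
      rw [Algebra.algebraMap_eq_smul_one] at this
      exact this.trans (smono hn)
    have e : k + star k = (h + star h) + ((k - h) + star (k - h)) := by
      rw [star_sub]; abel
    rw [e]
    refine (add_le_add h1 h3).trans (le_of_eq ?_)
    rw [← neg_smul, ← neg_smul, ← add_smul]; congr 1; ring
  have hDc : Convex ℝ D := by
    rintro h ⟨x, h1⟩ k ⟨y, h2⟩ a b ha hb hab
    refine ⟨a • x + b • y, ?_⟩
    refine le_trans ?_ (add_le_add (smul_le_smul_of_nonneg_left h1 ha)
      (smul_le_smul_of_nonneg_left h2 hb))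
    have hb' : b = 1 - a := by linarith
    have e : a • (star x * x + (1 - 2 * (φ x).re) • (1 : X →L[ℂ] X)) +
        b • (star y * y + (1 - 2 * (φ y).re) • 1) =
        star (a • x + b • y) * (a • x + b • y) + (1 - 2 * (φ (a • x + b • y)).re) • 1
          + (a * b) • (star (x - y) * (x - y)) := by
      have r : (φ (a • x + b • y)).re = a * (φ x).re + b * (φ y).re := by
        have e1 : a • x = (a : ℂ) • x := by simp
        have e2 : b • y = (b : ℂ) • y := by simp
        rw [map_add, e1, e2, map_smul, map_smul]; simp
      rw [r]
      simp only [star_add, star_sub, star_smul, star_trivial, smul_add, smul_sub, smul_smul, sub_mul,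
        mul_sub, add_mul, mul_add, smul_mul_assoc, mul_smul_comm]
      subst hb'
      module
    rw [e]
    refine le_add_of_nonneg_right ?_
    exact smul_nonneg (by positivity) (star_mul_self_nonneg _)
  have hdisj : Disjoint N D := by
    rw [Set.disjoint_left]
    rintro h ⟨ε, hε, h1⟩ ⟨x, h2⟩
    set c : ℝ := 1 - 2 * (φ x).re with hc
    have h3 : star x * x + c • 1 ≤ star h := by
      have := star_le_star_iff.2 h2
      simpa [star_mul, star_smul] using this
    have h4 := (add_le_add h2 h3).trans h1
    have h5 : star x * x ≤ (-(c + ε / 2)) • (1 : X →L[ℂ] X) := by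
      have := smul_le_smul_of_nonneg_left h4 (show (0 : ℝ) ≤ 1 / 2 by norm_num)
      have t := add_le_add_left this (-(c • (1 : X →L[ℂ] X)))
      have e1 : (1 / 2 : ℝ) • (star x * x + c • 1 + (star x * x + c • 1)) + -(c • (1 : X →L[ℂ] X)) =
        star x * x := by module
      have e2 : (1 / 2 : ℝ) • (-(ε • (1 : X →L[ℂ] X))) + -(c • (1 : X →L[ℂ] X)) =
        (-(c + ε / 2)) • (1 : X →L[ℂ] X) := by module
      rw [e1, e2] at t
      exact t
    have h6 := norm_sq_le_of_le x _ h5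
    have h7 : (φ x).re ≤ ‖x‖ := (Complex.re_le_norm _).trans (hφ x)
    nlinarith [sq_nonneg (‖x‖ - 1)]
  obtain ⟨f, u, hf1, hf2⟩ := geometric_hahn_banach_open hNc hNo hDc hdisj
  have hone : ∀ ε > (0 : ℝ), -(ε • (1 : X →L[ℂ] X)) ∈ N := by
    intro ε hε
    refine ⟨2 * ε, by positivity, le_of_eq ?_⟩
    simp only [star_neg, star_smul, star_one, star_trivial]; module
  have hu : 0 ≤ u := by
    by_contra hneg
    push Not at hneg
    have hlim : ∀ ε > (0 : ℝ), -(ε * f 1) < u := fun ε hε => by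
      simpa using hf1 _ (hone ε hε)
    have h1 := hlim (-u / (2 * (|f 1| + 1))) (by have := abs_nonneg (f 1); apply div_pos <;> linarith)
    have h2 : -u / (2 * (|f 1| + 1)) * f 1 ≤ -u / 2 := by
      have hp : 0 < |f 1| + 1 := by positivity
      calc -u / (2 * (|f 1| + 1)) * f 1 ≤ -u / (2 * (|f 1| + 1)) * (|f 1| + 1) := by
            gcongr
            · apply div_nonneg <;> linarith
            · linarith [le_abs_self (f 1)]
        _ = -u / 2 := by field_simp
    linarith
  have hu1 : u ≤ f 1 := hf2 1 ⟨0, by simp⟩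
  have hf1pos : 0 < f 1 := by
    have := hf1 _ (hone 1 one_pos)
    simp at this
    linarith
  have hskew : ∀ h, star h = -h → f h = 0 := by
    intro h hh
    have key : ∀ t : ℝ, -f 1 + t * f h < u := by
      intro t
      have : (-1 + t • h : X →L[ℂ] X) ∈ N := by
        refine ⟨2, by norm_num, le_of_eq ?_⟩
        simp only [star_add, star_neg, star_one, star_smul, star_trivial, hh]; module
      simpa using hf1 _ this
    by_contra hne
    have := key ((u + f 1) / f h)
    rw [div_mul_cancel₀ _ hne] at this
    linarith
  have hpos : ∀ x, 0 ≤ f (star x * x) := by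
    intro x
    by_contra hneg
    push Not at hneg
    have key : ∀ t : ℝ, 0 ≤ t → -f 1 - t * f (star x * x) < u := by
      intro t ht
      have : (-1 - t • (star x * x) : X →L[ℂ] X) ∈ N := by
        refine ⟨2, by norm_num, ?_⟩
        have e : (-1 - t • (star x * x) : X →L[ℂ] X) + star (-1 - t • (star x * x)) =
          -((2 : ℝ) • 1) - (2 * t) • (star x * x) := by
          simp only [star_sub, star_neg, star_one, star_smul, star_trivial, star_mul, star_star]
          module
        rw [e]
        exact sub_le_self _ (smul_nonneg (by positivity) (star_mul_self_nonneg _))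
      simpa using hf1 _ this
    have := key ((u + f 1) / (-f (star x * x))) (by apply div_nonneg <;> linarith)
    have e : (u + f 1) / (-f (star x * x)) * f (star x * x) = -(u + f 1) := by
      field_simp [hneg.ne]
    rw [e] at this
    linarith
  have hdom : ∀ x, 2 * (φ x).re * f 1 ≤ f (star x * x) + f 1 := by
    intro x
    have := hf2 _ ⟨x, le_rfl⟩
    rw [map_add, map_smul, smul_eq_mul] at this
    linarith
  refine ⟨(f 1)⁻¹ • (f : (X →L[ℂ] X) →ₗ[ℝ] ℝ), ?_, ?_, ?_, ?_⟩
  · intro x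
    exact mul_nonneg (by positivity) (hpos x)
  · intro h hh
    change (f 1)⁻¹ * f h = 0
    rw [hskew h hh, mul_zero]
  · exact inv_mul_cancel₀ hf1pos.ne'
  · intro x
    change _ ≤ (f 1)⁻¹ * f (star x * x)
    rw [le_inv_mul_iff₀ hf1pos]
    -- scale
    by_cases h0 : φ x = 0
    · rw [h0]; simpa using hpos x
    have hq : ∀ t : ℝ, 2 * t * ‖φ x‖ * f 1 ≤ t ^ 2 * f (star x * x) + f 1 := by
      intro t
      set w : ℂ := (t : ℂ) * (star (φ x) / (‖φ x‖ : ℂ)) with hw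
      have hn : (‖φ x‖ : ℂ) ≠ 0 := by simpa using h0
      have e1 : (φ (w • x)) = ((t * ‖φ x‖ : ℝ) : ℂ) := by
        rw [map_smul, smul_eq_mul, hw]
        have : star (φ x) * φ x = (‖φ x‖ : ℂ) ^ 2 := by
          simpa using Complex.conj_mul' (φ x)
        push_cast
        field_simp
        linear_combination (t : ℂ) * this
      have e3 : star w * w = ((t ^ 2 : ℝ) : ℂ) := by
        have h1 : star (φ x) * φ x = (‖φ x‖ : ℂ) ^ 2 := by
          simpa using Complex.conj_mul' (φ x)
        rw [hw]
        simp only [star_mul', star_div₀, star_star]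
        have r1 : star (t : ℂ) = t := Complex.conj_ofReal t
        have r2 : star (‖φ x‖ : ℂ) = ‖φ x‖ := Complex.conj_ofReal _
        rw [r1, r2]
        push_cast
        field_simp
        linear_combination (t : ℂ) ^ 2 * h1
      have e2 : star (w • x) * (w • x) = (t ^ 2) • (star x * x) := by
        rw [star_smul, smul_mul_smul_comm, e3]; exact Complex.coe_smul _ _
      have := hdom (w • x)
      rw [e1, e2, map_smul, smul_eq_mul, Complex.ofReal_re] at this
      linarith
    have hpx := hpos x
    set F := f (star x * x)
    set p := ‖φ x‖
    have hp : 0 < p := norm_pos_iff.2 h0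
    have h1 := hq (1 / p)
    have e : 2 * (1 / p) * p * f 1 = 2 * f 1 := by field_simp
    rw [e] at h1
    have h2 : f 1 ≤ (1 / p) ^ 2 * F := by linarith
    have e3 : f 1 * p ^ 2 ≤ (1 / p) ^ 2 * F * p ^ 2 := by gcongr
    have e4 : (1 / p) ^ 2 * F * p ^ 2 = F := by field_simp
    linarith

lemma func_rep (φ : (X →L[ℂ] X) →ₗ[ℂ] ℂ) (hφ : ∀ x, ‖φ x‖ ≤ ‖x‖) :
    ∃ (L : Type v) (_ : NormedAddCommGroup L) (_ : InnerProductSpace ℂ L) (_ : CompleteSpace L)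
      (π : (X →L[ℂ] X) →⋆ₐ[ℂ] (L →L[ℂ] L)) (ξ Ω : L), ‖ξ‖ ≤ 1 ∧ ‖Ω‖ ≤ 1 ∧
      ∀ x, φ x = ⟪Ω, π x ξ⟫ := by
  rcases subsingleton_or_nontrivial X with hX | hX
  · refine ⟨X, inferInstance, inferInstance, inferInstance, StarAlgHom.id ℂ _, 0, 0, by simp, by simp,
      fun x => ?_⟩
    have : x = 0 := Subsingleton.elim _ _
    simp [this]
  · obtain ⟨f, h1, h2, h3, h4⟩ := exists_dominating φ hφ
    obtain ⟨L, _, _, _, π, ξ, hπ⟩ := gns_real f h1 h2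
    have hξ : ‖ξ‖ ^ 2 = 1 := by
      have := hπ 1
      simpa [h3] using this
    let T : (X →L[ℂ] X) →ₗ[ℂ] L :=
      { toFun := fun x => π x ξ
        map_add' := fun x y => by simp
        map_smul' := fun c x => by simp }
    have hb : ∀ x, ‖φ x‖ ≤ ‖T x‖ := by
      intro x
      refine abs_le_of_sq_le_sq' ?_ (norm_nonneg _) |>.2
      exact (h4 x).trans (hπ x).ge
    have hker : LinearMap.ker T ≤ LinearMap.ker φ := by
      intro x hx
      have := hb x
      rw [LinearMap.mem_ker.1 hx] at this
      simpa using this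
    let V := LinearMap.range T
    let g0 : V →ₗ[ℂ] ℂ := (Submodule.liftQ _ φ hker).comp T.quotKerEquivRange.symm.toLinearMap
    have hg0 : ∀ x, g0 ⟨T x, x, rfl⟩ = φ x := by
      intro x
      have : T.quotKerEquivRange.symm ⟨T x, x, rfl⟩ = Submodule.Quotient.mk x := by
        rw [LinearEquiv.symm_apply_eq]; rfl
      change Submodule.liftQ _ φ hker (T.quotKerEquivRange.symm ⟨T x, x, rfl⟩) = _
      rw [this]; rfl
    have hg0b : ∀ v : V, ‖g0 v‖ ≤ 1 * ‖v‖ := by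
      rintro ⟨_, x, rfl⟩
      rw [hg0, one_mul]
      exact hb x
    obtain ⟨g, hg1, hg2⟩ := exists_extension_norm_eq V (g0.mkContinuous 1 hg0b)
    refine ⟨L, inferInstance, inferInstance, inferInstance, π, ξ,
      (InnerProductSpace.toDual ℂ L).symm g, ?_, ?_, ?_⟩
    · nlinarith [norm_nonneg ξ]
    · rw [LinearIsometryEquiv.norm_map, hg2]
      exact LinearMap.mkContinuous_norm_le _ zero_le_one _
    · intro x
      rw [InnerProductSpace.toDual_symm_apply]
      have := hg1 ⟨T x, x, rfl⟩
      rw [← hg0]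
      exact this.symm
end VN13

set_option linter.unusedSectionVars false

section VN14
variable {K : Type*} [NormedAddCommGroup K] [InnerProductSpace ℂ K] [CompleteSpace K]
variable {n : ℕ}

local notation "⟪" x "," y "⟫" => inner ℂ x y

/-- matrix units -/
noncomputable def mun (K : Type*) [NormedAddCommGroup K] [InnerProductSpace ℂ K] {n : ℕ} (i j : Fin n) :
    PiLp 2 (fun _ : Fin n => K) →L[ℂ] PiLp 2 (fun _ : Fin n => K) :=
  (sg i).comp (PiLp.proj 2 (fun _ : Fin n => K) j)

/-- matrix entries -/
noncomputable def ent (x : PiLp 2 (fun _ : Fin n => K) →L[ℂ] PiLp 2 (fun _ : Fin n => K))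
    (i j : Fin n) : K →L[ℂ] K :=
  (PiLp.proj 2 (fun _ : Fin n => K) i).comp (x.comp (sg j))

lemma mun_apply (i j k : Fin n) (v : PiLp 2 (fun _ : Fin n => K)) :
    mun K i j v k = if k = i then v j else 0 := by
  simp [mun, sg_apply]

lemma mun_mul (i j k l : Fin n) : mun K i j * mun K k l = if j = k then mun K i l else 0 := by
  refine ContinuousLinearMap.ext fun v => ?_
  ext m
  rw [mulA, mun_apply, mun_apply]
  by_cases h : j = k
  · simp [h, mun_apply]
  · simp [h]

lemma mun_star (i j : Fin n) : star (mun K i j) = mun K j i := by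
  refine ContinuousLinearMap.ext fun v => ?_
  refine ext_inner_left ℂ fun w => ?_
  rw [inner_star_right, PiLp.inner_apply, PiLp.inner_apply]
  simp only [mun_apply]
  have e1 : ∀ k, (⟪(if k = i then w j else 0), v k⟫ : ℂ) = if k = i then ⟪w j, v k⟫ else 0 := by
    intro k; split_ifs <;> simp
  have e2 : ∀ k, (⟪w k, (if k = j then v i else 0)⟫ : ℂ) = if k = j then ⟪w k, v i⟫ else 0 := by
    intro k; split_ifs <;> simp
  simp only [e1, e2]
  simp

lemma mun_sum : ∑ i : Fin n, mun K i i = 1 := by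
  refine ContinuousLinearMap.ext fun v => ?_
  rw [sum_apply]
  exact sum_sg v

lemma dgo_mun (a : K →L[ℂ] K) (i j : Fin n) : dgo a * mun K i j = mun K i j * dgo a := by
  refine ContinuousLinearMap.ext fun v => ?_
  ext m
  rw [mulA, mulA, dgo_apply, mun_apply, mun_apply, dgo_apply]
  split_ifs <;> simp

/-- the diagonal embedding as a star homomorphism -/
noncomputable def dgH (K : Type*) [NormedAddCommGroup K] [InnerProductSpace ℂ K] [CompleteSpace K] (n : ℕ) :
    (K →L[ℂ] K) →⋆ₐ[ℂ]
      (PiLp 2 (fun _ : Fin n => K) →L[ℂ] PiLp 2 (fun _ : Fin n => K)) where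
  toFun := dgo
  map_one' := by
    refine ContinuousLinearMap.ext fun v => ?_
    ext m; simp [dgo_apply]
  map_mul' a b := by
    refine ContinuousLinearMap.ext fun v => ?_
    ext m; simp [dgo_apply]
  map_zero' := by
    refine ContinuousLinearMap.ext fun v => ?_
    ext m; simp [dgo_apply]
  map_add' a b := by
    refine ContinuousLinearMap.ext fun v => ?_
    ext m; simp [dgo_apply]
  commutes' r := by
    refine ContinuousLinearMap.ext fun v => ?_
    ext m; simp [dgo_apply, Algebra.algebraMap_eq_smul_one]
  map_star' a := (dgo_star a).symm

lemma dgH_apply (a : K →L[ℂ] K) : dgH K n a = dgo a := rfl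

lemma ent_apply (x : PiLp 2 (fun _ : Fin n => K) →L[ℂ] PiLp 2 (fun _ : Fin n => K)) (i j : Fin n)
    (u : K) : ent x i j u = x (sg j u) i := rfl

lemma eq_sum_ent (x : PiLp 2 (fun _ : Fin n => K) →L[ℂ] PiLp 2 (fun _ : Fin n => K)) :
    x = ∑ i, ∑ j, dgo (ent x i j) * mun K i j := by
  refine ContinuousLinearMap.ext fun v => ?_
  ext m
  conv_lhs => rw [← sum_sg v]
  simp only [sum_apply, map_sum, WithLp.ofLp_sum, Finset.sum_apply, mulA, dgo_apply, mun_apply]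
  have : ∀ i j : Fin n, ent x i j (if m = i then v j else 0) = if m = i then ent x i j (v j) else 0 := by
    intro i j; split_ifs <;> simp
  simp only [this]
  rw [Finset.sum_comm]
  simp [ent_apply]

lemma matrixOp_apply (a : Fin n → Fin n → (K →L[ℂ] K)) (v : PiLp 2 (fun _ : Fin n => K)) (i : Fin n) :
    matrixOp a v i = ∑ j, a i j (v j) := by
  simp [matrixOp, sum_apply]

lemma ent_matrixOp (a : Fin n → Fin n → (K →L[ℂ] K)) (i j : Fin n) : ent (matrixOp a) i j = a i j := by
  refine ContinuousLinearMap.ext fun u => ?_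
  rw [ent_apply, matrixOp_apply]
  simp only [sg_apply]
  have : ∀ k : Fin n, a i k (if k = j then u else 0) = if k = j then a i k u else 0 := by
    intro k; split_ifs <;> simp
  simp [this]

lemma matrixOp_ent (x : PiLp 2 (fun _ : Fin n => K) →L[ℂ] PiLp 2 (fun _ : Fin n => K)) :
    matrixOp (ent x) = x := by
  refine ContinuousLinearMap.ext fun v => ?_
  ext m
  rw [matrixOp_apply]
  conv_rhs => rw [← sum_sg v]
  simp [ent_apply, map_sum]

lemma mem_matrixAmp {A : NonUnitalStarSubalgebra ℂ (K →L[ℂ] K)}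
    {x : PiLp 2 (fun _ : Fin n => K) →L[ℂ] PiLp 2 (fun _ : Fin n => K)} :
    x ∈ MatrixAmp n A ↔ ∀ i j, ent x i j ∈ A := by
  constructor
  · rintro ⟨a, ha, rfl⟩ i j
    rw [ent_matrixOp]; exact ha i j
  · intro h
    exact ⟨ent x, h, (matrixOp_ent x).symm⟩

lemma ent_add (x y : PiLp 2 (fun _ : Fin n => K) →L[ℂ] PiLp 2 (fun _ : Fin n => K)) (i j : Fin n) :
    ent (x + y) i j = ent x i j + ent y i j := by
  refine ContinuousLinearMap.ext fun u => ?_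
  simp [ent_apply]

lemma ent_smul (c : ℂ) (x : PiLp 2 (fun _ : Fin n => K) →L[ℂ] PiLp 2 (fun _ : Fin n => K))
    (i j : Fin n) : ent (c • x) i j = c • ent x i j := by
  refine ContinuousLinearMap.ext fun u => ?_
  simp [ent_apply]

lemma ent_mul (x y : PiLp 2 (fun _ : Fin n => K) →L[ℂ] PiLp 2 (fun _ : Fin n => K)) (i j : Fin n) :
    ent (x * y) i j = ∑ k, ent x i k * ent y k j := by
  refine ContinuousLinearMap.ext fun u => ?_
  rw [ent_apply, mulA, sum_apply]
  conv_lhs => rw [← sum_sg (y (sg j u))]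
  simp [map_sum, ent_apply]

lemma inner_sg (i : Fin n) (u : K) (v : PiLp 2 (fun _ : Fin n => K)) : ⟪sg i u, v⟫ = ⟪u, v i⟫ := by
  rw [PiLp.inner_apply]
  have e1 : ∀ k, (⟪sg i u k, v k⟫ : ℂ) = if k = i then ⟪u, v k⟫ else 0 := by
    intro k; rw [sg_apply]; split_ifs <;> simp
  simp [e1]

lemma inner_sg' (i : Fin n) (u : K) (v : PiLp 2 (fun _ : Fin n => K)) : ⟪v, sg i u⟫ = ⟪v i, u⟫ := by
  rw [← inner_conj_symm, inner_sg, inner_conj_symm]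

lemma ent_star (x : PiLp 2 (fun _ : Fin n => K) →L[ℂ] PiLp 2 (fun _ : Fin n => K)) (i j : Fin n) :
    ent (star x) i j = star (ent x j i) := by
  refine ContinuousLinearMap.ext fun u => ?_
  refine ext_inner_left ℂ fun w => ?_
  rw [inner_star_right, ent_apply, ent_apply, ← inner_sg, ← inner_sg', inner_star_right]

lemma ent_dgo_mun (a : K →L[ℂ] K) (i j k l : Fin n) :
    ent (dgo a * mun K i j) k l = if k = i ∧ l = j then a else 0 := by
  refine ContinuousLinearMap.ext fun u => ?_
  rw [ent_apply, mulA, dgo_apply, mun_apply, sg_apply]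
  by_cases h1 : k = i <;> by_cases h2 : l = j <;> simp [h1, h2, eq_comm]
  · rw [if_neg (fun h => h2 h.symm), map_zero]

/-- `Mₙ(A)` as a star subalgebra -/
noncomputable def matAlg (n : ℕ) (A : NonUnitalStarSubalgebra ℂ (K →L[ℂ] K)) :
    NonUnitalStarSubalgebra ℂ (PiLp 2 (fun _ : Fin n => K) →L[ℂ] PiLp 2 (fun _ : Fin n => K)) where
  carrier := MatrixAmp n A
  add_mem' := by
    intro x y hx hy
    rw [mem_matrixAmp] at *
    intro i j; rw [ent_add]; exact add_mem (hx i j) (hy i j)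
  zero_mem' := by
    rw [mem_matrixAmp]
    intro i j
    have : ent (0 : PiLp 2 (fun _ : Fin n => K) →L[ℂ] PiLp 2 (fun _ : Fin n => K)) i j = 0 := rfl
    rw [this]; exact zero_mem A
  mul_mem' := by
    intro x y hx hy
    rw [mem_matrixAmp] at *
    intro i j; rw [ent_mul]; exact sum_mem fun k _ => mul_mem (hx i k) (hy k j)
  smul_mem' := by
    intro c x hx
    rw [mem_matrixAmp] at *
    intro i j; rw [ent_smul]; exact SMulMemClass.smul_mem _ (hx i j)
  star_mem' := by
    intro x hx
    change star x ∈ MatrixAmp n A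
    have hx : x ∈ MatrixAmp n A := hx
    rw [mem_matrixAmp] at *
    intro i j; rw [ent_star]; exact star_mem (hx j i)

lemma mem_matAlg {A : NonUnitalStarSubalgebra ℂ (K →L[ℂ] K)}
    {x : PiLp 2 (fun _ : Fin n => K) →L[ℂ] PiLp 2 (fun _ : Fin n => K)} :
    x ∈ matAlg n A ↔ ∀ i j, ent x i j ∈ A := mem_matrixAmp

lemma dgo_mun_mem {A : NonUnitalStarSubalgebra ℂ (K →L[ℂ] K)} {a : K →L[ℂ] K} (ha : a ∈ A)
    (i j : Fin n) : dgo a * mun K i j ∈ matAlg n A := by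
  rw [mem_matAlg]
  intro k l
  rw [ent_dgo_mun]
  split_ifs
  · exact ha
  · exact zero_mem A

lemma dgo_mem {A : NonUnitalStarSubalgebra ℂ (K →L[ℂ] K)} {a : K →L[ℂ] K} (ha : a ∈ A) :
    dgo a ∈ matAlg n A := by
  have : dgo a = ∑ i : Fin n, dgo a * mun K i i := by
    rw [← Finset.mul_sum, mun_sum, mul_one]
  rw [this]
  exact sum_mem fun i _ => dgo_mun_mem ha i i

lemma mun_mul_mem {A : NonUnitalStarSubalgebra ℂ (K →L[ℂ] K)} 
    {x : PiLp 2 (fun _ : Fin n => K) →L[ℂ] PiLp 2 (fun _ : Fin n => K)} (hx : x ∈ matAlg n A)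
    (i j : Fin n) : mun K i j * x ∈ matAlg n A := by
  rw [eq_sum_ent x, Finset.mul_sum]
  refine sum_mem fun k _ => ?_
  rw [Finset.mul_sum]
  refine sum_mem fun l _ => ?_
  rw [← mul_assoc, ← dgo_mun, mul_assoc, mun_mul]
  split_ifs
  · exact dgo_mun_mem (mem_matAlg.1 hx _ _) _ _
  · rw [mul_zero]; exact zero_mem _

lemma matAlg_closed {A : NonUnitalStarSubalgebra ℂ (K →L[ℂ] K)} (hA : IsClosed (A : Set (K →L[ℂ] K))) :
    IsClosed (matAlg n A : Set (PiLp 2 (fun _ : Fin n => K) →L[ℂ] PiLp 2 (fun _ : Fin n => K))) := by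
  have : (matAlg n A : Set (PiLp 2 (fun _ : Fin n => K) →L[ℂ] PiLp 2 (fun _ : Fin n => K))) =
      ⋂ i, ⋂ j, (fun x => ent x i j) ⁻¹' (A : Set (K →L[ℂ] K)) := by
    ext x
    simp only [SetLike.mem_coe, mem_matAlg, Set.mem_iInter, Set.mem_preimage]
  rw [this]
  refine isClosed_iInter fun i => isClosed_iInter fun j => hA.preimage ?_
  unfold ent
  fun_prop
end VN14

set_option linter.unusedSectionVars false

section VN15
variable {K : Type*} [NormedAddCommGroup K] [InnerProductSpace ℂ K] [CompleteSpace K]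
variable {n : ℕ}

local notation "⟪" x "," y "⟫" => inner ℂ x y

lemma fourier_exists (n : ℕ) [NeZero n] : ∃ u : Fin n → Fin n → ℂ, (∀ t k, star (u t k) * u t k = 1) ∧
    ∀ m l, ∑ t, star (u t m) * u t l = if m = l then (n : ℂ) else 0 := by
  have hζ := Complex.isPrimitiveRoot_exp n (NeZero.ne n)
  set ζ := Complex.exp (2 * Real.pi * Complex.I / n)
  have hn : ‖ζ‖ = 1 := Complex.norm_eq_one_of_pow_eq_one hζ.pow_eq_one (NeZero.ne n)
  have h1 : star ζ * ζ = 1 := by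
    have := Complex.conj_mul' ζ
    rw [hn] at this
    simpa using this
  refine ⟨fun t k => (ζ ^ (k : ℕ)) ^ (t : ℕ), ?_, ?_⟩
  · intro t k
    rw [star_pow, star_pow, ← mul_pow, ← mul_pow, h1]; simp
  · intro m l
    have e : ∀ t : Fin n, star ((ζ ^ (m : ℕ)) ^ (t : ℕ)) * (ζ ^ (l : ℕ)) ^ (t : ℕ) =
        (star (ζ ^ (m : ℕ)) * ζ ^ (l : ℕ)) ^ (t : ℕ) := by
      intro t; rw [star_pow, mul_pow]
    simp only [e]
    have hm : star (ζ ^ (m : ℕ)) * ζ ^ (m : ℕ) = 1 := by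
      rw [star_pow, ← mul_pow, h1, one_pow]
    split_ifs with h
    · subst h
      rw [hm]; simp
    · rw [Fin.sum_univ_eq_sum_range (fun t => (star (ζ ^ (m : ℕ)) * ζ ^ (l : ℕ)) ^ t)]
      set z := star (ζ ^ (m : ℕ)) * ζ ^ (l : ℕ) with hz
      have hz1 : z ≠ 1 := by
        intro hz1
        apply h
        have : ζ ^ (m : ℕ) = ζ ^ (l : ℕ) := by
          calc ζ ^ (m : ℕ) = ζ ^ (m : ℕ) * z := by rw [hz1, mul_one]
            _ = (star (ζ ^ (m : ℕ)) * ζ ^ (m : ℕ)) * ζ ^ (l : ℕ) := by rw [hz]; ring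
            _ = _ := by rw [hm, one_mul]
        exact Fin.ext (hζ.pow_inj m.2 l.2 this)
      have hzn : z ^ n = 1 := by
        have p : ∀ k : ℕ, (ζ ^ k) ^ n = 1 := by
          intro k
          rw [← pow_mul, mul_comm, pow_mul, hζ.pow_eq_one, one_pow]
        rw [hz, mul_pow, ← star_pow, p, p, star_one, one_mul]
      have := geom_sum_mul z n
      rw [hzn, sub_self] at this
      exact (mul_eq_zero.1 this).resolve_right (sub_ne_zero.2 hz1)

lemma norm_le_one_of_star_mul {x e : K →L[ℂ] K} (h : star x * x = e) (he : ‖e‖ ≤ 1) : ‖x‖ ≤ 1 := by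
  have := CStarRing.norm_star_mul_self (x := x)
  rw [h] at this
  nlinarith [norm_nonneg x]

lemma norm_proj_le {e : K →L[ℂ] K} (h1 : e * e = e) (h2 : star e = e) : ‖e‖ ≤ 1 := by
  have := CStarRing.norm_star_mul_self (x := e)
  rw [h2, h1] at this
  by_contra h
  push Not at h
  nlinarith [norm_nonneg e]

/-- a system of matrix units -/
structure MU (F : Fin n → Fin n → (K →L[ℂ] K)) : Prop where
  mul : ∀ i j k l, F i j * F k l = if j = k then F i l else 0
  st : ∀ i j, star (F i j) = F j i
  sum : ∑ i, F i i = 1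

variable {F : Fin n → Fin n → (K →L[ℂ] K)}

lemma MU.norm_sum (hF : MU F) (o : Fin n) (u : K) : ∑ i, ‖F o i u‖ ^ 2 = ‖u‖ ^ 2 := by
  have : ∀ i, ‖F o i u‖ ^ 2 = (⟪F i i u, u⟫).re := by
    intro i
    rw [norm_sq_star, hF.st, hF.mul, if_pos rfl]
  simp only [this]
  rw [← Complex.re_sum, ← sum_inner, ← sum_apply, hF.sum]
  have := inner_self_eq_norm_sq (𝕜 := ℂ) u
  simpa using this

lemma MU.norm_le (hF : MU F) (o : Fin n) {y : K →L[ℂ] K} (hy : ∀ i j, F i j * y = y * F i j)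
    (h : ‖F o o * y‖ ≤ 1) : ‖y‖ ≤ 1 := by
  refine ContinuousLinearMap.opNorm_le_bound _ zero_le_one fun u => ?_
  rw [one_mul]
  refine abs_le_of_sq_le_sq' ?_ (norm_nonneg _) |>.2
  rw [← hF.norm_sum o, ← hF.norm_sum o u]
  refine Finset.sum_le_sum fun i _ => ?_
  have e : F o i (y u) = (F o o * y) (F o i u) := by
    rw [← mulA, ← mulA, hy, hy, mul_assoc, hF.mul, if_pos rfl]
  rw [e]
  gcongr
  exact (ContinuousLinearMap.le_opNorm _ _).trans (by nlinarith [norm_nonneg (F o i u)])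

/-- one step of the averaging -/
lemma avg_step (hF : MU F) (o : Fin n) {e P Q : K →L[ℂ] K} (he1 : e * e = e) (he2 : star e = e)
    {g : ℝ} {w : Fin n → (K →L[ℂ] K)} (hwF : ∀ k i j, F i j * w k = w k * F i j)
    (hw : ∀ i j, star (w i) * w j = if i = j then e else 0)
    (hPF : ∀ i j, F i j * P = P * F i j) (hQF : ∀ i j, F i j * Q = Q * F i j)
    {a : Fin n → Fin n → (K →L[ℂ] K)} (haF : ∀ k l i j, F i j * a k l = a k l * F i j)
    (hae : ∀ k l, a k l * e = a k l) (hea : ∀ k l, e * a k l = a k l)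
    (hX : ‖∑ k, ∑ l, a k l * F k l‖ ≤ 1)
    (hg : ∀ y : K →L[ℂ] K, y = ∑ k, ∑ l, w k * a k l * star (w l) → ‖y‖ ≤ 1 → ‖y * Q - P * y‖ ≤ g) :
    ‖∑ k, ∑ l, F k l * (∑ m, a k m * (star (w m) * Q * w l) - ∑ m, (star (w k) * P * w m) * a m l)‖
      ≤ g := by
  have hwF' : ∀ k i j, F i j * star (w k) = star (w k) * F i j := by
    intro k i j
    have := congrArg star (hwF k j i)
    simp only [star_mul, hF.st] at this
    exact this.symm
  set V : K →L[ℂ] K := ∑ l, F o l * w l with hV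
  have hVs : star V = ∑ k, star (w k) * F k o := by
    rw [hV, star_sum]; simp only [star_mul, hF.st]
  have hconj : ∀ T : K →L[ℂ] K, (∀ i j, F i j * T = T * F i j) →
      star V * T * V = ∑ k, ∑ l, F k l * (star (w k) * T * w l) := by
    intro T hT
    rw [hVs, hV, Finset.sum_mul, Finset.sum_mul]
    refine Finset.sum_congr rfl fun k _ => ?_
    rw [Finset.mul_sum]
    refine Finset.sum_congr rfl fun l _ => ?_
    calc star (w k) * F k o * T * (F o l * w l) = star (w k) * (F k o * T) * F o l * w l := by
          simp only [mul_assoc]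
      _ = star (w k) * T * (F k o * F o l) * w l := by rw [hT]; simp only [mul_assoc]
      _ = star (w k) * (T * F k l) * w l := by rw [hF.mul, if_pos rfl]; simp only [mul_assoc]
      _ = (star (w k) * F k l) * T * w l := by rw [← hT]; simp only [mul_assoc]
      _ = _ := by rw [← hwF']; simp only [mul_assoc]
  have hVV : star V * V = e := by
    have := hconj 1 (by simp)
    rw [mul_one] at this
    rw [this]
    have : ∀ k l, F k l * (star (w k) * 1 * w l) = if k = l then F k l * e else 0 := by
      intro k l
      rw [mul_one, hw]; split_ifs <;> simp
    simp only [this]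
    simp [← Finset.sum_mul, hF.sum]
  have hVn : ‖V‖ ≤ 1 := norm_le_one_of_star_mul hVV (norm_proj_le he1 he2)
  have hVsn : ‖star V‖ ≤ 1 := by rwa [norm_star]
  set y : K →L[ℂ] K := ∑ k, ∑ l, w k * a k l * star (w l) with hy
  have hyF : ∀ i j, F i j * y = y * F i j := by
    intro i j
    rw [hy, Finset.mul_sum, Finset.sum_mul]
    refine Finset.sum_congr rfl fun k _ => ?_
    rw [Finset.mul_sum, Finset.sum_mul]
    refine Finset.sum_congr rfl fun l _ => ?_
    calc F i j * (w k * a k l * star (w l)) = (F i j * w k) * a k l * star (w l) := by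
          simp only [mul_assoc]
      _ = w k * (F i j * a k l) * star (w l) := by rw [hwF]; simp only [mul_assoc]
      _ = w k * a k l * (F i j * star (w l)) := by rw [haF]; simp only [mul_assoc]
      _ = _ := by rw [hwF']; simp only [mul_assoc]
  have hwy : ∀ k, star (w k) * y = ∑ m, a k m * star (w m) := by
    intro k
    rw [hy, Finset.mul_sum]
    have : ∀ i, star (w k) * ∑ l, w i * a i l * star (w l) =
        if k = i then ∑ l, a i l * star (w l) else 0 := by
      intro i
      rw [Finset.mul_sum]
      have : ∀ l, star (w k) * (w i * a i l * star (w l)) =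
          (if k = i then e else 0) * (a i l * star (w l)) := by
        intro l; rw [← hw]; simp only [mul_assoc]
      simp only [this]
      split_ifs
      · refine Finset.sum_congr rfl fun l _ => ?_
        rw [← mul_assoc, hea]
      · simp
    simp [this]
  have hyw : ∀ l, y * w l = ∑ m, w m * a m l := by
    intro l
    rw [hy, Finset.sum_mul]
    refine Finset.sum_congr rfl fun m _ => ?_
    rw [Finset.sum_mul]
    have : ∀ i, w m * a m i * star (w i) * w l = if i = l then w m * a m i else 0 := by
      intro i
      rw [mul_assoc (w m * a m i), hw]
      split_ifs
      · rw [mul_assoc, hae]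
      · simp
    simp [this]
  have hVX : V * (∑ k, ∑ l, a k l * F k l) * star V = F o o * y := by
    have h1 : V * (∑ k, ∑ l, a k l * F k l) = ∑ k, ∑ l, w k * a k l * F o l := by
      rw [Finset.mul_sum]
      refine Finset.sum_congr rfl fun k _ => ?_
      rw [Finset.mul_sum]
      refine Finset.sum_congr rfl fun l _ => ?_
      rw [hV, Finset.sum_mul]
      have : ∀ i, F o i * w i * (a k l * F k l) = if i = k then w k * a k l * F o l else 0 := by
        intro i
        calc F o i * w i * (a k l * F k l) = (F o i * w i) * a k l * F k l := by
              simp only [mul_assoc]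
          _ = w i * (F o i * a k l) * F k l := by rw [hwF]; simp only [mul_assoc]
          _ = w i * a k l * (F o i * F k l) := by rw [haF]; simp only [mul_assoc]
          _ = _ := by
            rw [hF.mul]
            split_ifs with h
            · rw [h]
            · simp
      simp [this]
    rw [h1, Finset.sum_mul, hy, Finset.mul_sum]
    refine Finset.sum_congr rfl fun k _ => ?_
    rw [Finset.sum_mul, Finset.mul_sum]
    refine Finset.sum_congr rfl fun l _ => ?_
    rw [hVs, Finset.mul_sum]
    have : ∀ i, w k * a k l * F o l * (star (w i) * F i o) =
        if l = i then F o o * (w k * a k l * star (w l)) else 0 := by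
      intro i
      calc w k * a k l * F o l * (star (w i) * F i o) = w k * a k l * (F o l * star (w i)) * F i o := by
            simp only [mul_assoc]
        _ = w k * a k l * star (w i) * (F o l * F i o) := by rw [hwF']; simp only [mul_assoc]
        _ = _ := by
          rw [hF.mul]
          split_ifs with h
          · rw [h]
            calc w k * a k i * star (w i) * F o o = w k * a k i * (star (w i) * F o o) := by
                  simp only [mul_assoc]
              _ = w k * (a k i * F o o) * star (w i) := by rw [← hwF']; simp only [mul_assoc]
              _ = (w k * F o o) * a k i * star (w i) := by rw [← haF]; simp only [mul_assoc]
              _ = _ := by rw [← hwF]; simp only [mul_assoc]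
          · simp
    simp [this]
  have hyn : ‖y‖ ≤ 1 := by
    refine hF.norm_le o hyF ?_
    rw [← hVX]
    calc _ ≤ ‖V * ∑ k, ∑ l, a k l * F k l‖ * ‖star V‖ := norm_mul_le _ _
      _ ≤ (‖V‖ * ‖∑ k, ∑ l, a k l * F k l‖) * ‖star V‖ := by gcongr; exact norm_mul_le _ _
      _ ≤ (1 * 1) * 1 := by gcongr
      _ = 1 := by norm_num
  have hgy := hg y rfl hyn
  have hT := hconj (y * Q - P * y) (by
    intro i j
    rw [mul_sub, sub_mul]
    congr 1
    · rw [← mul_assoc, hyF, mul_assoc, hQF, mul_assoc]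
    · rw [← mul_assoc, hPF, mul_assoc, hyF, mul_assoc])
  have hfin : (∑ k, ∑ l, F k l * (∑ m, a k m * (star (w m) * Q * w l) -
      ∑ m, (star (w k) * P * w m) * a m l)) = star V * (y * Q - P * y) * V := by
    rw [hT]
    refine Finset.sum_congr rfl fun k _ => Finset.sum_congr rfl fun l _ => ?_
    congr 1
    have : star (w k) * (y * Q - P * y) * w l = (star (w k) * y) * Q * w l -
        star (w k) * P * (y * w l) := by
      simp only [mul_sub, sub_mul, mul_assoc]
    rw [this, hwy, hyw, Finset.sum_mul, Finset.sum_mul, Finset.mul_sum]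
    simp only [mul_assoc]
  rw [hfin]
  have hg0 : 0 ≤ g := (norm_nonneg _).trans hgy
  calc _ ≤ ‖star V * (y * Q - P * y)‖ * ‖V‖ := norm_mul_le _ _
    _ ≤ (‖star V‖ * ‖y * Q - P * y‖) * ‖V‖ := by gcongr; exact norm_mul_le _ _
    _ ≤ (1 * g) * 1 := by gcongr
    _ = g := by ring
end VN15

set_option linter.unusedSectionVars false

section VN16
variable {K : Type*} [NormedAddCommGroup K] [InnerProductSpace ℂ K] [CompleteSpace K]
variable {n : ℕ}

local notation "⟪" x "," y "⟫" => inner ℂ x y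

variable {F : Fin n → Fin n → (K →L[ℂ] K)}

lemma avg_sum [NeZero n] {u : Fin n → Fin n → ℂ}
    (hu : ∀ m l, ∑ t, star (u t m) * u t l = if m = l then (n : ℂ) else 0)
    (v : Fin n → (K →L[ℂ] K)) (T : K →L[ℂ] K) (m l : Fin n) :
    ∑ s, ∑ t, star (u t m • v (m + s)) * T * (u t l • v (l + s)) =
      if m = l then (n : ℂ) • ∑ k, star (v k) * T * v k else 0 := by
  have e : ∀ s t, star (u t m • v (m + s)) * T * (u t l • v (l + s)) =
      (star (u t m) * u t l) • (star (v (m + s)) * T * v (l + s)) := by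
    intro s t
    rw [star_smul, smul_mul_assoc, smul_mul_smul_comm]
  simp only [e, ← Finset.sum_smul, hu]
  split_ifs with h
  · subst h
    rw [← Finset.smul_sum]
    congr 1
    exact Equiv.sum_comp (Equiv.addLeft m) (fun k => star (v k) * T * v k)
  · simp

theorem avg_main [NeZero n] (hF : MU F) {e P Q : K →L[ℂ] K} (he1 : e * e = e) (he2 : star e = e)
    {M : StarSubalgebra ℂ (K →L[ℂ] K)} (hMF : ∀ y ∈ M, ∀ i j, F i j * y = y * F i j)
    (hcen : ∀ y ∈ M, e * y = y * e)
    {g : ℝ} {v : Fin n → (K →L[ℂ] K)} (hvM : ∀ k, v k ∈ M)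
    (hv : ∀ i j, star (v i) * v j = if i = j then e else 0)
    (hPF : ∀ i j, F i j * P = P * F i j) (hQF : ∀ i j, F i j * Q = Q * F i j)
    {a : Fin n → Fin n → (K →L[ℂ] K)} (haM : ∀ k l, a k l ∈ M)
    (hae : ∀ k l, a k l * e = a k l)
    (hX : ‖∑ k, ∑ l, a k l * F k l‖ ≤ 1)
    (hg : ∀ y ∈ M, y * e = y → ‖y‖ ≤ 1 → ‖y * Q - P * y‖ ≤ g)
    (hgQ : ∀ y ∈ M, y * e = y → ‖y‖ ≤ 1 → ‖y * Q - Q * y‖ ≤ g)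
    (hgP : ∀ y ∈ M, y * e = y → ‖y‖ ≤ 1 → ‖y * P - P * y‖ ≤ g) :
    ‖(∑ k, ∑ l, a k l * F k l) * Q - P * ∑ k, ∑ l, a k l * F k l‖ ≤ 3 * g := by
  have hg0 : 0 ≤ g := (norm_nonneg _).trans (hg 0 (zero_mem M) (by simp) (by simp))
  obtain ⟨u, hu1, hu2⟩ := fourier_exists n
  have hea : ∀ k l, e * a k l = a k l := fun k l => by rw [hcen _ (haM k l), hae]
  have hen := norm_proj_le he1 he2
  have hve : ∀ k, v k * e = v k := by
    intro k
    have h1 : star (v k) * v k = e := by rw [hv, if_pos rfl]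
    have : star (v k * e - v k) * (v k * e - v k) = 0 := by
      have : star (v k * e - v k) * (v k * e - v k) = e * (star (v k) * v k) * e - e * (star (v k) * v k)
          - (star (v k) * v k) * e + star (v k) * v k := by
        rw [star_sub, star_mul, he2]; noncomm_ring
      rw [this, h1]; simp [he1]
    exact sub_eq_zero.1 (CStarRing.star_mul_self_eq_zero_iff _ |>.1 this)
  have hvn : ∀ k, ‖v k‖ ≤ 1 := fun k =>
    norm_le_one_of_star_mul (e := e) (by rw [hv, if_pos rfl]) hen
  have hsve : ∀ k, star (v k) * e = star (v k) := by
    intro k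
    have : star (e * v k) = star (v k) := by rw [hcen _ (hvM k), hve]
    rwa [star_mul, he2] at this
  set X : K →L[ℂ] K := ∑ k, ∑ l, a k l * F k l with hXd
  have hXe : X * e = X := by
    have he : e ∈ M := by
      have : star (v 0) * v 0 = e := by rw [hv, if_pos rfl]
      rw [← this]; exact mul_mem (star_mem (hvM 0)) (hvM 0)
    rw [hXd, Finset.sum_mul]
    refine Finset.sum_congr rfl fun k _ => ?_
    rw [Finset.sum_mul]
    refine Finset.sum_congr rfl fun l _ => ?_
    rw [mul_assoc, hMF e he, ← mul_assoc, hae]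
  have heX : e * X = X := by
    rw [hXd, Finset.mul_sum]
    refine Finset.sum_congr rfl fun k _ => ?_
    rw [Finset.mul_sum]
    refine Finset.sum_congr rfl fun l _ => ?_
    rw [← mul_assoc, hea]
  set SQ : K →L[ℂ] K := ∑ k, star (v k) * Q * v k with hSQ
  set SP : K →L[ℂ] K := ∑ k, star (v k) * P * v k with hSP
  have hSPF : ∀ i j, F i j * SP = SP * F i j := by
    intro i j
    rw [hSP, Finset.mul_sum, Finset.sum_mul]
    refine Finset.sum_congr rfl fun k _ => ?_
    calc F i j * (star (v k) * P * v k) = (F i j * star (v k)) * P * v k := by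
          simp only [mul_assoc]
      _ = star (v k) * (F i j * P) * v k := by rw [hMF _ (star_mem (hvM k))]; simp only [mul_assoc]
      _ = star (v k) * P * (F i j * v k) := by rw [hPF]; simp only [mul_assoc]
      _ = _ := by rw [hMF _ (hvM k)]; simp only [mul_assoc]
  -- first part
  have hfirst : ‖X * SQ - SP * X‖ ≤ n * g := by
    have hstep : ∀ s t : Fin n, ‖∑ k, ∑ l, F k l * (∑ m, a k m *
        (star (u t m • v (m + s)) * Q * (u t l • v (l + s))) -
        ∑ m, (star (u t k • v (k + s)) * P * (u t m • v (m + s))) * a m l)‖ ≤ g := by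
      intro s t
      refine avg_step (w := fun k => u t k • v (k + s)) hF 0 he1 he2 ?_ ?_ hPF hQF ?_ hae hea hX ?_
      · intro k i j
        exact hMF _ (SMulMemClass.smul_mem _ (hvM _)) i j
      · intro i j
        simp only [star_smul, smul_mul_smul_comm, hv, add_left_inj]
        split_ifs with h
        · subst h; rw [hu1, one_smul]
        · simp
      · intro k l i j
        exact hMF _ (haM k l) i j
      · intro y hy hyn
        have hwM : ∀ k, u t k • v (k + s) ∈ M := fun k => SMulMemClass.smul_mem _ (hvM _)
        refine hg y ?_ ?_ hyn
        · rw [hy]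
          exact sum_mem fun k _ => sum_mem fun l _ =>
            mul_mem (mul_mem (hwM k) (haM k l)) (star_mem (hwM l))
        · rw [hy, Finset.sum_mul]
          refine Finset.sum_congr rfl fun k _ => ?_
          rw [Finset.sum_mul]
          refine Finset.sum_congr rfl fun l _ => ?_
          rw [mul_assoc, star_smul, smul_mul_assoc (star (u t l)), hsve]
    have hsum : ∑ s, ∑ t, (∑ k, ∑ l, F k l * (∑ m, a k m *
        (star (u t m • v (m + s)) * Q * (u t l • v (l + s))) -
        ∑ m, (star (u t k • v (k + s)) * P * (u t m • v (m + s))) * a m l)) =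
        (n : ℂ) • (X * SQ - SP * X) := by
      have h1 : ∀ k l, ∑ s, ∑ t, F k l * (∑ m, a k m *
          (star (u t m • v (m + s)) * Q * (u t l • v (l + s))) -
          ∑ m, (star (u t k • v (k + s)) * P * (u t m • v (m + s))) * a m l) =
          F k l * ((n : ℂ) • (a k l * SQ - SP * a k l)) := by
        intro k l
        simp only [← Finset.mul_sum, Finset.sum_sub_distrib]
        congr 1
        have p1 : ∑ s, ∑ t, ∑ m, a k m * (star (u t m • v (m + s)) * Q * (u t l • v (l + s))) =
            (n : ℂ) • (a k l * SQ) := by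
          have : ∀ s, ∑ t, ∑ m, a k m * (star (u t m • v (m + s)) * Q * (u t l • v (l + s))) =
            ∑ m, ∑ t, a k m * (star (u t m • v (m + s)) * Q * (u t l • v (l + s))) :=
            fun s => Finset.sum_comm
          simp only [this]
          rw [Finset.sum_comm]
          simp only [← Finset.mul_sum, avg_sum hu2]
          simp [hSQ]
        have p2 : ∑ s, ∑ t, ∑ m, (star (u t k • v (k + s)) * P * (u t m • v (m + s))) * a m l =
            (n : ℂ) • (SP * a k l) := by
          have : ∀ s, ∑ t, ∑ m, (star (u t k • v (k + s)) * P * (u t m • v (m + s))) * a m l =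
            ∑ m, ∑ t, (star (u t k • v (k + s)) * P * (u t m • v (m + s))) * a m l :=
            fun s => Finset.sum_comm
          simp only [this]
          rw [Finset.sum_comm]
          simp only [← Finset.sum_mul, avg_sum hu2]
          simp [hSP]
        rw [p1, p2, smul_sub]
      have h2 : ∀ s : Fin n, ∑ t, (∑ k, ∑ l, F k l * (∑ m, a k m *
          (star (u t m • v (m + s)) * Q * (u t l • v (l + s))) -
          ∑ m, (star (u t k • v (k + s)) * P * (u t m • v (m + s))) * a m l)) =
          ∑ k, ∑ l, ∑ t, F k l * (∑ m, a k m *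
          (star (u t m • v (m + s)) * Q * (u t l • v (l + s))) -
          ∑ m, (star (u t k • v (k + s)) * P * (u t m • v (m + s))) * a m l) := by
        intro s
        rw [Finset.sum_comm]
        exact Finset.sum_congr rfl fun k _ => Finset.sum_comm
      rw [Finset.sum_congr rfl fun s _ => h2 s, Finset.sum_comm]
      rw [Finset.sum_congr rfl fun k _ => Finset.sum_comm]
      simp only [h1]
      simp only [mul_smul_comm, ← Finset.smul_sum]
      congr 1
      rw [hXd, Finset.sum_mul, Finset.mul_sum, ← Finset.sum_sub_distrib]
      refine Finset.sum_congr rfl fun k _ => ?_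
      rw [Finset.sum_mul, Finset.mul_sum, ← Finset.sum_sub_distrib]
      refine Finset.sum_congr rfl fun l _ => ?_
      rw [mul_sub, ← mul_assoc, hMF _ (haM k l), ← mul_assoc, hSPF, mul_assoc SP, hMF _ (haM k l)]
    have hle : ‖(n : ℂ) • (X * SQ - SP * X)‖ ≤ n * (n * g) := by
      rw [← hsum]
      refine (norm_sum_le_of_le (n := fun _ => (n : ℝ) * g) Finset.univ fun s _ => ?_).trans (by simp)
      refine (norm_sum_le_of_le (n := fun _ => g) Finset.univ fun t _ => hstep s t).trans (by simp)
    rw [norm_smul, Complex.norm_natCast] at hle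
    exact le_of_mul_le_mul_left hle (by exact_mod_cast Nat.pos_of_ne_zero (NeZero.ne n))
  have hsecond : ‖(n : ℂ) • (e * Q) - SQ‖ ≤ n * g := by
    have : (n : ℂ) • (e * Q) - SQ = ∑ k, star (v k) * (v k * Q - Q * v k) := by
      simp only [mul_sub, ← mul_assoc, Finset.sum_sub_distrib, ← hSQ]
      congr 1
      simp only [hv, if_true]
      simp
      exact Nat.cast_smul_eq_nsmul ℂ n _
    rw [this]
    refine (norm_sum_le_of_le (n := fun _ => g) Finset.univ fun k _ => ?_).trans (by simp)
    calc _ ≤ ‖star (v k)‖ * ‖v k * Q - Q * v k‖ := norm_mul_le _ _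
      _ ≤ 1 * g := by
        gcongr
        · rw [norm_star]; exact hvn k
        · exact hgQ _ (hvM k) (hve k) (hvn k)
      _ = g := one_mul g
  have hthird : ‖(n : ℂ) • (P * e) - SP‖ ≤ n * g := by
    have : (n : ℂ) • (P * e) - SP = ∑ k, (P * star (v k) - star (v k) * P) * v k := by
      simp only [sub_mul, Finset.sum_sub_distrib, ← hSP]
      congr 1
      simp only [mul_assoc, hv, if_true]
      simp
      exact Nat.cast_smul_eq_nsmul ℂ n _
    rw [this]
    refine (norm_sum_le_of_le (n := fun _ => g) Finset.univ fun k _ => ?_).trans (by simp)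
    calc _ ≤ ‖P * star (v k) - star (v k) * P‖ * ‖v k‖ := norm_mul_le _ _
      _ ≤ g * 1 := by
        gcongr
        · rw [norm_sub_rev]
          exact hgP _ (star_mem (hvM k)) (hsve k) (by rw [norm_star]; exact hvn k)
        · exact hvn k
      _ = g := mul_one g
  have hdec : (n : ℂ) • (X * Q - P * X) = (X * SQ - SP * X) + X * ((n : ℂ) • (e * Q) - SQ) -
      ((n : ℂ) • (P * e) - SP) * X := by
    have h1 : X * (e * Q) = X * Q := by rw [← mul_assoc, hXe]
    have h2 : P * e * X = P * X := by rw [mul_assoc, heX]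
    rw [mul_sub, sub_mul, mul_smul_comm, smul_mul_assoc, h1, h2, smul_sub]; abel
  have hle : ‖(n : ℂ) • (X * Q - P * X)‖ ≤ n * (3 * g) := by
    rw [hdec]
    calc _ ≤ ‖X * SQ - SP * X‖ + ‖X * ((n : ℂ) • (e * Q) - SQ)‖ +
          ‖((n : ℂ) • (P * e) - SP) * X‖ :=
          (norm_sub_le _ _).trans (by gcongr; exact norm_add_le _ _)
      _ ≤ n * g + 1 * (n * g) + (n * g) * 1 := by
        gcongr
        · exact (norm_mul_le _ _).trans (by gcongr)
        · exact (norm_mul_le _ _).trans (by gcongr)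
      _ = _ := by ring
  rw [norm_smul, Complex.norm_natCast] at hle
  exact le_of_mul_le_mul_left hle (by exact_mod_cast Nat.pos_of_ne_zero (NeZero.ne n))
end VN16

set_option linter.unusedSectionVars false

section VN17
universe u
variable {E : Type*} [NormedAddCommGroup E] [NormedSpace ℂ E]

lemma dist_functional (S : Submodule ℂ E) (x : E) {r : ℝ} (hr : ∀ y ∈ S, r ≤ ‖x - y‖) :
    ∃ φ : E →ₗ[ℂ] ℂ, (∀ z, ‖φ z‖ ≤ ‖z‖) ∧ (∀ y ∈ S, φ y = 0) ∧ r ≤ ‖φ x‖ := by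
  obtain ⟨g, hg1, hg2⟩ := exists_dual_vector'' ℂ (Submodule.Quotient.mk (p := S) x)
  refine ⟨(g : (E ⧸ S) →ₗ[ℂ] ℂ).comp S.mkQ, ?_, ?_, ?_⟩
  · intro z
    have h1 : ‖(Submodule.Quotient.mk z : E ⧸ S)‖ ≤ ‖z‖ := QuotientAddGroup.norm_mk_le_norm (S := S.toAddSubgroup)
    calc ‖g (Submodule.Quotient.mk z)‖ ≤ ‖g‖ * ‖(Submodule.Quotient.mk z : E ⧸ S)‖ := g.le_opNorm _
      _ ≤ 1 * ‖z‖ := by gcongr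
      _ = ‖z‖ := one_mul _
  · intro y hy
    change g (Submodule.Quotient.mk y) = 0
    rw [(Submodule.Quotient.mk_eq_zero S).2 hy, map_zero]
  · change r ≤ ‖g (Submodule.Quotient.mk x)‖
    rw [hg2]
    have e : ‖(Submodule.Quotient.mk x : E ⧸ S)‖ = infDist x (S : Set E) :=
      QuotientAddGroup.norm_mk (S := S.toAddSubgroup) x
    rw [RCLike.norm_ofReal, abs_norm, e]
    refine (le_infDist ⟨0, zero_mem S⟩).2 fun y hy => ?_
    rw [dist_eq_norm]; exact hr y hy

variable {K : Type*} [NormedAddCommGroup K] [InnerProductSpace ℂ K] [CompleteSpace K]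

lemma norm_refl_le {P : K →L[ℂ] K} (h1 : P * P = P) (h2 : star P = P) :
    ‖(2 : ℂ) • P - 1‖ ≤ 1 := by
  refine norm_le_one_of_star_mul (e := 1) ?_ ?_
  · have h3 : star (2 : ℂ) = 2 := by simp
    rw [star_sub, star_smul, h2, star_one, h3]
    simp only [sub_mul, mul_sub, smul_mul_smul_comm, h1, mul_one, one_mul]
    module
  · exact ContinuousLinearMap.norm_id_le

lemma norm_proj_comm_le {P Q c : K →L[ℂ] K} (hP1 : P * P = P) (hP2 : star P = P)
    (hQ1 : Q * Q = Q) (hQ2 : star Q = Q) : ‖c * Q - P * c‖ ≤ ‖c‖ := by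
  have e : (2 : ℂ) • (c * Q - P * c) = c * ((2 : ℂ) • Q - 1) - ((2 : ℂ) • P - 1) * c := by
    simp only [sub_mul, mul_sub, smul_mul_assoc, mul_smul_comm, mul_one, one_mul]
    module
  have h : ‖(2 : ℂ) • (c * Q - P * c)‖ ≤ 2 * ‖c‖ := by
    rw [e]
    calc _ ≤ ‖c * ((2 : ℂ) • Q - 1)‖ + ‖((2 : ℂ) • P - 1) * c‖ := norm_sub_le _ _
      _ ≤ ‖c‖ * ‖(2 : ℂ) • Q - 1‖ + ‖(2 : ℂ) • P - 1‖ * ‖c‖ := by gcongr <;> exact norm_mul_le _ _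
      _ ≤ ‖c‖ * 1 + 1 * ‖c‖ := by
        gcongr
        · exact norm_refl_le hQ1 hQ2
        · exact norm_refl_le hP1 hP2
      _ = _ := by ring
  rw [norm_smul] at h
  norm_num at h
  exact h

variable {H : Type u} [NormedAddCommGroup H] [InnerProductSpace ℂ H] [CompleteSpace H]

local notation "⟪" x "," y "⟫" => inner ℂ x y

lemma mun_MU {n : ℕ} (π : (PiLp 2 (fun _ : Fin n => H) →L[ℂ] PiLp 2 (fun _ : Fin n => H)) →⋆ₐ[ℂ]
    (K →L[ℂ] K)) : MU (fun i j => π (mun H i j)) where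
  mul i j k l := by rw [← map_mul, mun_mul]; split_ifs <;> simp
  st i j := by rw [← map_star, mun_star]
  sum := by rw [← map_sum, mun_sum, map_one]

lemma mun_bic_comm {n : ℕ} (A : NonUnitalStarSubalgebra ℂ (H →L[ℂ] H))
    (π : (PiLp 2 (fun _ : Fin n => H) →L[ℂ] PiLp 2 (fun _ : Fin n => H)) →⋆ₐ[ℂ] (K →L[ℂ] K))
    {y : K →L[ℂ] K} (hy : y ∈ bic A (π.comp (dgH H n))) (i j : Fin n) :
    π (mun H i j) * y = y * π (mun H i j) := by
  refine bic_comm A _ hy fun a _ => ?_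
  change π (dgo a) * π (mun H i j) = π (mun H i j) * π (dgo a)
  rw [← map_mul, ← map_mul, dgo_mun]

lemma pi_eq_sum {n : ℕ}
    (π : (PiLp 2 (fun _ : Fin n => H) →L[ℂ] PiLp 2 (fun _ : Fin n => H)) →⋆ₐ[ℂ] (K →L[ℂ] K))
    (x : PiLp 2 (fun _ : Fin n => H) →L[ℂ] PiLp 2 (fun _ : Fin n => H)) :
    π x = ∑ k, ∑ l, (π.comp (dgH H n)) (ent x k l) * π (mun H k l) := by
  conv_lhs => rw [eq_sum_ent x]
  simp only [map_sum, map_mul]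
  rfl

theorem dist_main {n : ℕ} [NeZero n] (A B : NonUnitalStarSubalgebra ℂ (H →L[ℂ] H))
    (hAc : IsClosed (A : Set (H →L[ℂ] H)))
    (hA : ∀ τ : A → ℂ, IsBoundedTrace A τ → τ = 0) {g : ℝ}
    (hAB : ∀ a ∈ A, ‖a‖ ≤ 1 → ∃ b ∈ B, ‖a - b‖ ≤ g)
    {x : PiLp 2 (fun _ : Fin n => H) →L[ℂ] PiLp 2 (fun _ : Fin n => H)} (hx : x ∈ matAlg n A)
    (hx1 : ‖x‖ ≤ 1) {r : ℝ} (hr : 3 * g < r) : ∃ y ∈ matAlg n B, ‖x - y‖ < r := by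
  by_contra hcon
  push Not at hcon
  obtain ⟨φ, hφ1, hφ2, hφ3⟩ := dist_functional (matAlg n B).toSubmodule x hcon
  obtain ⟨L, _, _, _, π, ξ, Ω, hξ, hΩ, hφ⟩ := func_rep φ hφ1
  set ρ : (H →L[ℂ] H) →⋆ₐ[ℂ] (L →L[ℂ] L) := π.comp (dgH H n) with hρ
  have hρa : ∀ a, ρ a = π (dgo a) := fun _ => rfl
  let T : (PiLp 2 (fun _ : Fin n => H) →L[ℂ] PiLp 2 (fun _ : Fin n => H)) →ₗ[ℂ] L :=
      { toFun := fun x => π x ξ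
        map_add' := fun x y => by simp
        map_smul' := fun c x => by simp }
  set V : Submodule ℂ L := (matAlg n B).toSubmodule.map T with hV
  have hVmem : ∀ y ∈ matAlg n B, π y ξ ∈ V := fun y hy => ⟨y, hy, rfl⟩
  set P := cproj V with hP
  set f := suppP B ρ with hf
  set Q := P + 1 - f with hQ
  have hP1 : P * P = P := cproj_mul_self _
  have hP2 : star P = P := cproj_star _
  have hf1 : f * f = f := supp_idem B ρ
  have hf2 : star f = f := supp_star B ρ
  have hPF : ∀ i j, π (mun H i j) * P = P * π (mun H i j) := by
    intro i j
    refine cproj_comm _ _ ?_ ?_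
    · rintro _ ⟨y, hy, rfl⟩
      change π (mun H i j) (π y ξ) ∈ V
      rw [← mulA, ← map_mul]
      exact hVmem _ (mun_mul_mem hy i j)
    · rintro _ ⟨y, hy, rfl⟩
      change star (π (mun H i j)) (π y ξ) ∈ V
      rw [← map_star, mun_star, ← mulA, ← map_mul]
      exact hVmem _ (mun_mul_mem hy j i)
  have hbP : ∀ b ∈ B, ρ b * P = P * ρ b := by
    intro b hb
    refine cproj_comm _ _ ?_ ?_
    · rintro _ ⟨y, hy, rfl⟩
      change ρ b (π y ξ) ∈ V
      rw [hρa, ← mulA, ← map_mul]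
      exact hVmem _ (mul_mem (dgo_mem hb) hy)
    · rintro _ ⟨y, hy, rfl⟩
      change star (ρ b) (π y ξ) ∈ V
      rw [← map_star, hρa, ← mulA, ← map_mul]
      exact hVmem _ (mul_mem (dgo_mem (star_mem hb)) hy)
  have hfF : ∀ i j, π (mun H i j) * f = f * π (mun H i j) :=
    fun i j => mun_bic_comm B π (supp_mem B ρ) i j
  have hfπ : ∀ y ∈ matAlg n B, f * π y = π y := by
    intro y hy
    rw [pi_eq_sum π y, Finset.mul_sum]
    refine Finset.sum_congr rfl fun k _ => ?_
    rw [Finset.mul_sum]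
    refine Finset.sum_congr rfl fun l _ => ?_
    rw [← mul_assoc, ← hρ, supp_mul B ρ (mem_matAlg.1 hy k l)]
  have hfP : f * P = P := by
    have : f * P = 1 * P := by
      refine mul_cproj_ext ?_
      rintro _ ⟨y, hy, rfl⟩
      change f (π y ξ) = π y ξ
      rw [← mulA, hfπ y hy]
    rwa [one_mul] at this
  have hPf : P * f = P := by
    have := congrArg star hfP
    rwa [star_mul, hP2, hf2] at this
  have hQ1 : Q * Q = Q := by
    rw [hQ]
    simp only [sub_mul, mul_sub, add_mul, mul_add, hP1, hPf, hfP, hf1, one_mul, mul_one]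
    abel
  have hQ2 : star Q = Q := by rw [hQ]; simp [star_add, star_sub, hP2, hf2]
  have hQF : ∀ i j, π (mun H i j) * Q = Q * π (mun H i j) := by
    intro i j
    rw [hQ]
    simp only [sub_mul, mul_sub, add_mul, mul_add, one_mul, mul_one, hPF, hfF]
  have hbQ : ∀ b ∈ B, ρ b * Q = P * ρ b := by
    intro b hb
    rw [hQ]
    simp only [mul_sub, mul_add, mul_one, mul_supp B ρ hb, hf, hbP b hb]; abel
  have hQb : ∀ b ∈ B, Q * ρ b = P * ρ b := by
    intro b hb
    rw [hQ]
    simp only [sub_mul, add_mul, one_mul, supp_mul B ρ hb, hf]; abel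
  have hPΩ : P Ω = 0 := by
    refine cproj_apply_zero ?_
    rintro _ ⟨y, hy, rfl⟩
    have := hφ2 y hy
    rw [hφ] at this
    rw [← inner_conj_symm]
    change (starRingEnd ℂ) ⟪Ω, π y ξ⟫ = 0
    rw [this, map_zero]
  have hQξ : Q ξ = ξ := by
    have h0 : f (ξ - P ξ) = 0 := by
      refine supp_apply_zero B ρ fun b hb => ?_
      have h1 : ρ b (P ξ) = P (ρ b ξ) := by rw [← mulA, hbP b hb, mulA]
      have h2 : P (ρ b ξ) = ρ b ξ := cproj_apply_mem (hVmem _ (dgo_mem hb))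
      rw [map_sub, h1, h2, sub_self]
    have h1 : f (P ξ) = P ξ := by rw [← mulA, hfP]
    rw [map_sub, h1] at h0
    rw [hQ]
    simp only [sub_apply, add_apply]
    rw [sub_eq_zero.1 h0]
    simp
  -- estimates
  have near : ∀ (P' Q' : L →L[ℂ] L), P' * P' = P' → star P' = P' → Q' * Q' = Q' → star Q' = Q' →
      (∀ b ∈ B, ρ b * Q' = P' * ρ b) → ∀ y ∈ bic A ρ, y * suppP A ρ = y → ‖y‖ ≤ 1 →
      ‖y * Q' - P' * y‖ ≤ g := by
    intro P' Q' p1 p2 q1 q2 hb y hy hye hy1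
    refine kap_ineq A ρ hAc ?_ hy hye hy1
    intro a ha ha1
    obtain ⟨b, hbB, hab⟩ := hAB a ha ha1
    have e : ρ a * Q' - P' * ρ a = ρ (a - b) * Q' - P' * ρ (a - b) := by
      rw [map_sub, sub_mul, mul_sub, hb b hbB]; abel
    rw [e]
    refine (norm_proj_comm_le p1 p2 q1 q2).trans ?_
    exact (NonUnitalStarAlgHom.norm_apply_le ρ (a - b)).trans hab
  obtain ⟨v, hvM, hv⟩ := exists_pi_family A hA ρ n
  have hX := pi_eq_sum π x
  have hmain := avg_main (mun_MU π) (supp_idem A ρ) (supp_star A ρ)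
    (M := bic A ρ) (fun y hy i j => mun_bic_comm A π hy i j)
    (fun y hy => supp_bic_comm A ρ hy) hvM hv hPF hQF
    (a := fun k l => ρ (ent x k l))
    (fun k l => bic_of_mem A ρ (mem_matAlg.1 hx k l))
    (fun k l => mul_supp A ρ (mem_matAlg.1 hx k l))
    (by rw [hρ, ← hX]; exact (NonUnitalStarAlgHom.norm_apply_le π x).trans hx1)
    (near P Q hP1 hP2 hQ1 hQ2 hbQ)
    (near Q Q hQ1 hQ2 hQ1 hQ2 fun b hb => by rw [hbQ b hb, hQb b hb])
    (near P P hP1 hP2 hP1 hP2 hbP)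
  rw [hρ, ← hX] at hmain
  have hfin : φ x = ⟪Ω, (π x * Q - P * π x) ξ⟫ := by
    rw [hφ, sub_apply, mulA, mulA, hQξ, inner_sub_right, ← hP2, inner_star_right, hPΩ,
      inner_zero_left, sub_zero]
  have : ‖φ x‖ ≤ 3 * g := by
    rw [hfin]
    calc _ ≤ ‖Ω‖ * ‖(π x * Q - P * π x) ξ‖ := norm_inner_le_norm _ _
      _ ≤ ‖Ω‖ * (‖π x * Q - P * π x‖ * ‖ξ‖) := by gcongr; exact ContinuousLinearMap.le_opNorm _ _
      _ ≤ 1 * (‖π x * Q - P * π x‖ * 1) := by gcongr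
      _ ≤ 3 * g := by linarith
  linarith
end VN17

set_option linter.unusedSectionVars false

section VN18
variable {H : Type*} [NormedAddCommGroup H] [InnerProductSpace ℂ H] [CompleteSpace H]

local notation "⟪" x "," y "⟫" => inner ℂ x y

lemma sa_decomp {B : NonUnitalStarSubalgebra ℂ (H →L[ℂ] H)} (hB : IsClosed (B : Set (H →L[ℂ] H)))
    {h : H →L[ℂ] H} (hh : h ∈ B) (hs : star h = h) {t : ℝ} (ht : 0 ≤ t)
    (hle : -(t • (1 : H →L[ℂ] H)) ≤ h) :
    ∃ r ∈ B, ∃ s ∈ B, star r = r ∧ star s = s ∧ h = r * r - s * s ∧ ‖s * s‖ ≤ t := by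
  have hsa : IsSelfAdjoint h := hs
  have h1 : cfcₙ (fun x : ℝ => √(max x 0)) h ∈ B := cfcₙ_mem (𝕜' := ℂ) (hs := hB) _ hh
  have h2 : cfcₙ (fun x : ℝ => √(max (-x) 0)) h ∈ B := cfcₙ_mem (𝕜' := ℂ) (hs := hB) _ hh
  rw [cfcₙ_eq_cfc (by fun_prop) (by simp)] at h1 h2
  have e2 : cfc (fun x : ℝ => √(max (-x) 0)) h * cfc (fun x : ℝ => √(max (-x) 0)) h =
      cfc (fun x : ℝ => max (-x) 0) h := by
    rw [← cfc_mul (fun x : ℝ => √(max (-x) 0)) (fun x : ℝ => √(max (-x) 0)) h]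
    congr 1
    funext x
    exact Real.mul_self_sqrt (le_max_right _ _)
  have e1 : cfc (fun x : ℝ => √(max x 0)) h * cfc (fun x : ℝ => √(max x 0)) h =
      cfc (fun x : ℝ => max x 0) h := by
    rw [← cfc_mul (fun x : ℝ => √(max x 0)) (fun x : ℝ => √(max x 0)) h]
    congr 1
    funext x
    exact Real.mul_self_sqrt (le_max_right _ _)
  refine ⟨_, h1, _, h2, ?_, ?_, ?_, ?_⟩
  · exact cfc_predicate (R := ℝ) (p := IsSelfAdjoint) _ h
  · exact cfc_predicate (R := ℝ) (p := IsSelfAdjoint) _ h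
  · rw [e1, e2, ← cfc_sub (fun x : ℝ => max x 0) (fun x : ℝ => max (-x) 0) h]
    conv_lhs => rw [← cfc_id ℝ h]
    congr 1
    funext x
    rcases le_total 0 x with hx | hx
    · simp [hx]
    · simp [hx]
  · rw [e2]
    refine norm_cfc_le ht fun x hx => ?_
    have h3 : algebraMap ℝ (H →L[ℂ] H) (-t) ≤ h := by
      rw [Algebra.algebraMap_eq_smul_one, neg_smul]; exact hle
    have h4 := (algebraMap_le_iff_le_spectrum hsa).1 h3 x hx
    rw [Real.norm_eq_abs, abs_of_nonneg (le_max_right _ _)]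
    exact max_le (by linarith) ht

lemma trace_ext {B : NonUnitalStarSubalgebra ℂ (H →L[ℂ] H)} (hB : IsClosed (B : Set (H →L[ℂ] H)))
    {τ : B → ℂ} (hτ : IsBoundedTrace B τ) :
    ∃ f : (H →L[ℂ] H) →ₗ[ℝ] ℝ, (∀ x, 0 ≤ f (star x * x)) ∧ (∀ h, star h = -h → f h = 0) ∧
      ∀ b (hb : b ∈ B), f b = (τ ⟨b, hb⟩).re := by
  obtain ⟨tadd, tsmul, -, tpos, C₀, hC₀⟩ := hτ
  set C := max C₀ 0 with hCd
  have hC0 : 0 ≤ C := le_max_right _ _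
  have hC : ∀ x : B, ‖τ x‖ ≤ C * ‖(x : H →L[ℂ] H)‖ := fun x =>
    (hC₀ x).trans (by gcongr; exact le_max_left _ _)
  have tsub : ∀ x y : B, τ (x - y) = τ x - τ y := by
    intro x y
    have h1 := tadd (x - y) y
    rw [sub_add_cancel] at h1
    rw [h1]; ring
  have lower : ∀ h (hh : h ∈ B), star h = h → ∀ t : ℝ, 0 ≤ t → -(t • (1 : H →L[ℂ] H)) ≤ h →
      (τ ⟨h, hh⟩).im = 0 ∧ -(C * t) ≤ (τ ⟨h, hh⟩).re := by
    intro h hh hs t ht hle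
    obtain ⟨r, hr, s, hsB, rs, ss, e, hn⟩ := sa_decomp hB hh hs ht hle
    have e' : (⟨h, hh⟩ : B) = star (⟨r, hr⟩ : B) * ⟨r, hr⟩ - star (⟨s, hsB⟩ : B) * ⟨s, hsB⟩ := by
      apply Subtype.ext
      change h = star r * r - star s * s
      rw [rs, ss, e]
    have p1 := tpos ⟨r, hr⟩
    have p2 := tpos ⟨s, hsB⟩
    rw [Complex.le_def] at p1 p2
    have n2 := hC (star (⟨s, hsB⟩ : B) * ⟨s, hsB⟩)
    have n3 : ‖((star (⟨s, hsB⟩ : B) * ⟨s, hsB⟩ : B) : H →L[ℂ] H)‖ ≤ t := by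
      change ‖star s * s‖ ≤ t
      rw [ss]; exact hn
    have n4 := Complex.re_le_norm (τ (star (⟨s, hsB⟩ : B) * ⟨s, hsB⟩))
    have n5 := mul_le_mul_of_nonneg_left n3 hC0
    rw [e', tsub, Complex.sub_im, Complex.sub_re, ← p1.2, ← p2.2]
    refine ⟨by simp, ?_⟩
    have := p1.1
    simp only [Complex.zero_re] at this
    linarith
  -- real part on B
  have reform : ∀ b (hb : b ∈ B), ∀ t : ℝ, 0 ≤ t → -((2 * t) • (1 : H →L[ℂ] H)) ≤ b + star b →
      -(C * t) ≤ (τ ⟨b, hb⟩).re := by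
    intro b hb t ht hle
    set h : H →L[ℂ] H := (1 / 2 : ℂ) • (b + star b) with hh
    set k : H →L[ℂ] H := (-Complex.I / 2) • (b - star b) with hk
    have hhB : h ∈ B := SMulMemClass.smul_mem _ (add_mem hb (star_mem hb))
    have hkB : k ∈ B := SMulMemClass.smul_mem _ (sub_mem hb (star_mem hb))
    have hhs : star h = h := by
      rw [hh, star_smul, star_add, star_star, add_comm]; congr 1; simp
    have hks : star k = k := by
      rw [hk, star_smul, star_sub, star_star, ← neg_sub b, smul_neg, ← neg_smul]; congr 1; simp; ring
    have e : (⟨b, hb⟩ : B) = ⟨h, hhB⟩ + Complex.I • ⟨k, hkB⟩ := by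
      apply Subtype.ext
      change b = h + Complex.I • k
      rw [hh, hk, smul_smul]
      have : Complex.I * (-Complex.I / 2) = 1 / 2 := by
        have := Complex.I_mul_I
        linear_combination (-1 / 2 : ℂ) * this
      rw [this]; module
    have l1 := lower h hhB hhs t ht (by
      have := smul_le_smul_of_nonneg_left hle (show (0 : ℝ) ≤ 1 / 2 by norm_num)
      have e1 : (1 / 2 : ℝ) • (-((2 * t) • (1 : H →L[ℂ] H))) = -(t • 1) := by module
      have e2 : (1 / 2 : ℝ) • (b + star b) = h := by
        rw [hh, ← Complex.coe_smul]; norm_num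
      rwa [e1, e2] at this)
    have l2 := lower k hkB hks ‖k‖ (norm_nonneg _) (by
      have := (show IsSelfAdjoint k from hks).neg_algebraMap_norm_le_self
      rwa [Algebra.algebraMap_eq_smul_one] at this)
    rw [e, tadd, tsmul]
    simp only [Complex.add_re, Complex.mul_re, Complex.I_re, Complex.I_im, l2.1]
    linarith [l1.2]
  let E := (H →L[ℂ] H) × ℝ
  let s : PointedCone ℝ ((H →L[ℂ] H) × ℝ) :=
    { carrier := {p | 0 ≤ p.2 ∧ -((2 * p.2) • (1 : H →L[ℂ] H)) ≤ p.1 + star p.1}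
      add_mem' := by
        rintro ⟨x, a⟩ ⟨y, b⟩ ⟨ha, hx⟩ ⟨hb, hy⟩
        refine ⟨add_nonneg ha hb, ?_⟩
        have := add_le_add hx hy
        dsimp only at this ⊢
        have e1 : -((2 * (a + b)) • (1 : H →L[ℂ] H)) = -((2 * a) • 1) + -((2 * b) • 1) := by module
        have e2 : (x + y) + star (x + y) = (x + star x) + (y + star y) := by rw [star_add]; abel
        rw [Prod.mk_add_mk]
        dsimp only
        rwa [e1, e2]
      zero_mem' := by
        refine ⟨le_rfl, ?_⟩
        simp
      smul_mem' := by
        rintro ⟨c, hc⟩ ⟨x, a⟩ ⟨ha, hx⟩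
        refine ⟨mul_nonneg hc ha, ?_⟩
        have := smul_le_smul_of_nonneg_left hx hc
        change -((2 * (c * a)) • (1 : H →L[ℂ] H)) ≤ c • x + star (c • x)
        have e1 : -((2 * (c * a)) • (1 : H →L[ℂ] H)) = c • -((2 * a) • 1) := by module
        have e2 : c • x + star (c • x) = c • (x + star x) := by
          rw [star_smul, star_trivial, smul_add]
        rw [e1, e2]; exact this }
  let D : Submodule ℝ ((H →L[ℂ] H) × ℝ) :=
    { carrier := {p | p.1 ∈ B}
      add_mem' := fun hx hy => add_mem (S := NonUnitalStarSubalgebra ℂ (H →L[ℂ] H)) hx hy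
      zero_mem' := zero_mem B
      smul_mem' := fun c x hx => real_smul_memA B hx c }
  let F : ((H →L[ℂ] H) × ℝ) →ₗ.[ℝ] ℝ :=
    { domain := D
      toFun :=
        { toFun := fun p => (τ ⟨p.1.1, p.2⟩).re + C * p.1.2
          map_add' := by
            rintro ⟨⟨x, a⟩, hx⟩ ⟨⟨y, b⟩, hy⟩
            have := tadd ⟨x, hx⟩ ⟨y, hy⟩
            change (τ (⟨x, hx⟩ + ⟨y, hy⟩)).re + C * (a + b) =
              (τ ⟨x, hx⟩).re + C * a + ((τ ⟨y, hy⟩).re + C * b)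
            rw [this, Complex.add_re]; ring
          map_smul' := by
            rintro c ⟨⟨x, a⟩, hx⟩
            have h1 := tsmul (c : ℂ) ⟨x, hx⟩
            have h2 : ((c : ℂ) • (⟨x, hx⟩ : B)) = ⟨c • x, real_smul_memA B hx c⟩ := by
              apply Subtype.ext
              change (c : ℂ) • x = c • x
              simp
            rw [h2] at h1
            change (τ ⟨c • x, real_smul_memA B hx c⟩).re + C * (c * a) =
              c * ((τ ⟨x, hx⟩).re + C * a)
            rw [h1, Complex.re_ofReal_mul]; ring } }
  obtain ⟨G, hG1, hG2⟩ := riesz_extension s F (by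
    rintro ⟨⟨x, a⟩, hx⟩ ⟨ha, hle⟩
    have := reform x hx a ha hle
    change 0 ≤ (τ ⟨x, hx⟩).re + C * a
    linarith) (by
    rintro ⟨y, a⟩
    refine ⟨⟨(0, |a| + ‖y‖), zero_mem B⟩, ?_, ?_⟩
    · change 0 ≤ |a| + ‖y‖ + a
      have := neg_abs_le a
      have := norm_nonneg y
      linarith
    · change -((2 * (|a| + ‖y‖ + a)) • (1 : H →L[ℂ] H)) ≤ (0 + y) + star (0 + y)
      rw [zero_add]
      have h1 := (IsSelfAdjoint.add_star_self y).neg_algebraMap_norm_le_self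
      rw [Algebra.algebraMap_eq_smul_one] at h1
      refine le_trans ?_ h1
      refine neg_le_neg (smul_le_smul_of_nonneg_right ?_ zero_le_one)
      have h2 := norm_add_le y (star y)
      rw [norm_star] at h2
      have := neg_abs_le a
      linarith)
  refine ⟨G.comp (LinearMap.inl ℝ _ ℝ), ?_, ?_, ?_⟩
  · intro x
    refine hG2 _ ⟨le_rfl, ?_⟩
    change -((2 * (0 : ℝ)) • (1 : H →L[ℂ] H)) ≤ star x * x + star (star x * x)
    rw [star_mul, star_star]
    simp only [mul_zero, zero_smul, neg_zero]
    exact add_nonneg (star_mul_self_nonneg x) (star_mul_self_nonneg x)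
  · intro h hh
    have key : ∀ k : H →L[ℂ] H, star k = -k → 0 ≤ G (k, 0) := by
      intro k hk
      refine hG2 _ ⟨le_rfl, ?_⟩
      change -((2 * (0 : ℝ)) • (1 : H →L[ℂ] H)) ≤ k + star k
      simp [hk]
    have h1 := key h hh
    have h2 := key (-h) (by rw [star_neg, hh])
    have h3 : ((-h, 0) : (H →L[ℂ] H) × ℝ) = -(h, 0) := by simp
    rw [h3, map_neg] at h2
    change G (h, 0) = 0
    linarith
  · intro b hb
    have := hG1 ⟨(b, 0), hb⟩
    change G (b, 0) = _
    refine this.trans ?_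
    change (τ ⟨b, hb⟩).re + C * 0 = _
    simp
end VN18

set_option linter.unusedSectionVars false

section VN19
universe u
variable {K : Type*} [NormedAddCommGroup K] [InnerProductSpace ℂ K] [CompleteSpace K]
variable {H : Type u} [NormedAddCommGroup H] [InnerProductSpace ℂ H] [CompleteSpace H]

local notation "⟪" x "," y "⟫" => inner ℂ x y

lemma supp_mul_zero (A : NonUnitalStarSubalgebra ℂ (H →L[ℂ] H))
    (ρ : (H →L[ℂ] H) →⋆ₐ[ℂ] (K →L[ℂ] K)) {x : K →L[ℂ] K} (h : ∀ a ∈ A, ρ a * x = 0) :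
    suppP A ρ * x = 0 := by
  refine ContinuousLinearMap.ext fun u => ?_
  rw [mulA]
  refine supp_apply_zero A ρ fun a ha => ?_
  rw [← mulA, h a ha]; rfl

lemma mul_supp_zero (A : NonUnitalStarSubalgebra ℂ (H →L[ℂ] H))
    (ρ : (H →L[ℂ] H) →⋆ₐ[ℂ] (K →L[ℂ] K)) {x : K →L[ℂ] K} (h : ∀ a ∈ A, x * ρ a = 0) :
    x * suppP A ρ = 0 := by
  have := supp_mul_zero A ρ (x := star x) fun a ha => by
    have := congrArg star (h _ (star_mem ha))
    rwa [star_mul, ← map_star, star_star, star_zero] at this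
  have := congrArg star this
  rwa [star_mul, star_star, supp_star, star_zero] at this

lemma row_approx {n : ℕ} (A : NonUnitalStarSubalgebra ℂ (H →L[ℂ] H))
    (hAc : IsClosed (A : Set (H →L[ℂ] H)))
    (hA : ∀ τ : A → ℂ, IsBoundedTrace A τ → τ = 0) (o : Fin n)
    (π : (PiLp 2 (fun _ : Fin n => H) →L[ℂ] PiLp 2 (fun _ : Fin n => H)) →⋆ₐ[ℂ] (K →L[ℂ] K))
    {Ω : K} (hΩ : π (mun H o o) Ω = Ω) {ε : ℝ} (hε : 0 < ε) :
    ∃ a ∈ matAlg n A, ‖a‖ ≤ 1 ∧ ∀ k,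
      ‖suppP A (π.comp (dgH H n)) Ω‖ - ε ≤ ‖π (mun H o o) (π a (π (mun H k o) Ω))‖ := by
  set ρ : (H →L[ℂ] H) →⋆ₐ[ℂ] (K →L[ℂ] K) := π.comp (dgH H n) with hρ
  have hρa : ∀ a, ρ a = π (dgo a) := fun _ => rfl
  set e := suppP A ρ with he
  have he1 : e * e = e := supp_idem A ρ
  have he2 : star e = e := supp_star A ρ
  obtain ⟨v, hvM, hvv⟩ := exists_pi_family A hA ρ n
  have hve : ∀ k, v k * e = v k := by
    intro k
    have h0 : star (v k * (1 - e)) * (v k * (1 - e)) = 0 := by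
      have : star (v k * (1 - e)) * (v k * (1 - e)) = (1 - e) * (star (v k) * v k) * (1 - e) := by
        rw [star_mul, star_sub, star_one, he2]; noncomm_ring
      rw [this, hvv, if_pos rfl, ← he]
      have : (1 - e) * e = 0 := by rw [sub_mul, one_mul, he1, sub_self]
      rw [this, zero_mul]
    rw [CStarRing.star_mul_self_eq_zero_iff, mul_sub, mul_one, sub_eq_zero] at h0
    exact h0.symm
  have hev : ∀ k, e * v k = v k := fun k => by rw [supp_bic_comm A ρ (hvM k), hve]
  have hF := mun_MU π
  have hFv : ∀ i j k, π (mun H i j) * v k = v k * π (mun H i j) := fun i j k =>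
    mun_bic_comm A π (hvM k) i j
  have hFvs : ∀ i j k, π (mun H i j) * star (v k) = star (v k) * π (mun H i j) := fun i j k =>
    mun_bic_comm A π (star_mem (hvM k)) i j
  set r : K →L[ℂ] K := ∑ k, π (mun H o k) * v k with hr
  have hrr : star r * r = e := by
    rw [hr, star_sum, Finset.sum_mul_sum]
    have h1 : ∀ i j, star (π (mun H o i) * v i) * (π (mun H o j) * v j)
        = if i = j then π (mun H i i) * e else 0 := by
      intro i j
      have : star (π (mun H o i) * v i) * (π (mun H o j) * v j) =
          π (mun H i j) * (star (v i) * v j) := by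
        rw [star_mul, hF.st o i, mul_assoc, ← mul_assoc _ _ (v j), hF.mul, if_pos rfl, ← mul_assoc,
          ← hFvs, mul_assoc]
      rw [this, hvv]
      split_ifs with h
      · subst h; rfl
      · rw [mul_zero]
    simp only [h1, Finset.sum_ite_eq, Finset.mem_univ, if_true]
    rw [← Finset.sum_mul, hF.sum, one_mul]
  have hr1 : ‖r‖ ≤ 1 := norm_le_one_of_star_mul hrr (norm_proj_le he1 he2)
  have hre : r * e = r := by
    rw [hr, Finset.sum_mul]
    exact Finset.sum_congr rfl fun k _ => by rw [mul_assoc, hve]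
  have hrs : r * suppP (matAlg n A) π = r := by
    have h1 : e * (1 - suppP (matAlg n A) π) = 0 := supp_mul_zero A ρ fun a ha => by
      rw [mul_sub, mul_one, hρa, mul_supp _ _ (dgo_mem ha), sub_self]
    rw [mul_sub, mul_one, sub_eq_zero] at h1
    rw [← hre, mul_assoc, ← h1]
  have hrb : r ∈ bic (matAlg n A) π := by
    refine mem_bic _ _ fun m hm => ?_
    have hmv : ∀ k, m * v k = v k * m := fun k =>
      bic_comm A ρ (hvM k) fun a ha => hm _ (dgo_mem ha)
    have hFm : ∀ k, (π (mun H o k) * m - m * π (mun H o k)) * e = 0 := fun k =>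
      mul_supp_zero A ρ fun a ha => by
        rw [sub_mul, sub_eq_zero, mul_assoc, mul_assoc, hρa, ← hm _ (dgo_mem ha), ← mul_assoc,
          ← map_mul, ← dgo_mun, hm _ (dgo_mun_mem ha _ _)]
    rw [hr, Finset.mul_sum, Finset.sum_mul]
    refine Finset.sum_congr rfl fun k _ => ?_
    have h2 := congrArg (fun z => z * v k) (hFm k)
    rw [mul_assoc, hev, zero_mul, sub_mul, sub_eq_zero, mul_assoc, hmv] at h2
    rw [← mul_assoc, ← h2, mul_assoc]
  obtain ⟨a, ha, ha1, hak⟩ := kaplansky (matAlg n A) π (matAlg_closed hAc) hrb hrs hr1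
    (fun k : Fin n => π (mun H k o) Ω) hε
  refine ⟨a, ha, ha1, fun k => ?_⟩
  have h1 : r (π (mun H k o) Ω) = v k Ω := by
    rw [hr, sum_apply, Finset.sum_eq_single k]
    · rw [← mulA, hFv, mul_assoc, hF.mul, if_pos rfl, mulA, hΩ]
    · intro j _ hj
      rw [← mulA, hFv, mul_assoc, hF.mul, if_neg hj, mul_zero]; rfl
    · simp
  have h2 : π (mun H o o) (v k Ω) = v k Ω := by rw [← mulA, hFv, mulA, hΩ]
  have h3 : ‖v k Ω‖ = ‖e Ω‖ := by
    have : ‖v k Ω‖ ^ 2 = ‖e Ω‖ ^ 2 := by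
      rw [norm_sq_star, norm_sq_star, hvv, if_pos rfl, he2, he1]
    exact (sq_eq_sq₀ (norm_nonneg _) (norm_nonneg _)).1 this
  have h4 := hak k
  rw [h1] at h4
  have h5 : ‖π (mun H o o)‖ ≤ 1 := norm_proj_le (by rw [hF.mul, if_pos rfl]) (hF.st o o)
  have h6 : ‖π (mun H o o) (π a (π (mun H k o) Ω) - v k Ω)‖ ≤ ε :=
    ((π (mun H o o)).le_of_opNorm_le h5 _).trans (by rw [one_mul]; exact h4.le)
  rw [map_sub, h2] at h6
  have h7 := norm_sub_norm_le (v k Ω) (π (mun H o o) (π a (π (mun H k o) Ω)))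
  rw [norm_sub_rev] at h7
  rw [← h3]
  linarith

lemma mun_sandwich {n : ℕ} (b : PiLp 2 (fun _ : Fin n => H) →L[ℂ] PiLp 2 (fun _ : Fin n => H))
    (o i k l : Fin n) : mun H o i * b * mun H k l = dgo (ent b i k) * mun H o l := by
  refine ContinuousLinearMap.ext fun v => ?_
  ext m
  rw [mulA, mulA, mulA, dgo_apply, mun_apply, mun_apply]
  split_ifs
  · rfl
  · simp

lemma norm_ent_le {n : ℕ} (b : PiLp 2 (fun _ : Fin n => H) →L[ℂ] PiLp 2 (fun _ : Fin n => H))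
    (i k : Fin n) : ‖ent b i k‖ ≤ ‖b‖ := by
  have h1 : ∀ u : H, ‖sg (ι := Fin n) k u‖ = ‖u‖ := by
    intro u
    have : ‖sg (ι := Fin n) k u‖ ^ 2 = ‖u‖ ^ 2 := by
      rw [PiLp.norm_sq_eq_of_L2]
      simp only [sg_apply]
      rw [Finset.sum_eq_single k]
      · simp
      · intro j _ hj; simp [hj]
      · simp
    exact (sq_eq_sq₀ (norm_nonneg _) (norm_nonneg _)).1 this
  refine ContinuousLinearMap.opNorm_le_bound _ (norm_nonneg _) fun u => ?_
  rw [ent_apply]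
  calc _ ≤ ‖b (sg k u)‖ := PiLp.norm_apply_le _ _
    _ ≤ ‖b‖ * ‖sg (ι := Fin n) k u‖ := b.le_opNorm _
    _ = _ := by rw [h1]

lemma norm_mul_star_le (b : K →L[ℂ] K) : ‖b * star b‖ ≤ ‖b‖ ^ 2 := by
  refine (norm_mul_le _ _).trans ?_
  rw [norm_star, sq]

lemma ent_rsmul {n : ℕ} (c : ℝ) (x : PiLp 2 (fun _ : Fin n => H) →L[ℂ] PiLp 2 (fun _ : Fin n => H))
    (i j : Fin n) : ent (c • x) i j = c • ent x i j := by
  refine ContinuousLinearMap.ext fun u => ?_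
  simp [ent_apply]

lemma ent_neg {n : ℕ} (x : PiLp 2 (fun _ : Fin n => H) →L[ℂ] PiLp 2 (fun _ : Fin n => H))
    (i j : Fin n) : ent (-x) i j = -ent x i j := by
  refine ContinuousLinearMap.ext fun u => ?_
  simp [ent_apply]

lemma compl_proj {p : K →L[ℂ] K} (h1 : p * p = p) (h2 : star p = p) :
    star (1 - p) * (1 - p) = 1 - p := by
  rw [star_sub, star_one, h2]
  simp only [sub_mul, mul_sub, h1, one_mul, mul_one]
  abel

lemma trace_sum {B : NonUnitalStarSubalgebra ℂ (H →L[ℂ] H)} {τ : B → ℂ}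
    (tadd : ∀ x y : B, τ (x + y) = τ x + τ y) {ι : Type*} (s : Finset ι) (c : ι → B) :
    τ (∑ k ∈ s, c k) = ∑ k ∈ s, τ (c k) := by
  classical
  induction s using Finset.induction_on with
  | empty =>
    have := tadd 0 0
    rw [add_zero] at this
    rw [Finset.sum_empty, Finset.sum_empty]
    exact left_eq_add.1 this
  | insert i s hi ih => rw [Finset.sum_insert hi, Finset.sum_insert hi, tadd, ih]

lemma exists_sq {B : NonUnitalStarSubalgebra ℂ (H →L[ℂ] H)} {τ : B → ℂ}
    (tsmul : ∀ (c : ℂ) (x : B), τ (c • x) = c * τ x) (hne : τ ≠ 0)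
    {f : (H →L[ℂ] H) →ₗ[ℝ] ℝ} (fpos : ∀ x, 0 ≤ f (star x * x))
    (fskew : ∀ h, star h = -h → f h = 0)
    (fτ : ∀ b (hb : b ∈ B), f b = (τ ⟨b, hb⟩).re) : ∃ b ∈ B, 0 < f (star b * b) := by
  by_contra hcon
  push Not at hcon
  have hz : ∀ b ∈ B, f b = 0 := by
    intro b hb
    have h0 : f (star b * b) = 0 := le_antisymm (hcon b hb) (fpos b)
    have hs : f (b - star b) = 0 := fskew _ (by rw [star_sub, star_star, neg_sub])
    rw [map_sub, sub_eq_zero] at hs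
    have key : ∀ t : ℝ, 0 ≤ t ^ 2 * f 1 + 2 * t * f b := by
      intro t
      have := fpos (t • 1 + b)
      have e : star (t • (1 : H →L[ℂ] H) + b) * (t • 1 + b)
          = (t ^ 2) • 1 + t • b + t • star b + star b * b := by
        rw [star_add, star_smul, star_one, star_trivial]
        simp only [add_mul, mul_add, smul_mul_assoc, mul_smul_comm, mul_one, one_mul, smul_add,
          smul_smul]
        rw [sq]; abel
      rw [e] at this
      simp only [map_add, map_smul, smul_eq_mul] at this
      rw [h0, ← hs] at this
      linarith
    have f1 : 0 ≤ f 1 := by simpa using fpos 1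
    have k := key (-(f b) / (f 1 + 1))
    have hp : 0 < f 1 + 1 := by linarith
    by_contra hfb
    have hsq : 0 < f b ^ 2 := by positivity
    have e : (-(f b) / (f 1 + 1)) ^ 2 * f 1 + 2 * (-(f b) / (f 1 + 1)) * f b
        = - (f b ^ 2 * (f 1 + 2) / (f 1 + 1) ^ 2) := by
      field_simp; ring
    rw [e] at k
    have : 0 < f b ^ 2 * (f 1 + 2) / (f 1 + 1) ^ 2 := by positivity
    linarith
  apply hne
  funext b
  have hre : ∀ b : B, (τ b).re = 0 := fun b => by rw [← fτ b.1 b.2, hz _ b.2]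
  have h1 := hre (Complex.I • b)
  rw [tsmul] at h1
  refine Complex.ext (by simpa using hre b) ?_
  simpa using h1

set_option maxHeartbeats 1000000 in
theorem no_trace (A B : NonUnitalStarSubalgebra ℂ (H →L[ℂ] H))
    (hAc : IsClosed (A : Set (H →L[ℂ] H))) (hBc : IsClosed (B : Set (H →L[ℂ] H)))
    (hA : ∀ τ : A → ℂ, IsBoundedTrace A τ → τ = 0) {g : ℝ} (hg : 4 * g < 1)
    (hAB : ∀ a ∈ A, ‖a‖ ≤ 1 → ∃ b ∈ B, ‖a - b‖ ≤ g)
    (hBA : ∀ b ∈ B, ‖b‖ ≤ 1 → ∃ a ∈ A, ‖b - a‖ ≤ g)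
    (τ : B → ℂ) (hτ : IsBoundedTrace B τ) : τ = 0 := by
  obtain ⟨f, fpos, fskew, fτ⟩ := trace_ext hBc hτ
  obtain ⟨tadd, tsmul, tcyc, tpos, C0, tC0⟩ := hτ
  by_contra hne
  have hg0 : 0 ≤ g := by
    obtain ⟨b, _, h⟩ := hAB 0 (zero_mem A) (by simp)
    exact (norm_nonneg _).trans h
  have hb0 := exists_sq tsmul hne fpos fskew fτ
  obtain ⟨b0, hb0, hfb0⟩ := hb0
  set C := |C0| with hC
  have hC0 : 0 ≤ C := abs_nonneg _
  have tC : ∀ x : B, ‖τ x‖ ≤ C * ‖(x : H →L[ℂ] H)‖ := fun x =>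
    (tC0 x).trans (by gcongr; exact le_abs_self _)
  obtain ⟨r, hr1, hr2⟩ : ∃ r, 3 * g < r ∧ r < 1 - g := exists_between (by linarith)
  have hr0 : 0 ≤ r := by linarith
  set δ := (1 - g - r) / 2 with hδ
  have hδ0 : 0 < δ := by rw [hδ]; linarith
  have hb0n : 0 < ‖b0‖ := by
    rw [norm_pos_iff]; rintro rfl; simp at hfb0
  -- choose n
  obtain ⟨n, hn⟩ := exists_nat_gt (C * (1 + r) ^ 2 * ‖b0‖ ^ 2 / (δ ^ 2 * f (star b0 * b0)))
  have hnpos : 0 < n := by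
    have : 0 ≤ C * (1 + r) ^ 2 * ‖b0‖ ^ 2 / (δ ^ 2 * f (star b0 * b0)) := by positivity
    exact_mod_cast this.trans_lt hn
  have : NeZero n := ⟨hnpos.ne'⟩
  rw [div_lt_iff₀ (by positivity)] at hn
  let f' : (PiLp 2 (fun _ : Fin n => H) →L[ℂ] PiLp 2 (fun _ : Fin n => H)) →ₗ[ℝ] ℝ :=
    { toFun := fun x => f (ent x 0 0)
      map_add' := fun x y => by rw [ent_add, map_add]
      map_smul' := fun c x => by
        rw [ent_rsmul, map_smul]; rfl }
  have hf' : ∀ x, f' x = f (ent x 0 0) := fun _ => rfl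
  obtain ⟨L, _, _, _, π, Ω, hΩ⟩ := gns_real f' (fun x => by
    rw [hf', ent_mul, map_sum]
    refine Finset.sum_nonneg fun k _ => ?_
    rw [ent_star]; exact fpos _) (fun h hh => by
    rw [hf']
    refine fskew _ ?_
    rw [← ent_star, hh, ent_neg])
  set ρ : (H →L[ℂ] H) →⋆ₐ[ℂ] (L →L[ℂ] L) := π.comp (dgH H n) with hρ
  have hρa : ∀ a, ρ a = π (dgo a) := fun _ => rfl
  have hF := mun_MU π
  have hΩ0 : π (mun H 0 0) Ω = Ω := by
    have h1 := hΩ (1 - mun H 0 0)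
    have h2 : star (1 - mun H (0 : Fin n) 0) * (1 - mun H 0 0) = 1 - mun H 0 0 :=
      compl_proj (by rw [mun_mul, if_pos rfl]) (mun_star 0 0)
    have h3 : ent (1 - mun H (0 : Fin n) 0) 0 0 = 0 := by
      refine ContinuousLinearMap.ext fun u => ?_
      rw [ent_apply, sub_apply, PiLp.sub_apply, mun_apply, if_pos rfl]
      simp
    rw [h2, hf', h3, map_zero, sq_eq_zero_iff, norm_eq_zero, map_sub, map_one, sub_apply,
      sub_eq_zero] at h1
    exact h1.symm
  have hρΩ : ∀ b, ‖ρ b Ω‖ ^ 2 = f (star b * b) := by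
    intro b
    have e : star (dgo b) * dgo b = dgH H n (star b * b) := by
      rw [map_mul, map_star]; rfl
    rw [hρa, hΩ, hf', e]
    congr 1
    refine ContinuousLinearMap.ext fun u => ?_
    rw [ent_apply, dgH_apply, dgo_apply, sg_apply, if_pos rfl]
  set fB := suppP B ρ with hfB
  set e := suppP A ρ with he
  set Ω' := fB Ω with hΩ'
  have hρΩ' : ∀ b ∈ B, ρ b Ω' = ρ b Ω := fun b hb => by rw [hΩ', ← mulA, mul_supp B ρ hb]
  have hfΩ' : fB Ω' = Ω' := by rw [hΩ', ← mulA, supp_idem]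
  have hΩ0' : π (mun H 0 0) Ω' = Ω' := by
    rw [hΩ', ← mulA, mun_bic_comm B π (supp_mem B ρ), mulA, hΩ0]
  have he1 : e * e = e := supp_idem A ρ
  have he2 : star e = e := supp_star A ρ
  have hfe : ‖(1 - e) * fB‖ ≤ g := by
    have := kap_ineq B ρ hBc (R := 0) (S := 1 - e) (c := g) (fun b hb hb1 => by
      obtain ⟨a, ha, hab⟩ := hBA b hb hb1
      have h1 : (1 - e) * ρ b = (1 - e) * ρ (b - a) := by
        rw [map_sub, mul_sub, sub_mul 1 e (ρ a), one_mul, supp_mul A ρ ha, sub_self, sub_zero]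
      have h2 : ‖1 - e‖ ≤ 1 := norm_proj_le
        (by simp only [sub_mul, mul_sub, he1, one_mul, mul_one]; abel) (by rw [star_sub, star_one, he2])
      rw [mul_zero, zero_sub, norm_neg, h1]
      calc _ ≤ ‖1 - e‖ * ‖ρ (b - a)‖ := norm_mul_le _ _
        _ ≤ 1 * ‖b - a‖ := by
          gcongr
          exact NonUnitalStarAlgHom.norm_apply_le ρ (b - a)
        _ ≤ g := by rwa [one_mul]) (supp_mem B ρ) (supp_idem B ρ)
        (norm_proj_le (supp_idem B ρ) (supp_star B ρ))
    rwa [mul_zero, zero_sub, norm_neg] at this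
  have heΩ : (1 - g) * ‖Ω'‖ ≤ ‖e Ω'‖ := by
    have h1 : ‖((1 - e) * fB) Ω'‖ ≤ g * ‖Ω'‖ := ContinuousLinearMap.le_of_opNorm_le _ hfe _
    rw [mulA, hfΩ', sub_apply] at h1
    have h2 := norm_sub_norm_le Ω' (e Ω')
    have h3 : (1 : L →L[ℂ] L) Ω' = Ω' := rfl
    rw [h3] at h1
    linarith
  have hΩ'n : f (star b0 * b0) ≤ ‖b0‖ ^ 2 * ‖Ω'‖ ^ 2 := by
    rw [← hρΩ, ← hρΩ' b0 hb0, ← mul_pow]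
    gcongr
    exact (ρ b0).le_of_opNorm_le (NonUnitalStarAlgHom.norm_apply_le ρ b0) _
  have hΩ'0 : 0 < ‖Ω'‖ := by
    rcases (norm_nonneg Ω').eq_or_lt with h | h
    · rw [← h] at hΩ'n; norm_num at hΩ'n; linarith
    · exact h
  obtain ⟨a, ha, ha1, hak⟩ := row_approx A hAc hA (0 : Fin n) π hΩ0'
    (ε := δ * ‖Ω'‖) (by positivity)
  obtain ⟨b, hb, hab⟩ := dist_main A B hAc hA hAB ha ha1 hr1
  have hbn : ‖b‖ ≤ 1 + r := by
    have := norm_sub_norm_le b a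
    rw [norm_sub_rev] at this
    linarith
  have hbk : ∀ k, (δ * ‖Ω'‖) ^ 2 ≤ (τ (⟨ent b 0 k, mem_matAlg.1 hb 0 k⟩ *
      star ⟨ent b 0 k, mem_matAlg.1 hb 0 k⟩)).re := by
    intro k
    set bk : B := ⟨ent b 0 k, mem_matAlg.1 hb 0 k⟩ with hbk
    have h1 : π (mun H 0 0) (π b (π (mun H k 0) Ω')) = ρ (ent b 0 k) Ω' := by
      rw [← mulA, ← mulA, ← map_mul, ← map_mul, mun_sandwich, map_mul, mulA, hΩ0', hρa]
    have h2 : ‖π (mun H 0 0) (π a (π (mun H k 0) Ω')) - π (mun H 0 0) (π b (π (mun H k 0) Ω'))‖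
        ≤ r * ‖Ω'‖ := by
      rw [← map_sub, ← sub_apply, ← map_sub]
      have n1 : ‖π (mun H (0 : Fin n) 0)‖ ≤ 1 :=
        norm_proj_le (by rw [hF.mul, if_pos rfl]) (hF.st 0 0)
      have n2 : ‖π (mun H k 0)‖ ≤ 1 := norm_le_one_of_star_mul
        (by rw [hF.st, hF.mul, if_pos rfl]) n1
      have n3 : ‖π (a - b)‖ ≤ r := (NonUnitalStarAlgHom.norm_apply_le π (a - b)).trans hab.le
      calc _ ≤ 1 * ‖π (a - b) (π (mun H k 0) Ω')‖ := ContinuousLinearMap.le_of_opNorm_le _ n1 _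
        _ ≤ 1 * (r * (1 * ‖Ω'‖)) := by
          gcongr
          refine (ContinuousLinearMap.le_of_opNorm_le _ n3 _).trans ?_
          gcongr
          exact ContinuousLinearMap.le_of_opNorm_le _ n2 _
        _ = _ := by ring
    rw [h1] at h2
    have h3 := hak k
    have h4 := norm_sub_norm_le (π (mun H 0 0) (π a (π (mun H k 0) Ω'))) (ρ (ent b 0 k) Ω')
    have h5 : δ * ‖Ω'‖ ≤ ‖ρ (ent b 0 k) Ω'‖ := by
      have : δ * ‖Ω'‖ = (1 - g) * ‖Ω'‖ - r * ‖Ω'‖ - δ * ‖Ω'‖ := by rw [hδ]; ring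
      linarith
    rw [← tcyc]
    have h6 : (τ (star bk * bk)).re = ‖ρ (ent b 0 k) Ω'‖ ^ 2 := by
      rw [hρΩ' _ bk.2, hρΩ, fτ _ (mul_mem (star_mem bk.2) bk.2)]; rfl
    rw [h6]
    gcongr
  have hsum := Finset.sum_le_sum fun k (_ : k ∈ Finset.univ) => hbk k
  rw [Finset.sum_const, Finset.card_univ, Fintype.card_fin, nsmul_eq_mul, ← Complex.re_sum,
    ← trace_sum tadd] at hsum
  have hup := (Complex.re_le_norm _).trans (tC (∑ k, (⟨ent b 0 k, mem_matAlg.1 hb 0 k⟩ *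
      star ⟨ent b 0 k, mem_matAlg.1 hb 0 k⟩ : B)))
  have hent : ((∑ k, (⟨ent b 0 k, mem_matAlg.1 hb 0 k⟩ *
      star ⟨ent b 0 k, mem_matAlg.1 hb 0 k⟩ : B) : B) : H →L[ℂ] H) = ent (b * star b) 0 0 := by
    rw [ent_mul, AddSubmonoidClass.coe_finsetSum]
    refine Finset.sum_congr rfl fun k _ => ?_
    rw [ent_star]; rfl
  rw [hent] at hup
  have hfin : (n : ℝ) * (δ * ‖Ω'‖) ^ 2 ≤ C * (1 + r) ^ 2 := by
    refine (hsum.trans hup).trans ?_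
    gcongr
    calc _ ≤ ‖b * star b‖ := norm_ent_le _ _ _
      _ ≤ ‖b‖ ^ 2 := norm_mul_star_le b
      _ ≤ _ := by gcongr
  have : (n : ℝ) * (δ ^ 2 * f (star b0 * b0)) ≤ C * (1 + r) ^ 2 * ‖b0‖ ^ 2 := by
    calc _ ≤ (n : ℝ) * (δ ^ 2 * (‖b0‖ ^ 2 * ‖Ω'‖ ^ 2)) := by gcongr
      _ = (n : ℝ) * (δ * ‖Ω'‖) ^ 2 * ‖b0‖ ^ 2 := by ring
      _ ≤ _ := by gcongr
  linarith

end VN19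

set_option linter.unusedSectionVars false

section VN20
universe u
variable {H : Type u} [NormedAddCommGroup H] [InnerProductSpace ℂ H] [CompleteSpace H]

lemma near_of_KK {S T : Set (H →L[ℂ] H)} (hS : (0 : H →L[ℂ] H) ∈ S) (hT : (0 : H →L[ℂ] H) ∈ T)
    {g : ℝ} (h : KKdist S T < g) : ∀ a ∈ S, ‖a‖ ≤ 1 → ∃ b ∈ T, ‖a - b‖ ≤ g := by
  intro a ha ha1
  have fin : hausdorffEDist (S ∩ closedBall 0 1) (T ∩ closedBall 0 1) ≠ ⊤ :=
    hausdorffEDist_ne_top_of_nonempty_of_bounded ⟨0, hS, by simp⟩ ⟨0, hT, by simp⟩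
      (isBounded_closedBall.subset Set.inter_subset_right)
      (isBounded_closedBall.subset Set.inter_subset_right)
  have haS : a ∈ S ∩ closedBall 0 1 := ⟨ha, by simpa using ha1⟩
  obtain ⟨b, hb, hd⟩ := exists_dist_lt_of_hausdorffDist_lt haS h fin
  exact ⟨b, hb.1, by rw [← dist_eq_norm]; exact hd.le⟩

lemma normalise {E : Type*} [NormedAddCommGroup E] [NormedSpace ℂ E] {x y : E} (hx : ‖x‖ ≤ 1)
    {r : ℝ} (h : ‖x - y‖ ≤ r) : ∃ c : ℂ, ‖c • y‖ ≤ 1 ∧ ‖x - c • y‖ ≤ 2 * r := by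
  have hr : 0 ≤ r := (norm_nonneg _).trans h
  rcases le_or_gt ‖y‖ 1 with hy | hy
  · exact ⟨1, by simpa using hy, by rw [one_smul]; linarith⟩
  · have hy0 : 0 < ‖y‖ := by linarith
    refine ⟨((‖y‖⁻¹ : ℝ) : ℂ), ?_, ?_⟩
    · rw [norm_smul, Complex.norm_real, norm_inv, norm_norm, inv_mul_cancel₀ hy0.ne']
    · have h1 : ‖y - ((‖y‖⁻¹ : ℝ) : ℂ) • y‖ = ‖y‖ - 1 := by
        have : y - ((‖y‖⁻¹ : ℝ) : ℂ) • y = ((1 - ‖y‖⁻¹ : ℝ) : ℂ) • y := by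
          push_cast; rw [sub_smul, one_smul]
        rw [this, norm_smul, Complex.norm_real, Real.norm_of_nonneg, sub_mul, one_mul,
          inv_mul_cancel₀ hy0.ne']
        have := inv_le_one_of_one_le₀ hy.le
        linarith
      have h2 : ‖y‖ - ‖x‖ ≤ r := by
        have := norm_sub_norm_le y x
        rw [norm_sub_rev] at this; linarith
      calc _ ≤ ‖x - y‖ + ‖y - ((‖y‖⁻¹ : ℝ) : ℂ) • y‖ := norm_sub_le_norm_sub_add_norm_sub _ _ _
        _ ≤ _ := by rw [h1]; linarith

lemma near_mat (A B : NonUnitalStarSubalgebra ℂ (H →L[ℂ] H))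
    (hAc : IsClosed (A : Set (H →L[ℂ] H)))
    (hA : ∀ τ : A → ℂ, IsBoundedTrace A τ → τ = 0) {g r : ℝ} (hgr : 3 * g < r) (n : ℕ)
    (hr : 0 ≤ r) (hAB : ∀ a ∈ A, ‖a‖ ≤ 1 → ∃ b ∈ B, ‖a - b‖ ≤ g) :
    ∀ x ∈ MatrixAmp n A ∩ closedBall 0 1, ∃ y ∈ MatrixAmp n B ∩ closedBall 0 1,
      dist x y ≤ 2 * r := by
  rintro x ⟨hx, hx1⟩
  have hx1 : ‖x‖ ≤ 1 := by simpa using hx1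
  have : ∃ y ∈ matAlg n B, ‖x - y‖ ≤ r := by
    rcases Nat.eq_zero_or_pos n with rfl | hn
    · refine ⟨0, zero_mem _, ?_⟩
      have : x = 0 := by
        refine ContinuousLinearMap.ext fun u => ?_
        ext i; exact i.elim0
      rw [this]; simpa using hr
    · have : NeZero n := ⟨hn.ne'⟩
      obtain ⟨y, hy, h⟩ := dist_main A B hAc hA hAB (x := x) hx hx1 hgr
      exact ⟨y, hy, h.le⟩
  obtain ⟨y, hy, hxy⟩ := this
  obtain ⟨c, hc1, hc2⟩ := normalise hx1 hxy
  refine ⟨c • y, ⟨SMulMemClass.smul_mem (s := matAlg n B) c hy, by simpa using hc1⟩, ?_⟩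
  rwa [dist_eq_norm]

end VN20


theorem stmt11 (A B : NonUnitalStarSubalgebra ℂ (H →L[ℂ] H))
    (hAc : IsClosed (A : Set (H →L[ℂ] H))) (hBc : IsClosed (B : Set (H →L[ℂ] H)))
    (hAnd : Nondegenerate A) (hBnd : Nondegenerate B)
    (γ : ℝ) (hγ : γ < 1 / (2 + 6 * Real.sqrt 2))
    (hd : KKdist (A : Set (H →L[ℂ] H)) (B : Set (H →L[ℂ] H)) < γ)
    (hA : ∀ τ : A → ℂ, IsBoundedTrace A τ → τ = 0) :
    (∀ τ : B → ℂ, IsBoundedTrace B τ → τ = 0) ∧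
      ∀ n : ℕ, KKdist (MatrixAmp n A) (MatrixAmp n B) < 6 * γ := by
  obtain ⟨g, hg1, hg2⟩ := exists_between hd
  have hg0 : 0 < g := lt_of_le_of_lt hausdorffDist_nonneg hg1
  have hAB := near_of_KK (zero_mem A) (zero_mem B) hg1
  have hBA := near_of_KK (zero_mem B) (zero_mem A)
    (show KKdist (B : Set (H →L[ℂ] H)) (A : Set (H →L[ℂ] H)) < g by
      rw [KKdist, hausdorffDist_comm]; exact hg1)
  have hγ4 : 4 * g < 1 := by
    have h1 : (1 : ℝ) ≤ Real.sqrt 2 := Real.one_le_sqrt.2 (by norm_num)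
    have h2 : 1 / (2 + 6 * Real.sqrt 2) ≤ 1 / 8 :=
      one_div_le_one_div_of_le (by norm_num) (by linarith)
    linarith
  have hB := no_trace A B hAc hBc hA hγ4 hAB hBA
  refine ⟨hB, fun n => ?_⟩
  obtain ⟨r, hr1, hr2⟩ : ∃ r, 3 * g < r ∧ r < 3 * γ := exists_between (by linarith)
  have hr0 : 0 ≤ r := by linarith
  have := hausdorffDist_le_of_mem_dist (r := 2 * r) (by linarith)
    (near_mat A B hAc hA hr1 n hr0 hAB) (near_mat B A hBc hB hr1 n hr0 hBA)
  rw [KKdist]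
  linarith
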